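/- There exist universal constants c₁, c₂, C > 0 such that the following holds. Let X be an isotropic random vector in ℝⁿ with log-concave density which is ψ_α (α ∈ [1,2]) with constant b_α, and let A be an n×n real matrix with ‖A‖_HS² = n. Set ñ := n/(‖A‖_op²·b_α²). Then for every real p ≠ 0 with c₁·ñ^{α/(2(α+2))} ≤ |p−2| ≤ c₂·ñ^{α/2}: 1 − C·(|p−2|/ñ^{α/2})^{1/(α+1)} ≤ (E|AX|^p)^{1/p} / (E|AX|²)^{1/2} ≤ 1 + C·(|p−2|/ñ^{α/2})^{1/(α+1)}. -/

import Mathlib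

open MeasureTheory ProbabilityTheory Real
open scoped ENNReal RealInnerProductSpace Pointwise NNReal

noncomputable section

/-- A nonnegative function is log-concave if `f(λx+(1-λ)y) ≥ f(x)^λ f(y)^{1-λ}`. -/
def IsLogConcaveFn {E : Type*} [AddCommGroup E] [Module ℝ E] (f : E → ℝ) : Prop :=
  (∀ x, 0 ≤ f x) ∧
  ∀ x y : E, ∀ l : ℝ, 0 ≤ l → l ≤ 1 →
    f x ^ l * f y ^ (1 - l) ≤ f (l • x + (1 - l) • y)

/-- Hilbert-Schmidt (Frobenius) norm of a matrix. -/
def hsNorm {n : ℕ} (A : Matrix (Fin n) (Fin n) ℝ) : ℝ :=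
  Real.sqrt (∑ i, ∑ j, (A i j) ^ 2)

/-- Operator norm of a matrix acting on Euclidean space. -/
def opNorm {n : ℕ} (A : Matrix (Fin n) (Fin n) ℝ) : ℝ :=
  ‖LinearMap.toContinuousLinearMap (Matrix.toEuclideanLin A)‖

/-- Application of a matrix to a Euclidean vector. -/
def mApp {n : ℕ} (A : Matrix (Fin n) (Fin n) ℝ) (x : EuclideanSpace ℝ (Fin n)) :
    EuclideanSpace ℝ (Fin n) := Matrix.toEuclideanLin A x

/-- The random vector `X` has density `f` with respect to Lebesgue measure. -/
def HasDensityFn {Ω : Type*} [MeasurableSpace Ω] (P : Measure Ω) {n : ℕ}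
    (X : Ω → EuclideanSpace ℝ (Fin n)) (f : EuclideanSpace ℝ (Fin n) → ℝ) : Prop :=
  Measurable X ∧ Measure.map X P = volume.withDensity fun x => ENNReal.ofReal (f x)

/-- `X` is isotropic: centered with identity covariance. -/
def Isotropic {Ω : Type*} [MeasurableSpace Ω] (P : Measure Ω) {n : ℕ}
    (X : Ω → EuclideanSpace ℝ (Fin n)) : Prop :=
  (∫ ω, X ω ∂P) = 0 ∧
  ∀ θ η : EuclideanSpace ℝ (Fin n), (∫ ω, ⟪X ω, θ⟫ * ⟪X ω, η⟫ ∂P) = ⟪θ, η⟫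

/-- `X` is ψ_α with constant `b`. -/
def IsPsiAlpha {Ω : Type*} [MeasurableSpace Ω] (P : Measure Ω) {n : ℕ}
    (X : Ω → EuclideanSpace ℝ (Fin n)) (α b : ℝ) : Prop :=
  ∀ p : ℝ, 2 ≤ p → ∀ y : EuclideanSpace ℝ (Fin n),
    (∫ ω, |⟪X ω, y⟫| ^ p ∂P) ^ (1/p) ≤ b * p ^ (1/α) * (∫ ω, ⟪X ω, y⟫ ^ 2 ∂P) ^ ((1:ℝ)/2)

/-- `G` is a standard Gaussian random vector in `ℝⁿ`. -/
def IsStdGaussian {Ω : Type*} [MeasurableSpace Ω] (P : Measure Ω) {n : ℕ}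
    (G : Ω → EuclideanSpace ℝ (Fin n)) : Prop :=
  Measurable G ∧
  Measure.map G P = volume.withDensity fun x =>
    ENNReal.ofReal ((2 * π) ^ (-(n:ℝ)/2) * Real.exp (-‖x‖ ^ 2 / 2))

/-- Surface area of the unit sphere `S^{k-1}` in `ℝᵏ`. -/
def sphereVol (k : ℕ) : ℝ := 2 * π ^ ((k : ℝ)/2) / Real.Gamma ((k : ℝ)/2)

/-- The marginal density `π_F g(x) = ∫_{F^⊥} g(x+y) dy`. -/
def marginalDensity {n : ℕ} (g : EuclideanSpace ℝ (Fin n) → ℝ)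
    (F : Submodule ℝ (EuclideanSpace ℝ (Fin n))) (x : EuclideanSpace ℝ (Fin n)) : ℝ :=
  ∫ y : Fᗮ, g (x + y)

/-- `h_{k,p}(u) = vol(S^{k-1}) ∫₀^∞ t^{p+k-1} π_{u(E₀)} g(t u(θ₀)) dt`. -/
def hkp {n : ℕ} (g : EuclideanSpace ℝ (Fin n) → ℝ)
    (E₀ : Submodule ℝ (EuclideanSpace ℝ (Fin n))) (θ₀ : EuclideanSpace ℝ (Fin n))
    (k : ℕ) (p : ℝ) (u : Matrix (Fin n) (Fin n) ℝ) : ℝ :=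
  sphereVol k * ∫ t in Set.Ioi (0:ℝ), t ^ (p + (k:ℝ) - 1) *
    marginalDensity g (Submodule.map (Matrix.toEuclideanLin u) E₀) (t • mApp u θ₀)

/-- Support functional of the one-sided L_q-centroid body `Z⁺_q(w)`. -/
def suppZplus {m : ℕ} (w : EuclideanSpace ℝ (Fin m) → ℝ) (q : ℝ)
    (y : EuclideanSpace ℝ (Fin m)) : ℝ :=
  (2 * ∫ x, (max ⟪x, y⟫ 0) ^ q * w x) ^ (1/q)

/-- Ball's body `K_q(w) = {x : q ∫₀^∞ t^{q-1} w(tx) dt ≥ 1}`. -/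
def ballBody {m : ℕ} (w : EuclideanSpace ℝ (Fin m) → ℝ) (q : ℝ) :
    Set (EuclideanSpace ℝ (Fin m)) :=
  {x | 1 ≤ q * ∫ t in Set.Ioi (0:ℝ), t ^ (q-1) * w (t • x)}

/-- The one-sided L_q-centroid body `Z⁺_q(w)`, as the convex set with support
functional `suppZplus w q`. -/
def ZplusBody {m : ℕ} (w : EuclideanSpace ℝ (Fin m) → ℝ) (q : ℝ) :
    Set (EuclideanSpace ℝ (Fin m)) :=
  {x | ∀ y, ⟪x, y⟫ ≤ suppZplus w q y}

namespace GM

/-- midpoint Prekopa-Leindler property with cost. -/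
def PLM {E : Type*} [AddCommGroup E] [Module ℝ E] [MeasurableSpace E] (μ : Measure E)
    (c : E → E → ℝ≥0∞) : Prop :=
  ∀ u v w : E → ℝ≥0∞, Measurable u → Measurable v → Measurable w →
    (∀ x y, u x * v y ≤ c x y * w ((1/2:ℝ) • (x + y)) ^ 2) →
    (∫⁻ x, u x ∂μ) * (∫⁻ x, v x ∂μ) ≤ (∫⁻ x, w x ∂μ) ^ 2

lemma ennreal_amgm {x y z : ℝ≥0∞} (h : x + y ≤ 2 * z) : x * y ≤ z ^ 2 := by
  rcases eq_or_ne z ⊤ with rfl | hz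
  · simp
  have hxy : x + y ≠ ⊤ := ne_top_of_le_ne_top (ENNReal.mul_ne_top (by simp) hz) h
  have hx : x ≠ ⊤ := fun hh => hxy (by simp [hh])
  have hy : y ≠ ⊤ := fun hh => hxy (by simp [hh])
  lift x to ℝ≥0 using hx
  lift y to ℝ≥0 using hy
  lift z to ℝ≥0 using hz
  norm_cast at h ⊢
  have h' : (x:ℝ) + y ≤ 2 * z := by exact_mod_cast h
  have : (x:ℝ) * y ≤ z ^ 2 := by nlinarith [sq_nonneg ((x:ℝ) - y), x.2, y.2, z.2, x.coe_nonneg, y.coe_nonneg, z.coe_nonneg]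
  exact_mod_cast this

lemma bm_compact {A B C : Set ℝ} (hA : IsCompact A) (hB : IsCompact B) (hA0 : A.Nonempty)
    (hB0 : B.Nonempty) (h : ∀ x ∈ A, ∀ y ∈ B, (1/2:ℝ) * (x + y) ∈ C) :
    volume A + volume B ≤ 2 * volume C := by
  have ha := hA.sSup_mem hA0
  have hb := hB.sInf_mem hB0
  set a := sSup A
  set b := sInf B
  have h1 : (fun x => b + x) '' A ∪ (fun x => a + x) '' B ⊆ (2:ℝ) • C := by
    rintro z (⟨x, hx, rfl⟩ | ⟨y, hy, rfl⟩)
    · exact ⟨(1/2) * (x + b), h x hx b hb, by simp; ring⟩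
    · exact ⟨(1/2) * (a + y), h a ha y hy, by simp⟩
  have h2 : volume ((fun x => b + x) '' A ∪ (fun x => a + x) '' B) = volume A + volume B := by
    rw [measure_union₀]
    · rw [Set.image_add_left, Set.image_add_left, measure_preimage_add, measure_preimage_add]
    · have := (hB.image (by fun_prop : Continuous fun x => a + x)).measurableSet
      exact this.nullMeasurableSet
    · refine measure_mono_null (t := {a + b}) ?_ (by simp)
      rintro z ⟨⟨x, hx, rfl⟩, ⟨y, hy, hz⟩⟩
      have e1 : x ≤ a := le_csSup hA.bddAbove hx
      have e2 : b ≤ y := csInf_le hB.bddBelow hy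
      simp at hz ⊢
      linarith
  rw [← h2]
  refine (measure_mono h1).trans ?_
  rw [Measure.addHaar_smul]
  simp

lemma bm_one {A B C : Set ℝ} (hA : MeasurableSet A) (hB : MeasurableSet B) (hA0 : A.Nonempty)
    (hB0 : B.Nonempty) (h : ∀ x ∈ A, ∀ y ∈ B, (1/2:ℝ) * (x + y) ∈ C) :
    volume A + volume B ≤ 2 * volume C := by
  obtain ⟨a, ha⟩ := hA0
  obtain ⟨b, hb⟩ := hB0
  rw [hA.measure_eq_iSup_isCompact, hB.measure_eq_iSup_isCompact]
  simp only [iSup_and']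
  refine ENNReal.biSup_add_biSup_le' ⟨∅, by simp⟩ ⟨∅, by simp⟩ ?_
  rintro K ⟨hK, hKc⟩ L ⟨hL, hLc⟩
  refine le_trans (add_le_add (measure_mono (Set.subset_insert a K))
    (measure_mono (Set.subset_insert b L))) ?_
  refine bm_compact (hKc.insert a) (hLc.insert b) ⟨a, by simp⟩ ⟨b, by simp⟩ ?_
  intro x hx y hy
  refine h x ?_ y ?_
  · rcases hx with rfl | hx
    exacts [ha, hK hx]
  · rcases hy with rfl | hy
    exacts [hb, hL hy]

lemma pl_unit {u v w : ℝ → ℝ} (hu : Measurable u) (hv : Measurable v)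
    (hw : Measurable w) (hu0 : ∀ x, 0 ≤ u x) (hv0 : ∀ x, 0 ≤ v x) (hw0 : ∀ x, 0 ≤ w x)
    (hu1 : ∀ x, u x ≤ 1) (hv1 : ∀ x, v x ≤ 1)
    (hus : ∀ t < 1, ∃ x, t < u x) (hvs : ∀ t < 1, ∃ x, t < v x)
    (h : ∀ x y, u x * v y ≤ w ((1/2:ℝ) * (x + y)) ^ 2) :
    (∫⁻ x, ENNReal.ofReal (u x)) + (∫⁻ x, ENNReal.ofReal (v x))
      ≤ 2 * ∫⁻ x, ENNReal.ofReal (w x) := by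
  rw [lintegral_eq_lintegral_meas_lt _ (Filter.Eventually.of_forall hu0) hu.aemeasurable,
    lintegral_eq_lintegral_meas_lt _ (Filter.Eventually.of_forall hv0) hv.aemeasurable,
    lintegral_eq_lintegral_meas_lt _ (Filter.Eventually.of_forall hw0) hw.aemeasurable]
  have anti : ∀ (f : ℝ → ℝ), Measurable fun t : ℝ => volume {a | t < f a} := by
    intro f
    apply Antitone.measurable
    intro s t hst
    exact measure_mono fun x (hx : t < f x) => lt_of_le_of_lt hst hx
  rw [← lintegral_add_left (anti u), ← lintegral_const_mul _ (anti w)]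
  refine setLIntegral_mono ((anti w).const_mul 2) ?_
  intro t ht
  have ht0 : (0:ℝ) < t := ht
  by_cases ht1 : t < 1
  · refine bm_one (measurableSet_lt measurable_const hu) (measurableSet_lt measurable_const hv)
      (hus t ht1) (hvs t ht1) ?_
    intro x hx y hy
    simp only [Set.mem_ofPred_eq] at hx hy ⊢
    have := h x y
    have h2 : t * t < w (1 / 2 * (x + y)) ^ 2 := by nlinarith
    nlinarith [hw0 (1 / 2 * (x + y))]
  · have e1 : {a | t < u a} = ∅ := by
      ext x; simp; linarith [hu1 x]
    have e2 : {a | t < v a} = ∅ := by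
      ext x; simp; linarith [hv1 x]
    simp [e1, e2]

lemma plm_scale {E : Type*} [AddCommGroup E] [Module ℝ E] [MeasurableSpace E] {μ : Measure E}
    {c : E → E → ℝ≥0∞} (hμ : PLM μ c) {K : ℝ≥0∞} (hK0 : K ≠ 0) (hK : K ≠ ⊤)
    {u v w : E → ℝ≥0∞} (hu : Measurable u) (hv : Measurable v) (hw : Measurable w)
    (h : ∀ x y, u x * v y ≤ K * c x y * w ((1/2:ℝ) • (x + y)) ^ 2) :
    (∫⁻ x, u x ∂μ) * (∫⁻ x, v x ∂μ) ≤ K * (∫⁻ x, w x ∂μ) ^ 2 := by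
  have := hμ (fun x => K⁻¹ * u x) v w (hu.const_mul _) hv hw (fun x y => by
    calc K⁻¹ * u x * v y = K⁻¹ * (u x * v y) := by ring
      _ ≤ K⁻¹ * (K * c x y * w ((1/2:ℝ) • (x + y)) ^ 2) := by exact mul_le_mul' le_rfl (h x y)
      _ = (K⁻¹ * K) * (c x y * w ((1/2:ℝ) • (x + y)) ^ 2) := by ring
      _ = _ := by rw [ENNReal.inv_mul_cancel hK0 hK, one_mul])
  rw [lintegral_const_mul _ hu, mul_assoc] at this
  calc _ = K * (K⁻¹ * ((∫⁻ x, u x ∂μ) * (∫⁻ x, v x ∂μ))) := by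
        rw [← mul_assoc, ENNReal.mul_inv_cancel hK0 hK, one_mul]
    _ ≤ _ := by gcongr

lemma pl_bdd {u v w : ℝ → ℝ≥0∞} (hu : Measurable u) (hv : Measurable v)
    (hw : Measurable w) {N : ℝ≥0∞} (hN : N ≠ ⊤) (hu1 : ∀ x, u x ≤ N) (hv1 : ∀ x, v x ≤ N)
    (h : ∀ x y, u x * v y ≤ w ((1/2:ℝ) * (x + y)) ^ 2) :
    (∫⁻ x, u x) * (∫⁻ x, v x) ≤ (∫⁻ x, w x) ^ 2 := by
  set a := ⨆ x, u x with ha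
  set b := ⨆ x, v x with hb
  have haN : a ≤ N := iSup_le hu1
  have hbN : b ≤ N := iSup_le hv1
  have hat : a ≠ ⊤ := ne_top_of_le_ne_top hN haN
  have hbt : b ≠ ⊤ := ne_top_of_le_ne_top hN hbN
  rcases eq_or_ne a 0 with ha0 | ha0
  · have : ∀ x, u x = 0 := by simpa [ha] using ha0
    simp [this]
  rcases eq_or_ne b 0 with hb0 | hb0
  · have : ∀ x, v x = 0 := by simpa [hb] using hb0
    simp [this]
  lift a to ℝ≥0 using hat with a' 
  lift b to ℝ≥0 using hbt with b'
  have ha' : (0:ℝ) < a' := by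
    have : a' ≠ 0 := by exact_mod_cast ha0
    exact_mod_cast pos_iff_ne_zero.mpr this
  have hb' : (0:ℝ) < b' := by
    have : b' ≠ 0 := by exact_mod_cast hb0
    exact_mod_cast pos_iff_ne_zero.mpr this
  have hua : ∀ x, u x ≤ a' := fun x => by rw [ha]; exact le_iSup u x
  have hvb : ∀ x, v x ≤ b' := fun x => by rw [hb]; exact le_iSup v x
  have hut : ∀ x, u x ≠ ⊤ := fun x => ne_top_of_le_ne_top ENNReal.coe_ne_top (hua x)
  have hvt : ∀ x, v x ≠ ⊤ := fun x => ne_top_of_le_ne_top ENNReal.coe_ne_top (hvb x)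
  set s : ℝ := Real.sqrt (a' * b') with hs
  have hs0 : 0 < s := Real.sqrt_pos.mpr (by positivity)
  have hs2 : s ^ 2 = a' * b' := Real.sq_sqrt (by positivity)
  set w' : ℝ → ℝ≥0∞ := fun x => min (w x) (ENNReal.ofReal s) with hw'
  have hw't : ∀ x, w' x ≠ ⊤ := fun x => ne_top_of_le_ne_top ENNReal.ofReal_ne_top (min_le_right _ _)
  have hw'm : Measurable w' := hw.min measurable_const
  have h' : ∀ x y, u x * v y ≤ w' ((1/2:ℝ) * (x + y)) ^ 2 := by
    intro x y
    rcases le_total (w ((1/2:ℝ) * (x + y))) (ENNReal.ofReal s) with hh | hh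
    · simp only [hw', min_eq_left hh]; exact h x y
    · simp only [hw', min_eq_right hh]
      rw [← ENNReal.ofReal_pow hs0.le, hs2, ENNReal.ofReal_mul ha'.le]
      simp only [ENNReal.ofReal_coe_nnreal]
      gcongr
      exacts [hua x, hvb y]
  have key := pl_unit (u := fun x => (u x).toReal / a') (v := fun x => (v x).toReal / b')
    (w := fun x => (w' x).toReal / s) (hu.ennreal_toReal.div_const _)
    (hv.ennreal_toReal.div_const _) (hw'm.ennreal_toReal.div_const _)
    (fun x => by positivity) (fun x => by positivity) (fun x => by positivity)
    (fun x => by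
      rw [div_le_one ha']
      exact ENNReal.toReal_le_of_le_ofReal ha'.le (by simpa using hua x))
    (fun x => by
      rw [div_le_one hb']
      exact ENNReal.toReal_le_of_le_ofReal hb'.le (by simpa using hvb x))
    (fun t ht => by
      have : ENNReal.ofReal (t * a') < ⨆ x, u x := by
        rw [← ha, ← ENNReal.ofReal_coe_nnreal]
        rw [ENNReal.ofReal_lt_ofReal_iff ha']
        nlinarith
      obtain ⟨x, hx⟩ := lt_iSup_iff.mp this
      refine ⟨x, ?_⟩
      rw [lt_div_iff₀ ha']
      by_contra hcon
      rw [not_lt] at hcon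
      have h3 := ENNReal.ofReal_le_ofReal hcon
      rw [ENNReal.ofReal_toReal (hut x)] at h3
      exact absurd hx (not_lt.mpr h3))
    (fun t ht => by
      have : ENNReal.ofReal (t * b') < ⨆ x, v x := by
        rw [← hb, ← ENNReal.ofReal_coe_nnreal]
        rw [ENNReal.ofReal_lt_ofReal_iff hb']
        nlinarith
      obtain ⟨x, hx⟩ := lt_iSup_iff.mp this
      refine ⟨x, ?_⟩
      rw [lt_div_iff₀ hb']
      by_contra hcon
      rw [not_lt] at hcon
      have h3 := ENNReal.ofReal_le_ofReal hcon
      rw [ENNReal.ofReal_toReal (hvt x)] at h3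
      exact absurd hx (not_lt.mpr h3))
    (fun x y => by
      have := ENNReal.toReal_mono (by simpa using hw't _) (h' x y)
      rw [ENNReal.toReal_mul, ENNReal.toReal_pow] at this
      rw [div_pow, hs2, div_mul_div_comm]
      gcongr)
  have e : ∀ (f : ℝ → ℝ≥0∞) (_ : Measurable f) (_ : ∀ x, f x ≠ ⊤) (r : ℝ) (_ : 0 < r),
      ∫⁻ x, f x = ENNReal.ofReal r * ∫⁻ x, ENNReal.ofReal ((f x).toReal / r) := by
    intro f hf hft r hr
    rw [← lintegral_const_mul _ (by fun_prop)]
    congr 1; ext x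
    rw [← ENNReal.ofReal_mul hr.le, mul_div_cancel₀ _ hr.ne', ENNReal.ofReal_toReal (hft x)]
  have key2 := ennreal_amgm key
  calc (∫⁻ x, u x) * (∫⁻ x, v x) = ENNReal.ofReal (s^2) * ((∫⁻ x, ENNReal.ofReal ((u x).toReal / a')) *
        ∫⁻ x, ENNReal.ofReal ((v x).toReal / b')) := by
        rw [e u hu hut a' ha', e v hv hvt b' hb', hs2, ENNReal.ofReal_mul ha'.le]; ring
    _ ≤ ENNReal.ofReal (s^2) * (∫⁻ x, ENNReal.ofReal ((w' x).toReal / s))^2 := by gcongr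
    _ = (∫⁻ x, w' x)^2 := by
      rw [e w' hw'm hw't s hs0, mul_pow, ENNReal.ofReal_pow hs0.le]
    _ ≤ _ := by
      gcongr
      exact min_le_left _ _

lemma lintegral_trunc {E : Type*} [MeasurableSpace E] (μ : Measure E) {u : E → ℝ≥0∞} (hu : Measurable u) :
    ∫⁻ x, u x ∂μ = ⨆ N : ℕ, ∫⁻ x, min (u x) N ∂μ := by
  rw [← lintegral_iSup (fun N => hu.min measurable_const)]
  · congr 1; ext x
    apply le_antisymm
    · rcases eq_or_ne (u x) ⊤ with h | h
      · simp [h, ENNReal.iSup_natCast]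
      · obtain ⟨N, hN⟩ := ENNReal.exists_nat_gt h
        exact le_iSup_of_le N (by simp [hN.le])
    · exact iSup_le fun N => min_le_left _ _
  · intro N M hNM x
    simp only
    gcongr

lemma plm_real : PLM (volume : Measure ℝ) (fun _ _ => 1) := by
  intro u v w hu hv hw h
  rw [lintegral_trunc volume hu, lintegral_trunc volume hv]
  rw [ENNReal.iSup_mul]
  refine iSup_le fun N => ?_
  rw [ENNReal.mul_iSup]
  refine iSup_le fun M => ?_
  refine pl_bdd (N := max (N:ℝ≥0∞) M) (hu.min measurable_const) (hv.min measurable_const) hw (by simp)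
    (fun x => (min_le_right _ _).trans (le_max_left _ _)) (fun x => (min_le_right _ _).trans (le_max_right _ _)) ?_
  intro x y
  refine le_trans ?_ ((h x y).trans (by simp))
  gcongr <;> exact min_le_left _ _

lemma PLM.prod {E F : Type*} [AddCommGroup E] [Module ℝ E] [MeasurableSpace E]
    [AddCommGroup F] [Module ℝ F] [MeasurableSpace F] {μ : Measure E} {ν : Measure F}
    [SFinite ν] [SFinite μ] {c : E → E → ℝ≥0∞} {d : F → F → ℝ≥0∞} (hμ : PLM μ c) (hν : PLM ν d)
    (hc0 : ∀ x y, c x y ≠ 0) (hc : ∀ x y, c x y ≠ ⊤) :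
    PLM (μ.prod ν) (fun x y => c x.1 y.1 * d x.2 y.2) := by
  intro u v w hu hv hw h
  rw [lintegral_prod _ hu.aemeasurable, lintegral_prod _ hv.aemeasurable,
    lintegral_prod _ hw.aemeasurable]
  refine hμ _ _ _ hu.lintegral_prod_right' hv.lintegral_prod_right' hw.lintegral_prod_right' ?_
  intro x y
  refine plm_scale hν (hc0 x y) (hc x y) (by fun_prop) (by fun_prop) (by fun_prop) ?_
  intro x' y'
  exact h (x, x') (y, y')

lemma PLM.map {E F : Type*} [AddCommGroup E] [Module ℝ E] [MeasurableSpace E]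
    [AddCommGroup F] [Module ℝ F] [MeasurableSpace F] {μ : Measure E}
    {c : F → F → ℝ≥0∞} {T : E → F} (hT : Measurable T)
    (hm : ∀ x y, T ((1/2:ℝ) • (x + y)) = (1/2:ℝ) • (T x + T y))
    (hμ : PLM μ (fun x y => c (T x) (T y))) : PLM (μ.map T) c := by
  intro u v w hu hv hw h
  rw [lintegral_map hu hT, lintegral_map hv hT, lintegral_map hw hT]
  refine hμ _ _ _ (hu.comp hT) (hv.comp hT) (hw.comp hT) ?_
  intro x y
  simp only [hm]
  exact h _ _

lemma PLM.pi {E : Type} [AddCommGroup E] [Module ℝ E] [MeasurableSpace E] {μ : Measure E}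
    [SigmaFinite μ] {c : E → E → ℝ≥0∞} (hμ : PLM μ c) 
    (hc0 : ∀ x y, c x y ≠ 0) (hc : ∀ x y, c x y ≠ ⊤) (n : ℕ) :
    PLM (Measure.pi (fun _ : Fin n => μ)) (fun x y => ∏ i, c (x i) (y i)) := by
  induction n with
  | zero =>
    intro u v w hu hv hw h
    rw [Measure.pi_of_empty, lintegral_dirac' _ hu, lintegral_dirac' _ hv, lintegral_dirac' _ hw]
    refine (h _ _).trans ?_
    simp only [Finset.univ_eq_empty, Finset.prod_empty, one_mul]
    gcongr
    apply le_of_eq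
    congr 1
    exact Subsingleton.elim _ _
  | succ n ih =>
    have e := (measurePreserving_piFinSuccAbove (fun _ : Fin (n+1) => μ) 0).symm
    rw [← e.map_eq]
    refine PLM.map (MeasurableEquiv.measurable _) ?_ ?_
    · intro x y
      ext i
      refine Fin.cases ?_ (fun i => ?_) i <;> simp [MeasurableEquiv.piFinSuccAbove, Fin.insertNthEquiv]
    · have := hμ.prod ih hc0 hc
      convert this using 3 with x y
      rw [Fin.prod_univ_succ]
      simp [MeasurableEquiv.piFinSuccAbove, Fin.insertNthEquiv]

def gcost (x y : ℝ) : ℝ≥0∞ := ENNReal.ofReal (exp ((x - y)^2 / 4))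

lemma plm_gauss : PLM (gaussianReal 0 1) gcost := by
  intro u v w hu hv hw h
  rw [gaussianReal_of_var_ne_zero 0 one_ne_zero]
  have hg := measurable_gaussianPDF 0 1
  rw [lintegral_withDensity_eq_lintegral_mul _ hg hu, lintegral_withDensity_eq_lintegral_mul _ hg hv,
   lintegral_withDensity_eq_lintegral_mul _ hg hw]
  refine plm_real _ _ _ (hg.mul hu) (hg.mul hv) (hg.mul hw) ?_
  intro x y
  simp only [Pi.mul_apply, one_mul]
  have : gaussianPDF 0 1 x * gaussianPDF 0 1 y * gcost x y = (gaussianPDF 0 1 ((1/2:ℝ)•(x+y)))^2 := by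
    simp only [gaussianPDF, gcost, gaussianPDFReal]
    rw [← ENNReal.ofReal_mul (by positivity), ← ENNReal.ofReal_mul (by positivity), ← ENNReal.ofReal_pow (by positivity)]
    congr 1
    rw [mul_pow, ← Real.exp_nat_mul]
    rw [show ∀ a b c d : ℝ, a * b * (a * c) * d = a^2 * (b * c * d) by intros; ring]
    rw [← Real.exp_add, ← Real.exp_add]
    congr 2
    simp; ring
  calc _ = gaussianPDF 0 1 x * gaussianPDF 0 1 y * (u x * v y) := by ring
    _ ≤ gaussianPDF 0 1 x * gaussianPDF 0 1 y * (gcost x y * w ((1/2:ℝ) • (x + y)) ^ 2) := by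
      exact mul_le_mul' le_rfl (h x y)
    _ = (gaussianPDF 0 1 x * gaussianPDF 0 1 y * gcost x y) * w ((1/2:ℝ) • (x + y)) ^ 2 := by ring
    _ = _ := by rw [this]; ring

abbrev gvec (n : ℕ) : Measure (Fin n → ℝ) := Measure.pi (fun _ => gaussianReal 0 1)
abbrev gmat (k n : ℕ) : Measure (Fin k → Fin n → ℝ) := Measure.pi (fun _ => gvec n)

lemma plm_gmat (k n : ℕ) : PLM (gmat k n)
    (fun Γ Δ => ENNReal.ofReal (exp ((∑ i, ∑ j, (Γ i j - Δ i j)^2) / 4))) := by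
  have h1 : ∀ x y, gcost x y ≠ 0 := fun x y => by
    unfold gcost; simp [Real.exp_pos]
  have h2 : ∀ x y, gcost x y ≠ ⊤ := fun x y => by simp [gcost]
  have := (plm_gauss.pi h1 h2 n).pi (fun x y => Finset.prod_ne_zero_iff.mpr fun i _ => h1 _ _)
    (fun x y => ENNReal.prod_ne_top fun i _ => h2 _ _) k
  convert this using 3 with x y
  simp only [gcost]
  rw [Finset.sum_div, Real.exp_sum, ENNReal.ofReal_prod_of_nonneg (fun i _ => by positivity)]
  congr 1; ext i
  rw [Finset.sum_div, Real.exp_sum, ENNReal.ofReal_prod_of_nonneg (fun i _ => by positivity)]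

lemma plm_euclid (n : ℕ) : PLM (volume : Measure (EuclideanSpace ℝ (Fin n))) (fun _ _ => 1) := by
  have h := (plm_real.pi (by simp) (by simp) n)
  rw [← (PiLp.volume_preserving_toLp (Fin n)).map_eq]
  refine PLM.map (PiLp.volume_preserving_toLp (Fin n)).measurable (fun x y => rfl) ?_
  rw [volume_pi]
  simpa using h

lemma plm_withDensity {E : Type*} [AddCommGroup E] [Module ℝ E] [MeasurableSpace E] {μ : Measure E}
    (hμ : PLM μ (fun _ _ => 1)) {f : E → ℝ≥0∞} (hf : AEMeasurable f μ)
    (hl : ∀ x y, f x * f y ≤ f ((1/2:ℝ) • (x + y)) ^ 2) :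
    PLM (μ.withDensity f) (fun _ _ => 1) := by
  intro u v w hu hv hw h
  obtain ⟨g, hg, hfg⟩ := hf
  rw [withDensity_congr_ae hfg]
  set N := toMeasurable μ {x | f x ≠ g x} with hN
  have hNm : MeasurableSet N := measurableSet_toMeasurable _ _
  have hN0 : μ N = 0 := by
    rw [hN, measure_toMeasurable]; exact hfg
  have hfgN : ∀ x, x ∉ N → f x = g x := by
    intro x hx
    by_contra hh
    exact hx (subset_toMeasurable _ _ hh)
  have hae : ∀ᵐ x ∂μ, x ∉ N := measure_eq_zero_iff_ae_notMem.mp hN0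
  classical
  rw [lintegral_withDensity_eq_lintegral_mul _ hg hu, lintegral_withDensity_eq_lintegral_mul _ hg hv,
   lintegral_withDensity_eq_lintegral_mul _ hg hw]
  have e : ∀ (c : ℝ≥0∞) (φ : E → ℝ≥0∞), ∫⁻ x, (g * φ) x ∂μ = ∫⁻ x, (if x ∈ N then c else g x * φ x) ∂μ := by
    intro c φ
    refine lintegral_congr_ae ?_
    filter_upwards [hae] with x hx
    simp [hx]
  rw [e 0 u, e 0 v, e ⊤ w]
  refine hμ _ _ _ (Measurable.ite hNm measurable_const (hg.mul hu)) (Measurable.ite hNm measurable_const (hg.mul hv))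
    (Measurable.ite hNm measurable_const (hg.mul hw)) ?_
  intro x y
  simp only [one_mul] at h ⊢
  by_cases h3 : (1/2:ℝ) • (x + y) ∈ N
  · rw [if_pos h3]; simp
  by_cases h1 : x ∈ N
  · simp [h1]
  by_cases h2 : y ∈ N
  · simp [h2]
  rw [if_neg h1, if_neg h2, if_neg h3, ← hfgN _ h1, ← hfgN _ h2, ← hfgN _ h3]
  calc _ = (f x * f y) * (u x * v y) := by ring
    _ ≤ _ := by
      rw [mul_pow]
      exact mul_le_mul' (hl x y) (h x y)

end GM

namespace GM

lemma tilt {Y : Type*} [MeasurableSpace Y] {ν : Measure Y} {D φ ψ : Y → ℝ}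
    (hD0 : ∀ y, 0 ≤ D y) (hD : Integrable D ν) (hφ : Integrable (fun y => D y * φ y) ν)
    (hψ : Integrable ψ ν) (hZ : 0 < ∫ y, D y ∂ν)
    (h : ∀ y, D y * exp (φ y) ≤ ψ y) :
    (∫ y, D y ∂ν) * exp ((∫ y, D y * φ y ∂ν) / ∫ y, D y ∂ν) ≤ ∫ y, ψ y ∂ν := by
  set Z := ∫ y, D y ∂ν
  set m := (∫ y, D y * φ y ∂ν) / Z with hm
  have hmZ : ∫ y, D y * φ y ∂ν = m * Z := by rw [hm]; field_simp
  have : ∫ y, (exp m * (1 - m) * D y + exp m * (D y * φ y)) ∂ν ≤ ∫ y, ψ y ∂ν := by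
    refine integral_mono ((hD.const_mul _).add (hφ.const_mul _)) hψ ?_
    intro y
    refine le_trans ?_ (h y)
    have h1 : exp m * (1 - m + φ y) ≤ exp (φ y) := by
      have := Real.add_one_le_exp (φ y - m)
      calc _ = exp m * (φ y - m + 1) := by ring
        _ ≤ exp m * exp (φ y - m) := by gcongr
        _ = _ := by rw [← Real.exp_add]; congr 1; ring
    have := mul_le_mul_of_nonneg_left h1 (hD0 y)
    simp only
    nlinarith
  rw [integral_add (hD.const_mul _) (hφ.const_mul _), integral_const_mul, integral_const_mul, hmZ] at this
  change exp m * (1 - m) * Z + _ ≤ _ at this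
  nlinarith

lemma lip_abs {Y : Type*} [MeasurableSpace Y] {ν : Measure Y} [IsProbabilityMeasure ν]
    {Q Q' S : Y → ℝ} (hQm : Measurable Q) (hQm' : Measurable Q') 
    (hQ0 : ∀ y, 0 ≤ Q y) (hQ'0 : ∀ y, 0 ≤ Q' y) (hS0 : ∀ y, 0 ≤ S y)
    (hQi : Integrable Q ν) (hSi : Integrable S ν) {k : ℕ} (hk : 1 ≤ k)
    (hSk : Integrable (fun y => S y ^ k) ν) {A r W : ℝ} (hA : 0 ≤ A) (hr : 0 < r) (hW : 0 < W)
    (hQ : ∫ y, Q y ∂ν ≤ 2 * A * k) (hS : ∫ y, S y ^ k ∂ν ≤ (r * W) ^ k)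
    (hrA : 4 * exp A * r ≤ 1)
    (hQQ : ∀ η : ℝ, 0 < η → ∀ y, Q' y ≤ Q y + η * Q y + S y / η + S y) :
    (∫ y, exp (- Q y / 2) ∂ν) * exp (-(W / 2) - 4 * A * exp A * k * r) ≤ ∫ y, exp (- Q' y / 2) ∂ν := by
  have hDi : ∀ R : Y → ℝ, Measurable R → (∀ y, 0 ≤ R y) → Integrable (fun y => exp (- R y / 2)) ν := by
    intro R hR hR0
    refine Integrable.of_bound (C := 1) (by fun_prop) (Filter.Eventually.of_forall fun y => ?_)
    rw [Real.norm_eq_abs, abs_of_pos (exp_pos _), Real.exp_le_one_iff]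
    linarith [hR0 y]
  set D := fun y => exp (- Q y / 2) with hDdef
  have hD1 : ∀ y, D y ≤ 1 := fun y => by
    simp only [hDdef]; rw [Real.exp_le_one_iff]; linarith [hQ0 y]
  have hD0 : ∀ y, 0 ≤ D y := fun y => (exp_pos _).le
  have hD := hDi Q hQm hQ0
  have hDmul : ∀ g : Y → ℝ, Integrable g ν → Integrable (fun y => D y * g y) ν := by
    intro g hg
    refine hg.bdd_mul (c := 1) (by fun_prop) (Filter.Eventually.of_forall fun y => ?_)
    rw [Real.norm_eq_abs, abs_of_nonneg (hD0 y)]; exact hD1 y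
  set Z := ∫ y, D y ∂ν with hZdef
  have hk0 : (0:ℝ) < k := by exact_mod_cast hk
  have hZ1 : exp (-(A * k)) ≤ Z := by
    have := tilt (ν := ν) (D := fun _ => 1) (φ := fun y => - Q y / 2) (ψ := D) (by simp) (by simp)
      (by simpa using (hQi.neg.div_const 2)) hD (by simp) (by simp [hDdef])
    simp only [integral_const, probReal_univ, smul_eq_mul, one_mul, mul_one, div_one] at this
    refine le_trans ?_ this
    rw [Real.exp_le_exp, integral_div, integral_neg]
    linarith
  have hZ : 0 < Z := (exp_pos _).trans_le hZ1
  have hEQ : (∫ y, D y * Q y ∂ν) ≤ 2 * A * k * Z := by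
    have := tilt (ν := ν) (D := D) (φ := fun y => Q y / 2) (ψ := fun _ => 1) hD0 hD
      (hDmul _ (hQi.div_const 2)) (by simp) hZ (by 
        intro y; simp only [hDdef]; rw [← Real.exp_add]; simp; linarith)
    simp only [integral_const, probReal_univ, smul_eq_mul, mul_one] at this
    have h2 : exp (-(A*k)) * exp ((∫ (y : Y), D y * (Q y / 2) ∂ν) / ∫ (y : Y), D y ∂ν) ≤ 1 := by
      refine le_trans ?_ this
      gcongr
    rw [← Real.exp_add, Real.exp_le_one_iff] at h2
    have h3 : (∫ (y : Y), D y * (Q y / 2) ∂ν) / Z ≤ A * k := by linarith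
    rw [div_le_iff₀ hZ] at h3
    have h4 : (∫ (y : Y), D y * (Q y / 2) ∂ν) = (∫ (y : Y), D y * Q y ∂ν) / 2 := by
      rw [← integral_div]; congr 1; ext y; ring
    linarith
  set a := exp A * r * W with ha
  have ha0 : 0 < a := by positivity
  have hES : (∫ y, D y * S y ∂ν) ≤ 2 * a * Z := by
    have h1 : (∫ y, D y * S y ∂ν) ≤ ∫ y, (a * D y + a * (S y ^ k / a ^ k)) ∂ν := by
      refine integral_mono (hDmul _ hSi) ((hD.const_mul _).add ((hSk.div_const _).const_mul _)) ?_
      intro y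
      simp only
      rw [← div_pow]
      have hy := hS0 y
      by_cases hya : S y ≤ a
      · have : 0 ≤ a * (S y / a) ^ k := by positivity
        nlinarith [hD0 y]
      · have h5 : 1 ≤ S y / a := by rw [one_le_div ha0]; linarith
        have h6 : S y / a ≤ (S y / a)^k := le_self_pow₀ h5 (by omega)
        have h7 : S y ≤ a * (S y / a) ^ k := by
          calc S y = a * (S y / a) := by field_simp
            _ ≤ _ := by gcongr
        nlinarith [hD0 y, hD1 y]
    rw [integral_add (hD.const_mul _) ((hSk.div_const _).const_mul _), integral_const_mul, integral_const_mul,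
      integral_div] at h1
    have h2 : (∫ y, S y ^ k ∂ν) / a ^ k ≤ Z := by
      rw [div_le_iff₀ (by positivity)]
      refine hS.trans ?_
      calc (r * W)^k = exp (-(A*k)) * a ^ k := by
            rw [ha, mul_assoc (exp A), mul_pow (exp A), ← Real.exp_nat_mul, ← mul_assoc, ← Real.exp_add]
            simp [mul_comm]
        _ ≤ _ := by gcongr
    change _ ≤ a * Z + _ at h1
    nlinarith
  set η := 4 * exp A * r with hη
  have hη0 : 0 < η := by positivity
  have hφi : Integrable (fun y => -(η * Q y + S y / η + S y)/2) ν :=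
    (((hQi.const_mul _).add (hSi.div_const _)).add hSi).neg.div_const 2
  have := tilt (ν := ν) (D := D) (φ := fun y => -(η * Q y + S y / η + S y)/2)
    (ψ := fun y => exp (- Q' y / 2)) hD0 hD (hDmul _ hφi) (hDi Q' hQm' hQ'0) hZ (by
      intro y
      simp only [hDdef]
      rw [← Real.exp_add, Real.exp_le_exp]
      linarith [hQQ η hη0 y])
  refine le_trans ?_ this
  change Z * _ ≤ Z * exp (_ / Z)
  gcongr
  rw [le_div_iff₀ hZ]
  have e1 : ∫ (y : Y), D y * (-(η * Q y + S y / η + S y) / 2) ∂ν = 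
      - (η / 2) * (∫ y, D y * Q y ∂ν) - ((1/η + 1)/2) * (∫ y, D y * S y ∂ν) := by
    rw [← integral_const_mul, ← integral_const_mul, ← integral_sub]
    · congr 1; ext y; ring
    · exact (hDmul _ hQi).const_mul _
    · exact (hDmul _ hSi).const_mul _
  rw [e1]
  have h8 : (1/η + 1)/2 * (2 * a) ≤ W / 2 := by
    have : 1 / η * a = W / 4 := by rw [ha, hη]; field_simp
    have : a ≤ W / 4 := by rw [ha]; nlinarith
    linarith
  have h9 : (1/η + 1)/2 * (∫ y, D y * S y ∂ν) ≤ (1/η + 1)/2 * (2 * a * Z) := by gcongr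
  have h10 : (η / 2) * (∫ y, D y * Q y ∂ν) ≤ (η / 2) * (2 * A * k * Z) := by gcongr
  have h11 : (1/η + 1)/2 * (2 * a * Z) ≤ W / 2 * Z := by
    calc _ = (1/η + 1)/2 * (2 * a) * Z := by ring
      _ ≤ _ := by gcongr
  have h12 : (η / 2) * (2 * A * k * Z) = 4 * A * exp A * k * r * Z := by rw [hη]; ring
  linarith
end GM

namespace GM

structure Good {n : ℕ} (ν : Measure (Fin n → ℝ)) (k : ℕ) (r : ℝ) : Prop where
  lc : PLM ν (fun _ _ => 1)
  rpos : 0 < r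
  kpos : 1 ≤ k
  int : ∀ m : ℕ, Integrable (fun y => (y ⬝ᵥ y) ^ m) ν
  m2 : ∫ y, y ⬝ᵥ y ∂ν = 1
  mom : ∀ v : Fin n → ℝ, ∫ y, (v ⬝ᵥ y) ^ (2 * k) ∂ν ≤ (r * (v ⬝ᵥ v)) ^ k

def Sf {k n : ℕ} (Γ : Fin k → Fin n → ℝ) (y : Fin n → ℝ) : ℝ := ∑ i, (Γ i ⬝ᵥ y) ^ 2
def Qf {k n : ℕ} (Γ : Fin k → Fin n → ℝ) (s : Fin k → ℝ) (y : Fin n → ℝ) : ℝ :=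
  ∑ i, (s i - Γ i ⬝ᵥ y) ^ 2
def nrm {k n : ℕ} (Γ : Fin k → Fin n → ℝ) : ℝ := ∑ i, ∑ j, (Γ i j) ^ 2
def hE {k n : ℕ} (ν : Measure (Fin n → ℝ)) (l : ℝ) (Γ : Fin k → Fin n → ℝ) (s : Fin k → ℝ) : ℝ≥0∞ :=
  ∫⁻ y, ENNReal.ofReal (exp (-(l * Qf Γ s y) / 2)) ∂ν
def qE {k n : ℕ} (ν : Measure (Fin n → ℝ)) (Γ : Fin k → Fin n → ℝ) : ℝ≥0∞ :=
  ∫⁻ y, ENNReal.ofReal (Sf Γ y) ∂ν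
def TT {n : ℕ} (ν : Measure (Fin n → ℝ)) (k : ℕ) (C : ℝ) : Set (Fin k → Fin n → ℝ) :=
  {Γ | qE ν Γ ≤ ENNReal.ofReal (C * k)}

lemma meas_dot {n : ℕ} : Measurable (fun p : (Fin n → ℝ) × (Fin n → ℝ) => p.1 ⬝ᵥ p.2) := by
  unfold dotProduct; fun_prop

@[fun_prop] lemma meas_dot2 {n : ℕ} {E : Type*} [MeasurableSpace E] {f g : E → Fin n → ℝ} 
    (hf : Measurable f) (hg : Measurable g) : Measurable (fun x => f x ⬝ᵥ g x) :=
  meas_dot.comp (hf.prodMk hg)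

@[fun_prop] lemma meas_Qf {k n : ℕ} {E : Type*} [MeasurableSpace E] {f : E → Fin k → Fin n → ℝ}
    {s : E → Fin k → ℝ} {g : E → Fin n → ℝ} 
    (hf : Measurable f) (hs : Measurable s) (hg : Measurable g) : Measurable (fun x => Qf (f x) (s x) (g x)) := by
  unfold Qf
  fun_prop

@[fun_prop] lemma meas_Sf {k n : ℕ} {E : Type*} [MeasurableSpace E] {f : E → Fin k → Fin n → ℝ}
    {g : E → Fin n → ℝ} 
    (hf : Measurable f) (hg : Measurable g) : Measurable (fun x => Sf (f x) (g x)) := by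
  unfold Sf
  fun_prop

@[fun_prop] lemma meas_hE {k n : ℕ} {ν : Measure (Fin n → ℝ)} [SFinite ν] {l : ℝ} {E : Type*} [MeasurableSpace E]
    {f : E → Fin k → Fin n → ℝ} {s : E → Fin k → ℝ}
    (hf : Measurable f) (hs : Measurable s) : Measurable (fun x => hE ν l (f x) (s x)) := by
  unfold hE
  refine Measurable.lintegral_prod_right' (f := fun p : E × (Fin n → ℝ) => 
    ENNReal.ofReal (exp (-(l * Qf (f p.1) (s p.1) p.2) / 2))) ?_
  fun_prop

@[fun_prop] lemma meas_qE {k n : ℕ} {ν : Measure (Fin n → ℝ)} [SFinite ν] : 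
    Measurable (fun x : Fin k → Fin n → ℝ => qE ν x) := by
  unfold qE
  refine Measurable.lintegral_prod_right' (f := fun p : (Fin k → Fin n → ℝ) × (Fin n → ℝ) => 
    ENNReal.ofReal (Sf p.1 p.2)) ?_
  fun_prop

lemma meas_TT {n : ℕ} {ν : Measure (Fin n → ℝ)} [SFinite ν] (k : ℕ) (C : ℝ) : MeasurableSet (TT ν k C) :=
  measurableSet_le meas_qE measurable_const

lemma cs_dot {n : ℕ} (v y : Fin n → ℝ) : (v ⬝ᵥ y) ^ 2 ≤ (v ⬝ᵥ v) * (y ⬝ᵥ y) := by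
  have := Finset.sum_mul_sq_le_sq_mul_sq Finset.univ v y
  simpa [dotProduct, sq] using this

lemma dot_self_nonneg {n : ℕ} (v : Fin n → ℝ) : 0 ≤ v ⬝ᵥ v := by
  unfold dotProduct; exact Finset.sum_nonneg fun i _ => mul_self_nonneg _

lemma nrm_eq {k n : ℕ} (Γ : Fin k → Fin n → ℝ) : nrm Γ = ∑ i, Γ i ⬝ᵥ Γ i := by
  simp [nrm, dotProduct, sq]

lemma nrm_nonneg {k n : ℕ} (Γ : Fin k → Fin n → ℝ) : 0 ≤ nrm Γ := by
  unfold nrm; positivity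

lemma Sf_nonneg {k n : ℕ} (Γ : Fin k → Fin n → ℝ) (y) : 0 ≤ Sf Γ y := by unfold Sf; positivity
lemma Qf_nonneg {k n : ℕ} (Γ : Fin k → Fin n → ℝ) (s y) : 0 ≤ Qf Γ s y := by unfold Qf; positivity

lemma Sf_le {k n : ℕ} (Γ : Fin k → Fin n → ℝ) (y) : Sf Γ y ≤ nrm Γ * (y ⬝ᵥ y) := by
  rw [nrm_eq, Sf, Finset.sum_mul]
  exact Finset.sum_le_sum fun i _ => cs_dot _ _

lemma Qf_le {k n : ℕ} (Γ : Fin k → Fin n → ℝ) (s y) : Qf Γ s y ≤ 2 * (∑ i, s i ^ 2) + 2 * Sf Γ y := by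
  rw [Sf, Qf, Finset.mul_sum, Finset.mul_sum, ← Finset.sum_add_distrib]
  exact Finset.sum_le_sum fun i _ => by nlinarith [sq_nonneg (s i + Γ i ⬝ᵥ y)]

lemma Good.int_Sk {n k : ℕ} {ν : Measure (Fin n → ℝ)} {r : ℝ} (g : Good ν k r)
    {k' : ℕ} (Γ : Fin k' → Fin n → ℝ) (m : ℕ) : Integrable (fun y => Sf Γ y ^ m) ν := by
  refine ((g.int m).const_mul (nrm Γ ^ m)).mono' (by fun_prop) (Filter.Eventually.of_forall fun y => ?_)
  rw [Real.norm_eq_abs, abs_of_nonneg (pow_nonneg (Sf_nonneg _ _) _), ← mul_pow]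
  exact pow_le_pow_left₀ (Sf_nonneg _ _) (Sf_le _ _) _

lemma Good.int_S {n k : ℕ} {ν : Measure (Fin n → ℝ)} {r : ℝ} (g : Good ν k r)
    {k' : ℕ} (Γ : Fin k' → Fin n → ℝ) : Integrable (fun y => Sf Γ y) ν := by
  simpa using g.int_Sk Γ 1

lemma Good.int_Q {n k : ℕ} {ν : Measure (Fin n → ℝ)} [IsProbabilityMeasure ν] {r : ℝ} (g : Good ν k r)
    {k' : ℕ} (Γ : Fin k' → Fin n → ℝ) (s) : Integrable (fun y => Qf Γ s y) ν := by
  refine ((integrable_const (2 * (∑ i, s i ^ 2))).add ((g.int_S Γ).const_mul 2)).mono' (by fun_prop) 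
    (Filter.Eventually.of_forall fun y => ?_)
  rw [Real.norm_eq_abs, abs_of_nonneg (Qf_nonneg _ _ _)]
  exact Qf_le _ _ _

lemma Good.mom_S {n k : ℕ} {ν : Measure (Fin n → ℝ)} {r : ℝ} (g : Good ν k r)
    {k' : ℕ} (M : Fin k' → Fin n → ℝ) : ∫ y, Sf M y ^ k ∂ν ≤ (r * nrm M) ^ k := by
  have hk := g.kpos
  have hW := nrm_nonneg M
  have intpow : ∀ v : Fin n → ℝ, Integrable (fun y => (v ⬝ᵥ y) ^ (2 * k)) ν := by
    intro v
    have := g.int_Sk (fun _ : Fin 1 => v) k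
    simpa [Sf, pow_mul] using this
  rcases hW.eq_or_lt with h0 | h0
  · have : ∀ y, Sf M y = 0 := fun y => le_antisymm (by simpa [← h0] using Sf_le M y) (Sf_nonneg _ _)
    simp [this, ← h0, show k ≠ 0 by omega]
  have pm : ∀ y, Sf M y ^ k ≤ nrm M ^ k * ∑ i, (M i ⬝ᵥ M i / nrm M) * (if M i ⬝ᵥ M i = 0 then 0 else
      (M i ⬝ᵥ y) ^ (2 * k) / (M i ⬝ᵥ M i) ^ k) := by
    intro y
    have := Real.pow_arith_mean_le_arith_mean_pow Finset.univ (fun i => M i ⬝ᵥ M i / nrm M)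
      (fun i => (M i ⬝ᵥ y) ^ 2 / (M i ⬝ᵥ M i)) (fun i _ => div_nonneg (dot_self_nonneg _) hW)
      (by rw [← Finset.sum_div, ← nrm_eq, div_self h0.ne']) 
      (fun i _ => div_nonneg (sq_nonneg _) (dot_self_nonneg _)) k
    have e : ∑ i, M i ⬝ᵥ M i / nrm M * ((M i ⬝ᵥ y) ^ 2 / (M i ⬝ᵥ M i)) = Sf M y / nrm M := by
      rw [Sf, Finset.sum_div]
      refine Finset.sum_congr rfl fun i _ => ?_
      by_cases hi : M i ⬝ᵥ M i = 0
      · have := cs_dot (M i) y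
        rw [hi, zero_mul] at this
        simp [hi, le_antisymm this (sq_nonneg _)]
      · field_simp
    rw [e, div_pow, div_le_iff₀ (by positivity), mul_comm] at this
    refine this.trans (le_of_eq ?_)
    congr 1
    refine Finset.sum_congr rfl fun i _ => ?_
    split_ifs with hi
    · simp [hi]
    · rw [div_pow, pow_mul]
  calc _ ≤ ∫ y, nrm M ^ k * ∑ i, (M i ⬝ᵥ M i / nrm M) * (if M i ⬝ᵥ M i = 0 then 0 else
      (M i ⬝ᵥ y) ^ (2 * k) / (M i ⬝ᵥ M i) ^ k) ∂ν := by
        refine integral_mono (g.int_Sk M k) ?_ pm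
        refine (integrable_finsetSum _ fun i _ => ?_).const_mul _
        refine Integrable.const_mul ?_ _
        split_ifs
        · simp
        · exact (intpow _).div_const _
    _ = nrm M ^ k * ∑ i, (M i ⬝ᵥ M i / nrm M) * (if M i ⬝ᵥ M i = 0 then 0 else
      (∫ y, (M i ⬝ᵥ y) ^ (2 * k) ∂ν) / (M i ⬝ᵥ M i) ^ k) := by
        rw [integral_const_mul, integral_finsetSum]
        · congr 1
          refine Finset.sum_congr rfl fun i _ => ?_
          rw [integral_const_mul]
          split_ifs
          · simp
          · rw [integral_div]
        · intro i _
          refine Integrable.const_mul ?_ _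
          split_ifs
          · simp
          · exact (intpow _).div_const _
    _ ≤ nrm M ^ k * ∑ i, (M i ⬝ᵥ M i / nrm M) * r ^ k := by
        gcongr with i
        · exact div_nonneg (dot_self_nonneg _) hW
        split_ifs with hi
        · exact pow_nonneg g.rpos.le _
        · have : 0 < M i ⬝ᵥ M i := lt_of_le_of_ne (dot_self_nonneg _) (Ne.symm hi)
          rw [div_le_iff₀ (by positivity), ← mul_pow]
          exact g.mom _
    _ = _ := by
        rw [← Finset.sum_mul, ← Finset.sum_div, ← nrm_eq, div_self h0.ne', mul_pow]; ring

lemma hE_ofReal {k n : ℕ} {ν : Measure (Fin n → ℝ)} [IsProbabilityMeasure ν] {l : ℝ} (hl : 0 < l)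
    (Γ : Fin k → Fin n → ℝ) (s) : hE ν l Γ s = ENNReal.ofReal (∫ y, exp (-(l * Qf Γ s y) / 2) ∂ν) := by
  rw [hE, ofReal_integral_eq_lintegral_ofReal]
  · refine Integrable.of_bound (C := 1) (by fun_prop) (Filter.Eventually.of_forall fun y => ?_)
    rw [Real.norm_eq_abs, abs_of_pos (exp_pos _), Real.exp_le_one_iff]
    have := mul_nonneg hl.le (Qf_nonneg Γ s y)
    linarith
  · exact Filter.Eventually.of_forall fun y => (exp_pos _).le

lemma hE_le_one {k n : ℕ} {ν : Measure (Fin n → ℝ)} [IsProbabilityMeasure ν] {l : ℝ} (hl : 0 < l)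
    (Γ : Fin k → Fin n → ℝ) (s) : hE ν l Γ s ≤ 1 := by
  calc _ ≤ ∫⁻ y, 1 ∂ν := by
        refine lintegral_mono fun y => ?_
        rw [← ENNReal.ofReal_one]
        refine ENNReal.ofReal_le_ofReal ?_
        rw [Real.exp_le_one_iff]
        have := mul_nonneg hl.le (Qf_nonneg Γ s y)
        linarith
    _ = 1 := by simp

/-- the Lipschitz-type estimate -/
lemma lip {n k : ℕ} {ν : Measure (Fin n → ℝ)} [IsProbabilityMeasure ν] {r : ℝ} (g : Good ν k r)
    {l t C κ A : ℝ} (hl : 0 < l) (hκ : 0 < κ) (ht : 0 ≤ t) (hC : 0 ≤ C) (hA : A = l * (t + C))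
    (hr : 4 * exp A * (κ * l * r) ≤ 1)
    {Γ : Fin k → Fin n → ℝ} (hΓ : Γ ∈ TT ν k C) {s : Fin k → ℝ} (hs : ∑ i, s i ^ 2 ≤ t * k)
    (Γ' : Fin k → Fin n → ℝ) :
    hE ν l Γ s ≤ ENNReal.ofReal (exp (nrm (Γ' - Γ) / (2 * κ) + 4 * A * exp A * k * (κ * l * r)))
      * hE ν l Γ' s := by
  have hA0 : 0 ≤ A := by rw [hA]; positivity
  have hr0 := g.rpos
  rcases eq_or_ne (Γ' - Γ) 0 with h0 | h0
  · rw [sub_eq_zero.mp h0]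
    refine le_mul_of_one_le_left' ?_
    rw [ENNReal.one_le_ofReal, Real.one_le_exp_iff]
    have := nrm_nonneg (Γ - Γ)
    positivity
  set M := Γ' - Γ with hM
  have hMpos : 0 < nrm M := by
    refine lt_of_le_of_ne (nrm_nonneg M) fun h => h0 ?_
    ext i j
    have h1 := (Finset.sum_eq_zero_iff_of_nonneg (fun i _ => by positivity)).mp h.symm i (Finset.mem_univ _)
    have h2 := (Finset.sum_eq_zero_iff_of_nonneg (fun i _ => by positivity)).mp h1 j (Finset.mem_univ _)
    simpa using h2
  have key := lip_abs (ν := ν) (Q := fun y => l * Qf Γ s y) (Q' := fun y => l * Qf Γ' s y) (S := fun y => l * Sf M y)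
    (by fun_prop) (by fun_prop) (fun y => mul_nonneg hl.le (Qf_nonneg _ _ _)) (fun y => mul_nonneg hl.le (Qf_nonneg _ _ _))
    (fun y => mul_nonneg hl.le (Sf_nonneg _ _)) ((g.int_Q Γ s).const_mul l) ((g.int_S M).const_mul l) g.kpos
    (by simpa [mul_pow] using (g.int_Sk M k).const_mul (l^k)) (A := A) (r := κ * l * r) (W := nrm M / κ)
    hA0 (by positivity) (by positivity) 
    (by
      have h1 : ∫ y, Sf Γ y ∂ν ≤ C * k := by
        have : qE ν Γ ≤ ENNReal.ofReal (C * k) := hΓ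
        rw [qE, ← ofReal_integral_eq_lintegral_ofReal (g.int_S Γ) (Filter.Eventually.of_forall fun y => Sf_nonneg _ _)] at this
        exact (ENNReal.ofReal_le_ofReal_iff (by positivity)).mp this
      have h2 : ∫ y, Qf Γ s y ∂ν ≤ 2 * (t * k) + 2 * (C * k) := by
        calc _ ≤ ∫ y, (2 * (∑ i, s i ^ 2) + 2 * Sf Γ y) ∂ν :=
              integral_mono (g.int_Q Γ s) ((integrable_const _).add ((g.int_S Γ).const_mul 2)) (Qf_le Γ s)
          _ = 2 * (∑ i, s i ^ 2) + 2 * ∫ y, Sf Γ y ∂ν := by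
              rw [integral_add (integrable_const _) ((g.int_S Γ).const_mul 2)]; simp [integral_const_mul]
          _ ≤ _ := by linarith
      rw [integral_const_mul, hA]
      calc l * ∫ y, Qf Γ s y ∂ν ≤ l * (2 * (t * k) + 2 * (C * k)) := by gcongr
        _ = _ := by ring)
    (by
      have := g.mom_S M
      simp only [mul_pow]
      rw [integral_const_mul]
      calc l^k * ∫ y, Sf M y ^ k ∂ν ≤ l ^ k * (r * nrm M) ^ k := by gcongr
        _ = (l * (r * nrm M)) ^ k := by rw [mul_pow l]
        _ = (κ * l * r * (nrm M / κ))^k := by congr 1; field_simp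
        _ = _ := by rw [mul_pow, mul_pow, mul_pow])
    hr
    (by
      intro η hη y
      have : Qf Γ' s y ≤ Qf Γ s y + η * Qf Γ s y + Sf M y / η + Sf M y := by
        simp only [Qf, Sf, Finset.mul_sum, Finset.sum_div]
        rw [← Finset.sum_add_distrib, ← Finset.sum_add_distrib, ← Finset.sum_add_distrib]
        refine Finset.sum_le_sum fun i _ => ?_
        have e : Γ' i ⬝ᵥ y = Γ i ⬝ᵥ y + M i ⬝ᵥ y := by
          rw [← add_dotProduct]; congr 1; simp [hM]
        rw [e]
        set a := s i - Γ i ⬝ᵥ y with ha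
        set b := M i ⬝ᵥ y with hb
        have e2 : s i - (Γ i ⬝ᵥ y + b) = a - b := by rw [ha]; ring
        rw [e2]
        have : 0 ≤ (η * a + b)^2 / η := by positivity
        have e3 : (η * a + b)^2 / η = η * a^2 + 2 * a * b + b^2/η := by field_simp; ring
        nlinarith
      calc l * Qf Γ' s y ≤ l * (Qf Γ s y + η * Qf Γ s y + Sf M y / η + Sf M y) := by gcongr
        _ = _ := by ring)
  rw [hE_ofReal hl, hE_ofReal hl, ← ENNReal.ofReal_mul (exp_pos _).le]
  refine ENNReal.ofReal_le_ofReal ?_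
  set I1 := ∫ y, exp (-(l * Qf Γ s y) / 2) ∂ν
  set I2 := ∫ y, exp (-(l * Qf Γ' s y) / 2) ∂ν
  have e5 : nrm M / (2 * κ) = nrm M / κ / 2 := by field_simp
  rw [e5]
  set x := nrm M / κ / 2
  set z := 4 * A * exp A * k * (κ * l * r)
  calc I1 = exp (x + z) * (I1 * exp (-x - z)) := by
        rw [mul_comm I1, ← mul_assoc, ← Real.exp_add]; simp
    _ ≤ _ := by gcongr

lemma hE_lc {n k : ℕ} {ν : Measure (Fin n → ℝ)} (hν : PLM ν (fun _ _ => 1))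
    {l : ℝ} (hl : 0 < l) (Γ : Fin k → Fin n → ℝ) (s s' : Fin k → ℝ) :
    hE ν l Γ s * hE ν l Γ s' ≤ hE ν l Γ ((1/2:ℝ) • (s + s')) ^ 2 := by
  refine hν _ _ _ (by fun_prop) (by fun_prop) (by fun_prop) ?_
  intro x y
  rw [one_mul, ← ENNReal.ofReal_mul (exp_pos _).le, ← ENNReal.ofReal_pow (exp_pos _).le]
  refine ENNReal.ofReal_le_ofReal ?_
  rw [← Real.exp_add, ← Real.exp_nat_mul, Real.exp_le_exp]
  have : 2 * Qf Γ ((1/2:ℝ) • (s + s')) ((1/2:ℝ) • (x + y)) ≤ Qf Γ s x + Qf Γ s' y := by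
    simp only [Qf]
    rw [Finset.mul_sum, ← Finset.sum_add_distrib]
    refine Finset.sum_le_sum fun i _ => ?_
    rw [dotProduct_smul, dotProduct_add]
    simp only [Pi.smul_apply, Pi.add_apply, smul_eq_mul]
    nlinarith [sq_nonneg ((s i - Γ i ⬝ᵥ x) - (s' i - Γ i ⬝ᵥ y))]
  push_cast
  nlinarith

lemma hE_mid {n k : ℕ} {ν : Measure (Fin n → ℝ)} [IsProbabilityMeasure ν] {r : ℝ} (g : Good ν k r)
    {l t C A : ℝ} (hl : 0 < l) (ht : 0 ≤ t) (hC : 0 ≤ C) (hA : A = l * (t + C))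
    (hr : 4 * exp A * (l * r) ≤ 1)
    {Γ Γ' : Fin k → Fin n → ℝ} (hΓ : Γ ∈ TT ν k C) (hΓ' : Γ' ∈ TT ν k C) {s s' : Fin k → ℝ}
    (hs : ∑ i, s i ^ 2 ≤ t * k) (hs' : ∑ i, s' i ^ 2 ≤ t * k) :
    hE ν l Γ s * hE ν l Γ' s' ≤ ENNReal.ofReal (exp (8 * A * exp A * k * (l * r))) *
      ENNReal.ofReal (exp (nrm (Γ - Γ') / 4)) * 
        hE ν l ((1/2:ℝ) • (Γ + Γ')) ((1/2:ℝ) • (s + s')) ^ 2 := by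
  have e : ∀ x y : Fin k → Fin n → ℝ, nrm ((1/2:ℝ) • (x + y) - x) = nrm (x - y) / 4 := by
    intro x y
    simp only [nrm, Finset.sum_div]
    refine Finset.sum_congr rfl fun i _ => Finset.sum_congr rfl fun j _ => ?_
    simp; ring
  have h1 := lip g hl one_pos ht hC hA (by simpa using hr) hΓ hs ((1/2:ℝ) • (Γ + Γ'))
  have h2 := lip g hl one_pos ht hC hA (by simpa using hr) hΓ' hs' ((1/2:ℝ) • (Γ + Γ'))
  have e1 := e Γ Γ'
  have e2 := e Γ' Γ
  rw [add_comm Γ' Γ] at e2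
  have e3 : nrm (Γ' - Γ) = nrm (Γ - Γ') := by
    simp only [nrm]
    refine Finset.sum_congr rfl fun i _ => Finset.sum_congr rfl fun j _ => ?_
    simp; ring
  rw [e1] at h1
  rw [e2, e3] at h2
  refine (mul_le_mul' h1 h2).trans ?_
  have h3 := hE_lc g.lc hl ((1/2:ℝ) • (Γ + Γ')) s s'
  rw [show ∀ a b c : ℝ≥0∞, a * b * (a * c) = (a * a) * (b * c) by intros; ring]
  refine mul_le_mul' (le_of_eq ?_) h3
  rw [← ENNReal.ofReal_mul (exp_pos _).le, ← ENNReal.ofReal_mul (exp_pos _).le, ← Real.exp_add, ← Real.exp_add]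
  congr 2
  ring
end GM

namespace GM

lemma lintegral_pi_prod {E : Type} [MeasurableSpace E] {μ : Measure E} [SigmaFinite μ] {k : ℕ}
    (f : Fin k → E → ℝ≥0∞) (hf : ∀ i, Measurable (f i)) :
    ∫⁻ x, ∏ i, f i (x i) ∂(Measure.pi (fun _ : Fin k => μ)) = ∏ i, ∫⁻ x, f i x ∂μ := by
  induction k with
  | zero =>
    rw [Measure.pi_of_empty]
    simp
  | succ k ih =>
    have e := (measurePreserving_piFinSuccAbove (fun _ : Fin (k+1) => μ) 0).symm
    rw [← e.map_eq, lintegral_map (by fun_prop) e.measurable]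
    simp_rw [Fin.prod_univ_succ]
    simp only [MeasurableEquiv.piFinSuccAbove, Fin.insertNthEquiv]
    simp
    have := lintegral_prod_mul (μ := μ) (ν := Measure.pi (fun _ : Fin k => μ)) (f := f 0) 
      (g := fun x => ∏ i : Fin k, f i.succ (x i)) (hf 0).aemeasurable
      (Finset.measurable_fun_prod _ fun i _ => (hf i.succ).comp (measurable_pi_apply i)).aemeasurable
    rw [this, ih _ (fun i => hf i.succ)]

lemma gauss1 {l a s : ℝ} (h : 0 < 1 + l * a ^ 2) :
    ∫⁻ x, ENNReal.ofReal (exp (-(l * (s - a * x) ^ 2) / 2)) ∂(gaussianReal 0 1) =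
      ENNReal.ofReal ((1 + l * a ^ 2) ^ (-(1/2:ℝ)) * exp (-(l * s ^ 2 / (2 * (1 + l * a ^ 2))))) := by
  rw [gaussianReal_of_var_ne_zero 0 one_ne_zero,
    lintegral_withDensity_eq_lintegral_mul _ (measurable_gaussianPDF 0 1) (by fun_prop)]
  set V := 1 + l * a ^ 2 with hV
  set m := l * a * s / V with hm
  set E := exp (-(l * s ^ 2 / (2 * V))) with hE
  have e : ∀ x, (gaussianPDF 0 1 * fun x => ENNReal.ofReal (exp (-(l * (s - a * x) ^ 2) / 2))) x =
      ENNReal.ofReal (((√(2 * π))⁻¹ * E) * exp (-(V/2) * (x - m) ^ 2)) := by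
    intro x
    simp only [Pi.mul_apply, gaussianPDF, gaussianPDFReal]
    rw [← ENNReal.ofReal_mul (by positivity)]
    congr 1
    simp only [NNReal.coe_one, mul_one]
    rw [mul_assoc, mul_assoc (√(2 * π))⁻¹, hE, ← Real.exp_add, ← Real.exp_add]
    congr 2
    rw [hm]
    field_simp
    rw [hV]
    ring
  simp_rw [e]
  have hintg : Integrable (fun x => exp (-(V/2) * (x - m) ^ 2)) := 
    (integrable_exp_neg_mul_sq (by positivity : 0 < V/2)).comp_sub_right m
  rw [← ofReal_integral_eq_lintegral_ofReal (hintg.const_mul _) 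
    (Filter.Eventually.of_forall fun x => by positivity), integral_const_mul,
    integral_sub_right_eq_self (fun x => exp (-(V/2) * x ^ 2)) m, integral_gaussian]
  congr 1
  rw [show π / (V / 2) = 2 * π * V⁻¹ by field_simp, Real.sqrt_mul (by positivity : 0 ≤ 2 * π), 
    Real.rpow_neg h.le, Real.sqrt_inv, ← Real.sqrt_eq_rpow]
  field_simp

lemma map_dot {n : ℕ} (y : Fin n → ℝ) :
    (gvec n).map (fun g => g ⬝ᵥ y) = (gaussianReal 0 1).map (fun x => √(y ⬝ᵥ y) * x) := by
  rw [gaussianReal_map_const_mul]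
  have : IsProbabilityMeasure ((gvec n).map (fun g => g ⬝ᵥ y)) := 
    Measure.isProbabilityMeasure_map (by fun_prop)
  apply Measure.ext_of_charFun
  ext t
  rw [charFun_gaussianReal, charFun_apply_real, integral_map (by fun_prop) (by fun_prop)]
  have e : ∀ g : Fin n → ℝ, Complex.exp (t * ((g ⬝ᵥ y : ℝ) : ℂ) * Complex.I) = 
      ∏ i, Complex.exp ((t * y i : ℝ) * (g i : ℂ) * Complex.I) := by
    intro g
    rw [← Complex.exp_sum]
    congr 1
    simp only [dotProduct]
    push_cast
    rw [Finset.mul_sum, Finset.sum_mul]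
    refine Finset.sum_congr rfl fun i _ => ?_
    ring
  simp_rw [e]
  have := integral_fintype_prod_eq_prod (μ := fun _ : Fin n => gaussianReal 0 1) 
    (fun i (x:ℝ) => Complex.exp ((t * y i : ℝ) * (x : ℂ) * Complex.I))
  rw [this]
  simp_rw [← charFun_apply_real, charFun_gaussianReal]
  rw [← Complex.exp_sum]
  congr 1
  have hs : (√(y ⬝ᵥ y))^2 = y ⬝ᵥ y := Real.sq_sqrt (dot_self_nonneg y)
  have : (((NNReal.mk ((√(y ⬝ᵥ y))^2) (sq_nonneg _) * 1 : ℝ≥0) : ℝ) : ℂ) = ((y ⬝ᵥ y : ℝ) : ℂ) := by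
    rw [← hs]; simp
  rw [this]
  simp only [dotProduct]
  push_cast
  simp
  rw [Finset.sum_mul, Finset.sum_div]
  refine Finset.sum_congr rfl fun i _ => ?_
  ring

lemma gE {k n : ℕ} {l : ℝ} (s : Fin k → ℝ) (y : Fin n → ℝ) (h : 0 < 1 + l * (y ⬝ᵥ y)) :
    ∫⁻ Γ, ENNReal.ofReal (exp (-(l * Qf Γ s y) / 2)) ∂(gmat k n) =
      ENNReal.ofReal ((1 + l * (y ⬝ᵥ y)) ^ (-(k/2:ℝ)) * 
        exp (-(l * (∑ i, s i ^ 2) / (2 * (1 + l * (y ⬝ᵥ y)))))) := by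
  have e : ∀ Γ : Fin k → Fin n → ℝ, ENNReal.ofReal (exp (-(l * Qf Γ s y) / 2)) = 
      ∏ i, ENNReal.ofReal (exp (-(l * (s i - Γ i ⬝ᵥ y) ^ 2) / 2)) := by
    intro Γ
    rw [← ENNReal.ofReal_prod_of_nonneg (fun i _ => (exp_pos _).le), ← Real.exp_sum]
    congr 2
    rw [Qf, Finset.mul_sum, ← Finset.sum_neg_distrib, Finset.sum_div]
  simp_rw [e]
  have := lintegral_pi_prod (μ := gvec n) (fun (i : Fin k) (v : Fin n → ℝ) => 
    ENNReal.ofReal (exp (-(l * (s i - v ⬝ᵥ y) ^ 2) / 2))) (by fun_prop)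
  rw [this]
  have e2 : ∀ i, ∫⁻ v, ENNReal.ofReal (exp (-(l * (s i - v ⬝ᵥ y) ^ 2) / 2)) ∂(gvec n) = 
      ENNReal.ofReal ((1 + l * (y ⬝ᵥ y)) ^ (-(1/2:ℝ)) * exp (-(l * s i ^ 2 / (2 * (1 + l * (y ⬝ᵥ y)))))) := by
    intro i
    have hs : (√(y ⬝ᵥ y))^2 = y ⬝ᵥ y := Real.sq_sqrt (dot_self_nonneg y)
    rw [← lintegral_map (f := fun x : ℝ => ENNReal.ofReal (exp (-(l * (s i - x) ^ 2) / 2))) 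
      (g := fun v => v ⬝ᵥ y) (by fun_prop) (by fun_prop), map_dot, lintegral_map (by fun_prop) (by fun_prop),
      gauss1 (by rwa [hs]), hs]
  simp_rw [e2]
  rw [← ENNReal.ofReal_prod_of_nonneg (fun i _ => by positivity)]
  congr 1
  rw [Finset.prod_mul_distrib, ← Real.exp_sum, Finset.prod_const, Finset.card_univ, Fintype.card_fin,
    ← Real.rpow_natCast, ← Real.rpow_mul h.le]
  congr 2
  · ring
  · rw [Finset.sum_neg_distrib, ← Finset.sum_div, ← Finset.mul_sum]
end GM

namespace GM

lemma ofReal_integral_le {Y : Type*} [MeasurableSpace Y] {ν : Measure Y} {g : Y → ℝ} (hg : Integrable g ν) :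
    ENNReal.ofReal (∫ y, g y ∂ν) ≤ ∫⁻ y, ENNReal.ofReal (g y) ∂ν := by
  rw [integral_eq_lintegral_pos_part_sub_lintegral_neg_part hg]
  refine (ENNReal.ofReal_le_ofReal (sub_le_self _ ENNReal.toReal_nonneg)).trans ENNReal.ofReal_toReal_le

lemma TTc {n k : ℕ} {ν : Measure (Fin n → ℝ)} [IsProbabilityMeasure ν] {r : ℝ} (g : Good ν k r) {C : ℝ} (hC : 0 ≤ C) :
    gmat k n (TT ν k C)ᶜ ≤ ENNReal.ofReal (exp (-(C * k / 4)) * 2 ^ (k/2:ℝ)) := by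
  set m := C * k / 4 with hm
  set Φ : (Fin k → Fin n → ℝ) → (Fin n → ℝ) → ℝ≥0∞ := fun Γ y => 
    ENNReal.ofReal ((y ⬝ᵥ y) * exp (Sf Γ y / (4 * (y ⬝ᵥ y)))) with hΦ
  have hint1 : Integrable (fun y : Fin n → ℝ => y ⬝ᵥ y) ν := by simpa using g.int 1
  have h1 : ∀ Γ ∈ (TT ν k C)ᶜ, ENNReal.ofReal (exp m) ≤ ∫⁻ y, Φ Γ y ∂ν := by
    intro Γ hΓ
    have hq : C * k ≤ ∫ y, Sf Γ y ∂ν := by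
      by_contra hcon
      apply hΓ
      change qE ν Γ ≤ _
      rw [qE, ← ofReal_integral_eq_lintegral_ofReal (g.int_S Γ) (Filter.Eventually.of_forall fun y => Sf_nonneg _ _)]
      exact ENNReal.ofReal_le_ofReal (not_le.mp hcon).le
    have hgi : Integrable (fun y : Fin n → ℝ => exp m * ((1 - m) * (y ⬝ᵥ y) + Sf Γ y / 4)) ν := 
      ((hint1.const_mul _).add ((g.int_S Γ).div_const 4)).const_mul _
    calc ENNReal.ofReal (exp m) ≤ ENNReal.ofReal (∫ y, exp m * ((1 - m) * (y ⬝ᵥ y) + Sf Γ y / 4) ∂ν) := by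
          refine ENNReal.ofReal_le_ofReal ?_
          rw [integral_const_mul, integral_add (hint1.const_mul _) ((g.int_S Γ).div_const 4), integral_const_mul,
            integral_div, g.m2]
          nlinarith [exp_pos m]
      _ ≤ ∫⁻ y, ENNReal.ofReal (exp m * ((1 - m) * (y ⬝ᵥ y) + Sf Γ y / 4)) ∂ν := ofReal_integral_le hgi
      _ ≤ _ := by
          refine lintegral_mono fun y => ENNReal.ofReal_le_ofReal ?_
          have hy := dot_self_nonneg y
          rcases hy.eq_or_lt with h0 | h0
          · have : Sf Γ y = 0 := le_antisymm (by simpa [← h0] using Sf_le Γ y) (Sf_nonneg _ _)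
            simp [← h0, this]
          · set x := Sf Γ y / (4 * (y ⬝ᵥ y)) with hx
            have hx2 : Sf Γ y / 4 = x * (y ⬝ᵥ y) := by rw [hx]; field_simp
            rw [hx2]
            have := Real.add_one_le_exp (x - m)
            have h3 : exp x = exp m * exp (x - m) := by rw [← Real.exp_add]; congr 1; ring
            rw [h3]
            calc _ = (y ⬝ᵥ y) * (exp m * (x - m + 1)) := by ring
              _ ≤ _ := by gcongr
  have hΦm : Measurable (Function.uncurry Φ) := by
    simp only [hΦ, Function.uncurry_def]
    fun_prop
  have h2 : ENNReal.ofReal (exp m) * gmat k n (TT ν k C)ᶜ ≤ ENNReal.ofReal (2 ^ (k/2:ℝ)) := by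
    calc _ = ∫⁻ Γ in (TT ν k C)ᶜ, ENNReal.ofReal (exp m) ∂(gmat k n) := by simp
      _ ≤ ∫⁻ Γ in (TT ν k C)ᶜ, ∫⁻ y, Φ Γ y ∂ν ∂(gmat k n) := 
          setLIntegral_mono' (meas_TT k C).compl h1
      _ ≤ ∫⁻ Γ, ∫⁻ y, Φ Γ y ∂ν ∂(gmat k n) := setLIntegral_le_lintegral _ _
      _ = ∫⁻ y, ∫⁻ Γ, Φ Γ y ∂(gmat k n) ∂ν := lintegral_lintegral_swap hΦm.aemeasurable
      _ = ∫⁻ y, ENNReal.ofReal (2 ^ (k/2:ℝ)) * ENNReal.ofReal (y ⬝ᵥ y) ∂ν := by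
          congr 1; ext y
          simp only [hΦ]
          have hy := dot_self_nonneg y
          rcases hy.eq_or_lt with h0 | h0
          · simp [← h0]
          · simp_rw [ENNReal.ofReal_mul hy]
            rw [lintegral_const_mul _ (by fun_prop), mul_comm]
            congr 1
            have e1 : 1 + -(1 / (2 * (y ⬝ᵥ y))) * (y ⬝ᵥ y) = 1/2 := by field_simp; norm_num
            have := gE (k := k) (l := -(1 / (2 * (y ⬝ᵥ y)))) 0 y (by rw [e1]; norm_num)
            rw [e1] at this
            have e2 : ∀ Γ : Fin k → Fin n → ℝ, -(-(1 / (2 * y ⬝ᵥ y)) * Qf Γ 0 y) / 2 = Sf Γ y / (4 * (y ⬝ᵥ y)) := by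
              intro Γ
              have : Qf Γ 0 y = Sf Γ y := by simp [Qf, Sf]
              rw [this]; field_simp; ring
            simp_rw [e2] at this
            rw [this]
            congr 1
            rw [one_div, Real.inv_rpow (by norm_num), Real.rpow_neg (by norm_num)]
            simp
      _ = _ := by
          rw [lintegral_const_mul _ (by fun_prop), ← ofReal_integral_eq_lintegral_ofReal hint1 
            (Filter.Eventually.of_forall fun y => dot_self_nonneg y), g.m2]
          simp
  calc gmat k n (TT ν k C)ᶜ = ENNReal.ofReal (exp (-m)) * (ENNReal.ofReal (exp m) * gmat k n (TT ν k C)ᶜ) := by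
        rw [← mul_assoc, ← ENNReal.ofReal_mul (exp_pos _).le, ← Real.exp_add]; simp
    _ ≤ ENNReal.ofReal (exp (-m)) * ENNReal.ofReal (2 ^ (k/2:ℝ)) := by gcongr
    _ = _ := by rw [← ENNReal.ofReal_mul (exp_pos _).le]

lemma gET {k n : ℕ} {ν : Measure (Fin n → ℝ)} [IsProbabilityMeasure ν] {C l : ℝ} (hl : 0 < l) (s : Fin k → ℝ) 
    (y : Fin n → ℝ) {δ : ℝ} (hδ : 0 ≤ δ) (hT : gmat k n (TT ν k C)ᶜ ≤ ENNReal.ofReal δ)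
    (h : 2 * δ ≤ (1 + l * (y ⬝ᵥ y)) ^ (-(k/2:ℝ)) * exp (-(l * (∑ i, s i ^ 2) / (2 * (1 + l * (y ⬝ᵥ y)))))) :
    ENNReal.ofReal ((1/2) * ((1 + l * (y ⬝ᵥ y)) ^ (-(k/2:ℝ)) * exp (-(l * (∑ i, s i ^ 2) / (2 * (1 + l * (y ⬝ᵥ y)))))))
      ≤ ∫⁻ Γ in TT ν k C, ENNReal.ofReal (exp (-(l * Qf Γ s y) / 2)) ∂(gmat k n) := by
  have hV : 0 < 1 + l * (y ⬝ᵥ y) := by have := dot_self_nonneg y; positivity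
  set G := (1 + l * (y ⬝ᵥ y)) ^ (-(k/2:ℝ)) * exp (-(l * (∑ i, s i ^ 2) / (2 * (1 + l * (y ⬝ᵥ y))))) with hG
  have h1 := gE (k := k) (l := l) s y hV
  rw [← lintegral_add_compl _ (meas_TT (ν := ν) k C), ← hG] at h1
  have h2 : ∫⁻ Γ in (TT ν k C)ᶜ, ENNReal.ofReal (exp (-(l * Qf Γ s y) / 2)) ∂(gmat k n) ≤ ENNReal.ofReal δ := by
    calc _ ≤ ∫⁻ Γ in (TT ν k C)ᶜ, 1 ∂(gmat k n) := by
          refine lintegral_mono fun Γ => ?_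
          rw [← ENNReal.ofReal_one]
          refine ENNReal.ofReal_le_ofReal ?_
          rw [Real.exp_le_one_iff]
          have := mul_nonneg hl.le (Qf_nonneg Γ s y)
          linarith
      _ ≤ _ := by simpa using hT
  have h3 : ENNReal.ofReal G ≤ (∫⁻ Γ in TT ν k C, ENNReal.ofReal (exp (-(l * Qf Γ s y) / 2)) ∂(gmat k n)) + ENNReal.ofReal δ := by
    rw [← h1]; gcongr
  calc ENNReal.ofReal (1/2 * G) ≤ ENNReal.ofReal (G - δ) := ENNReal.ofReal_le_ofReal (by linarith)
    _ = ENNReal.ofReal G - ENNReal.ofReal δ := ENNReal.ofReal_sub _ hδ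
    _ ≤ _ := tsub_le_iff_right.mpr h3

lemma amgm_s {m p s t : ℝ} (hm : 0 < m) (hp : |p| < m) (hs : 0 < s) (ht : 0 < t) :
    s ^ (m + p) * t ^ (m - p) ≤ exp (2 * p ^ 2 / m) * (((1/2) * (s + t)) ^ m) ^ 2 := by
  obtain ⟨hp1, hp2⟩ := abs_lt.mp hp
  set x := (1/2) * (s + t) with hx
  have hx0 : 0 < x := by positivity
  set a := p / m with ha
  have ha1 : 0 < 1 + a := by
    rw [ha]; have : 1 + p / m = (m + p) / m := by field_simp
    rw [this]; apply div_pos <;> linarith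
  have ha2 : 0 < 1 - a := by
    rw [ha]; have : 1 - p / m = (m - p) / m := by field_simp
    rw [this]; apply div_pos <;> linarith
  have hpa : p = a * m := by rw [ha]; field_simp
  have hs1 : log s ≤ log x + log (1 + a) + (s / (x * (1 + a)) - 1) := by
    have := Real.log_le_sub_one_of_pos (x := s / (x * (1 + a))) (by positivity)
    rw [Real.log_div (by positivity) (by positivity), Real.log_mul (by positivity) (by positivity)] at this
    linarith
  have ht1 : log t ≤ log x + log (1 - a) + (t / (x * (1 - a)) - 1) := by
    have := Real.log_le_sub_one_of_pos (x := t / (x * (1 - a))) (by positivity)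
    rw [Real.log_div (by positivity) (by positivity), Real.log_mul (by positivity) (by positivity)] at this
    linarith
  have l1 := Real.log_le_sub_one_of_pos ha1
  have l2 := Real.log_le_sub_one_of_pos ha2
  have e1 : (1 + a) * (s / (x * (1 + a))) = s / x := by field_simp
  have e2 : (1 - a) * (t / (x * (1 - a))) = t / x := by field_simp
  have e3 : s / x + t / x = 2 := by rw [← add_div, hx]; field_simp
  have main : (1 + a) * log s + (1 - a) * log t ≤ 2 * a ^ 2 + 2 * log x := by
    have f1 := mul_le_mul_of_nonneg_left hs1 ha1.le
    have f2 := mul_le_mul_of_nonneg_left ht1 ha2.le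
    have g1 := mul_le_mul_of_nonneg_left l1 ha1.le
    have g2 := mul_le_mul_of_nonneg_left l2 ha2.le
    nlinarith
  rw [Real.rpow_def_of_pos hs, Real.rpow_def_of_pos ht, Real.rpow_def_of_pos hx0, ← Real.exp_add,
    ← Real.exp_nat_mul, ← Real.exp_add, Real.exp_le_exp]
  have f3 := mul_le_mul_of_nonneg_left main hm.le
  have e4 : 2 * p ^ 2 / m = m * (2 * a ^ 2) := by rw [hpa]; field_simp
  rw [e4, hpa]
  push_cast
  nlinarith

def cq (k q : ℝ) : ℝ := (1/2) * (k/2) ^ (-(q/2)) * Gamma (q/2)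

lemma sInt {k q V : ℝ} (hk : 0 < k) (hq : 0 < q) (hV : 0 < V) :
    ∫⁻ s in Set.Ioi (0:ℝ), ENNReal.ofReal (s ^ (q - 1) * exp (-(k * s ^ 2 / (2 * V)))) = 
      ENNReal.ofReal (cq k q * V ^ (q/2)) := by
  have e : ∀ s ∈ Set.Ioi (0:ℝ), s ^ (q - 1) * exp (-(k * s ^ 2 / (2 * V))) = 
      s ^ (q - 1) * exp (-(k / (2 * V)) * s ^ (2:ℝ)) := by
    intro s hs
    congr 2
    rw [Real.rpow_two]; ring
  rw [setLIntegral_congr_fun measurableSet_Ioi (fun s hs => congrArg ENNReal.ofReal (e s hs)),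
    ← ofReal_integral_eq_lintegral_ofReal]
  · congr 1
    rw [integral_rpow_mul_exp_neg_mul_rpow (by norm_num) (by linarith) (by positivity), cq]
    rw [show k / (2 * V) = (k/2) / V by field_simp, Real.div_rpow (by positivity) hV.le,
      show -(q - 1 + 1) / 2 = -(q/2) by ring, show (q - 1 + 1)/2 = q / 2 by ring, Real.rpow_neg hV.le]
    field_simp
  · exact integrableOn_rpow_mul_exp_neg_mul_rpow (by linarith) (by norm_num) (by positivity)
  · refine (ae_restrict_iff' measurableSet_Ioi).mpr (Filter.Eventually.of_forall fun s hs => ?_)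
    have : (0:ℝ) < s := hs
    positivity

lemma cq_pos {k q : ℝ} (hk : 0 < k) (hq : 0 < q) : 0 < cq k q := by
  have := Real.Gamma_pos_of_pos (by positivity : 0 < q/2)
  unfold cq; positivity

lemma cq_succ {k q : ℝ} (hk : 0 < k) (hq : 0 < q) : cq k (q + 2) = cq k q * (q / k) := by
  unfold cq
  rw [show (q + 2)/2 = q/2 + 1 by ring, Real.Gamma_add_one (by positivity), neg_add, 
    Real.rpow_add (by positivity), Real.rpow_neg_one]
  field_simp

lemma cq_logconv {k p : ℝ} (hk : 0 < k) (hp : |p| < k) : cq k k ^ 2 ≤ cq k (k + p) * cq k (k - p) := by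
  obtain ⟨hp1, hp2⟩ := abs_lt.mp hp
  have h := Real.Gamma_mul_add_mul_le_rpow_Gamma_mul_rpow_Gamma (s := (k+p)/2) (t := (k-p)/2) (a := 1/2) (b := 1/2)
    (by linarith) (by linarith) (by norm_num) (by norm_num) (by norm_num)
  have e : 1/2 * ((k+p)/2) + 1/2 * ((k-p)/2) = k/2 := by ring
  rw [e, ← Real.sqrt_eq_rpow, ← Real.sqrt_eq_rpow] at h
  have g1 := Real.Gamma_pos_of_pos (by linarith : 0 < (k+p)/2)
  have g2 := Real.Gamma_pos_of_pos (by linarith : 0 < (k-p)/2)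
  have g3 := Real.Gamma_pos_of_pos (by linarith : 0 < k/2)
  have h2 : Gamma (k/2) ^ 2 ≤ Gamma ((k+p)/2) * Gamma ((k-p)/2) := by
    calc _ ≤ (√(Gamma ((k+p)/2)) * √(Gamma ((k-p)/2))) ^ 2 := by gcongr
      _ = _ := by rw [mul_pow, Real.sq_sqrt g1.le, Real.sq_sqrt g2.le]
  unfold cq
  have e2 : (k/2:ℝ) ^ (-((k+p)/2)) * (k/2) ^ (-((k-p)/2)) = ((k/2) ^ (-(k/2)))^2 := by
    rw [← Real.rpow_add (by positivity), ← Real.rpow_natCast, ← Real.rpow_mul (by positivity)]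
    congr 1; push_cast; ring
  calc _ = (1/4) * ((k/2) ^ (-(k/2)))^2 * Gamma (k/2)^2 := by ring
    _ ≤ (1/4) * ((k/2) ^ (-(k/2)))^2 * (Gamma ((k+p)/2) * Gamma ((k-p)/2)) := by gcongr
    _ = _ := by rw [← e2]; ring

lemma sIntLow {k q V τ : ℝ} (hk : 0 < k) (hq : 0 < q) (hV : 0 < V) (hτ : 0 < τ) (h : 2 * q * V ≤ k * τ ^ 2) :
    ENNReal.ofReal ((1/2) * (cq k q * V ^ (q/2))) ≤
    ∫⁻ s in Set.Ioc (0:ℝ) τ, ENNReal.ofReal (s ^ (q - 1) * exp (-(k * s ^ 2 / (2 * V)))) := by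
  have h1 := sInt hk hq hV
  have hc := cq_pos hk hq
  rw [← Set.Ioc_union_Ioi_eq_Ioi hτ.le, lintegral_union measurableSet_Ioi (by 
    rw [Set.disjoint_left]; intro x hx hx2; exact absurd hx.2 (not_le.mpr hx2))] at h1
  set J := ∫⁻ s in Set.Ioc (0:ℝ) τ, ENNReal.ofReal (s ^ (q - 1) * exp (-(k * s ^ 2 / (2 * V))))
  have h2 : ∫⁻ s in Set.Ioi τ, ENNReal.ofReal (s ^ (q - 1) * exp (-(k * s ^ 2 / (2 * V)))) ≤ 
      ENNReal.ofReal ((1/2) * (cq k q * V ^ (q/2))) := by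
    calc _ ≤ ∫⁻ s in Set.Ioi τ, ENNReal.ofReal (τ⁻¹^2) * ENNReal.ofReal (s ^ (q + 2 - 1) * exp (-(k * s ^ 2 / (2 * V)))) := by
          refine setLIntegral_mono' measurableSet_Ioi fun s hs => ?_
          rw [← ENNReal.ofReal_mul (by positivity)]
          refine ENNReal.ofReal_le_ofReal ?_
          have hs' : τ < s := hs
          have hs0 : 0 < s := hτ.trans hs'
          rw [show q + 2 - 1 = (q - 1) + 2 by ring, Real.rpow_add hs0, Real.rpow_two]
          have : 1 ≤ τ⁻¹^2 * s^2 := by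
            rw [← mul_pow]
            apply one_le_pow₀
            rw [inv_mul_eq_div, one_le_div hτ]; exact hs'.le
          calc s ^ (q - 1) * exp (-(k * s ^ 2 / (2 * V))) = 1 * (s ^ (q - 1) * exp (-(k * s ^ 2 / (2 * V)))) := by ring
            _ ≤ (τ⁻¹^2 * s^2) * (s ^ (q - 1) * exp (-(k * s ^ 2 / (2 * V)))) := by gcongr
            _ = _ := by ring
      _ = ENNReal.ofReal (τ⁻¹^2) * ∫⁻ s in Set.Ioi τ, ENNReal.ofReal (s ^ (q + 2 - 1) * exp (-(k * s ^ 2 / (2 * V)))) := by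
          rw [lintegral_const_mul _ (by fun_prop)]
      _ ≤ ENNReal.ofReal (τ⁻¹^2) * ∫⁻ s in Set.Ioi 0, ENNReal.ofReal (s ^ (q + 2 - 1) * exp (-(k * s ^ 2 / (2 * V)))) := by
          gcongr
      _ = ENNReal.ofReal (τ⁻¹^2 * (cq k (q+2) * V ^ ((q+2)/2))) := by
          rw [sInt hk (by linarith) hV, ← ENNReal.ofReal_mul (by positivity)]
      _ ≤ _ := by
          refine ENNReal.ofReal_le_ofReal ?_
          rw [cq_succ hk hq, show (q+2)/2 = q/2 + 1 by ring, Real.rpow_add hV, Real.rpow_one]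
          have : τ⁻¹^2 * (q / k) * V ≤ 1/2 := by
            rw [show τ⁻¹^2 * (q / k) * V = (q * V) / (k * τ^2) by field_simp, div_le_iff₀ (by positivity)]
            linarith
          calc _ = (τ⁻¹^2 * (q / k) * V) * (cq k q * V ^ (q/2)) := by ring
            _ ≤ _ := by gcongr
  have h3 : ENNReal.ofReal (cq k q * V ^ (q/2)) ≤ J + ENNReal.ofReal ((1/2) * (cq k q * V ^ (q/2))) := by
    rw [← h1]; gcongr
  rw [← tsub_le_iff_right, ← ENNReal.ofReal_sub _ (by positivity)] at h3
  refine le_trans (le_of_eq ?_) h3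
  congr 1; ring
end GM

namespace GM
set_option linter.all false

lemma tri_swap {k n : ℕ} {ν : Measure (Fin n → ℝ)} [IsProbabilityMeasure ν] (T : Set (Fin k → Fin n → ℝ))
    (I : Set ℝ) (q l : ℝ) :
    ∫⁻ z in T ×ˢ I, ENNReal.ofReal (z.2 ^ (q - 1)) * hE ν l z.1 (fun _ => z.2) ∂((gmat k n).prod volume) =
    ∫⁻ y, (∫⁻ s in I, ENNReal.ofReal (s ^ (q - 1)) * 
      (∫⁻ Γ in T, ENNReal.ofReal (exp (-(l * Qf Γ (fun _ => s) y) / 2)) ∂(gmat k n))) ∂ν := by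
  rw [← Measure.prod_restrict, lintegral_prod_symm _ (by fun_prop)]
  rw [lintegral_lintegral_swap (f := fun y s => ENNReal.ofReal (s ^ (q - 1)) * 
      ∫⁻ Γ in T, ENNReal.ofReal (exp (-(l * Qf Γ (fun _ => s) y) / 2)) ∂(gmat k n))]
  · refine lintegral_congr fun s => ?_
    simp only
    rw [lintegral_const_mul _ (by fun_prop), lintegral_const_mul]
    · congr 1
      simp only [hE]
      exact lintegral_lintegral_swap (by simp only [Function.uncurry_def]; fun_prop)
    · exact Measurable.lintegral_prod_right' (f := fun p : (Fin n → ℝ) × (Fin k → Fin n → ℝ) => 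
        ENNReal.ofReal (exp (-(l * Qf p.2 (fun _ => s) p.1) / 2))) (by fun_prop)
  · have : Measurable (fun p : (Fin n → ℝ) × ℝ => 
      ∫⁻ Γ in T, ENNReal.ofReal (exp (-(l * Qf Γ (fun _ => p.2) p.1) / 2)) ∂(gmat k n)) :=
      Measurable.lintegral_prod_right' (f := fun p : ((Fin n → ℝ) × ℝ) × (Fin k → Fin n → ℝ) => 
        ENNReal.ofReal (exp (-(l * Qf p.2 (fun _ => p.1.2) p.1.1) / 2))) (by fun_prop)
    simp only [Function.uncurry_def]
    fun_prop

def FF {n : ℕ} (ν : Measure (Fin n → ℝ)) (p : ℝ) : ℝ≥0∞ := 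
  ∫⁻ y in {y | y ⬝ᵥ y ≤ 100}, ENNReal.ofReal ((1 + y ⬝ᵥ y) ^ (p / 2)) ∂ν

def AA : ℝ := 1339

lemma u_low {n k : ℕ} {ν : Measure (Fin n → ℝ)} [IsProbabilityMeasure ν] {r : ℝ} (g : Good ν k r) 
    {p : ℝ} (hp : |p| < k) : 
    ENNReal.ofReal (1/4 * cq k (k + p)) * FF ν p ≤ 
    ∫⁻ z in TT ν k 898 ×ˢ Set.Ioc (0:ℝ) 21, ENNReal.ofReal (z.2 ^ ((k:ℝ) + p - 1)) * hE ν 1 z.1 (fun _ => z.2) ∂((gmat k n).prod volume) := by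
  obtain ⟨hp1, hp2⟩ := abs_lt.mp hp
  have hk : (1:ℝ) ≤ k := by exact_mod_cast g.kpos
  have hq : 0 < (k:ℝ) + p := by linarith
  have hcq := cq_pos (by linarith : (0:ℝ) < k) hq
  rw [tri_swap]
  refine le_trans ?_ (setLIntegral_le_lintegral {y | y ⬝ᵥ y ≤ 100} _)
  have hms : MeasurableSet {y : Fin n → ℝ | y ⬝ᵥ y ≤ 100} := measurableSet_le (by fun_prop) measurable_const
  rw [FF, ← lintegral_const_mul _ (by fun_prop)]
  refine setLIntegral_mono' hms fun y hy => ?_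
  have hy1 : y ⬝ᵥ y ≤ 100 := hy
  have hy0 := dot_self_nonneg y
  set V := 1 + y ⬝ᵥ y with hV
  have hV1 : 1 ≤ V := by linarith
  have hV0 : 0 < V := by linarith
  calc ENNReal.ofReal (1/4 * cq k (k + p)) * ENNReal.ofReal (V ^ (p/2)) 
      = ENNReal.ofReal (1/2 * V ^ (-(k/2:ℝ))) * ENNReal.ofReal (1/2 * (cq k (k + p) * V ^ ((k+p)/2))) := by
        rw [← ENNReal.ofReal_mul (by positivity), ← ENNReal.ofReal_mul (by positivity)]
        congr 1
        rw [show ((k:ℝ) + p)/2 = k/2 + p/2 by ring, Real.rpow_add hV0, Real.rpow_neg hV0.le]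
        field_simp
        ring
    _ ≤ ENNReal.ofReal (1/2 * V ^ (-(k/2:ℝ))) * 
        ∫⁻ s in Set.Ioc (0:ℝ) 21, ENNReal.ofReal (s ^ (k + p - 1) * exp (-(k * s ^ 2 / (2 * V)))) := by
        gcongr
        refine sIntLow (by linarith) hq hV0 (by norm_num) ?_
        nlinarith
    _ = ∫⁻ s in Set.Ioc (0:ℝ) 21, ENNReal.ofReal (1/2 * V ^ (-(k/2:ℝ))) * 
        ENNReal.ofReal (s ^ (k + p - 1) * exp (-(k * s ^ 2 / (2 * V)))) := by
        rw [lintegral_const_mul _ (by fun_prop)]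
    _ ≤ _ := by
        refine setLIntegral_mono' measurableSet_Ioc fun s hs => ?_
        have hs0 : 0 < s := hs.1
        have hs1 : s ≤ 21 := hs.2
        have hT := TTc g (C := 898) (by norm_num)
        have hsum : ∑ i : Fin k, (fun _ : Fin k => s) i ^ 2 = k * s ^ 2 := by simp
        have := gET (l := 1) one_pos (fun _ : Fin k => s) y (by positivity) hT (by
          rw [hsum, one_mul, one_mul, ← hV]
          have e1 : (101:ℝ) ^ (-(k/2:ℝ)) ≤ V ^ (-(k/2:ℝ)) := by
            apply Real.rpow_le_rpow_of_nonpos hV0 (by linarith)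
            linarith
          have e2 : exp (-(441 * k / 2)) ≤ exp (-(k * s ^ 2 / (2 * V))) := by
            rw [Real.exp_le_exp, neg_le_neg_iff]
            have : k * s ^ 2 / (2 * V) ≤ k * s ^ 2 / 2 := by
              apply div_le_div_of_nonneg_left (by positivity) (by norm_num) (by linarith)
            have h3 : s ^ 2 ≤ 441 := by nlinarith
            have h4 : k * s ^ 2 ≤ k * 441 := mul_le_mul_of_nonneg_left h3 (by linarith)
            linarith
          refine le_trans ?_ (mul_le_mul e1 e2 (exp_pos _).le (by positivity))
          have e3 : 2 * (202:ℝ) ^ (k/2:ℝ) ≤ exp (4 * k) := by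
            have h202 : (202:ℝ) ^ (k/2:ℝ) ≤ 16 ^ (k:ℕ) := by
              calc (202:ℝ) ^ (k/2:ℝ) ≤ (16^2) ^ (k/2:ℝ) := by gcongr; norm_num
                _ = _ := by 
                  rw [← Real.rpow_natCast 16 2, ← Real.rpow_mul (by norm_num), ← Real.rpow_natCast]
                  congr 1; push_cast; ring
            have h2 : (2:ℝ) ≤ 2 ^ k := by
              calc (2:ℝ) = 2^1 := by norm_num
                _ ≤ 2^k := by gcongr; norm_num; exact g.kpos
            calc _ ≤ 2^k * 16^(k:ℕ) := by gcongr
              _ = (32:ℝ)^k := by rw [← mul_pow]; norm_num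
              _ ≤ (exp 4)^k := by
                gcongr
                have := Real.exp_one_gt_d9
                calc (32:ℝ) ≤ (2.7182818283)^4 := by norm_num
                  _ ≤ (exp 1)^4 := by gcongr
                  _ = _ := by rw [← Real.exp_nat_mul]; norm_num
              _ = _ := by rw [← Real.exp_nat_mul]; congr 1; ring
          have e4 : (202:ℝ) ^ (k/2:ℝ) = 2 ^ (k/2:ℝ) * 101 ^ (k/2:ℝ) := by
            rw [← Real.mul_rpow (by norm_num) (by norm_num)]; norm_num
          have e5 : exp (-(898 * k / 4)) = exp (-(441 * k/2)) * (exp (4 * k))⁻¹ := by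
            rw [← Real.exp_neg, ← Real.exp_add]; congr 1; ring
          rw [e5, Real.rpow_neg (by norm_num)]
          rw [e4] at e3
          have p1 : (0:ℝ) < 101 ^ (k/2:ℝ) := by positivity
          have p2 := exp_pos (4 * (k:ℝ))
          have p3 := exp_pos (-(441 * (k:ℝ)/2))
          rw [inv_mul_eq_div, le_div_iff₀ p1]
          calc _ = exp (-(441 * (k:ℝ)/2)) * (2 * (2 ^ (k/2:ℝ) * 101 ^ (k/2:ℝ))) * (exp (4 * k))⁻¹ := by ring
            _ ≤ exp (-(441 * (k:ℝ)/2)) * exp (4 * k) * (exp (4 * k))⁻¹ := by gcongr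
            _ = _ := by field_simp)
        rw [hsum, one_mul, one_mul, ← hV] at this
        calc _ = ENNReal.ofReal (s ^ (k + p - 1)) * ENNReal.ofReal (1 / 2 * (V ^ (-(k / 2:ℝ)) * exp (-(k * s ^ 2 / (2 * V))))) := by
              rw [← ENNReal.ofReal_mul (by positivity), ← ENNReal.ofReal_mul (by positivity)]
              congr 1; ring
          _ ≤ _ := by gcongr

lemma w_up {n k : ℕ} {ν : Measure (Fin n → ℝ)} [IsProbabilityMeasure ν] (hk : 1 ≤ k) : 
    ∫⁻ z in Set.univ ×ˢ Set.Ioc (0:ℝ) 21, ENNReal.ofReal (z.2 ^ ((k:ℝ) - 1)) * hE ν 1 z.1 (fun _ => z.2) ∂((gmat k n).prod volume)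
     ≤ ENNReal.ofReal (cq k k) := by
  have hk : (1:ℝ) ≤ k := by exact_mod_cast hk
  rw [tri_swap]
  calc _ ≤ ∫⁻ y, ENNReal.ofReal (cq k k) ∂ν := by
        refine lintegral_mono fun y => ?_
        have hy0 := dot_self_nonneg y
        set V := 1 + y ⬝ᵥ y with hV
        have hV0 : 0 < V := by linarith
        calc _ = ∫⁻ s in Set.Ioc (0:ℝ) 21, ENNReal.ofReal (V ^ (-(k/2:ℝ))) * 
              ENNReal.ofReal (s ^ ((k:ℝ) - 1) * exp (-(k * s ^ 2 / (2 * V)))) := by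
              refine setLIntegral_congr_fun measurableSet_Ioc fun s hs => ?_
              have hs0 : 0 < s := hs.1
              have hsum : ∑ i : Fin k, (fun _ : Fin k => s) i ^ 2 = k * s ^ 2 := by simp
              simp only [Measure.restrict_univ]
              rw [gE (l := 1) _ y (by linarith), hsum, one_mul, one_mul, ← hV, 
                ← ENNReal.ofReal_mul (by positivity), ← ENNReal.ofReal_mul (by positivity)]
              congr 1; ring
          _ ≤ ∫⁻ s in Set.Ioi (0:ℝ), ENNReal.ofReal (V ^ (-(k/2:ℝ))) * 
              ENNReal.ofReal (s ^ ((k:ℝ) - 1) * exp (-(k * s ^ 2 / (2 * V)))) := 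
              lintegral_mono_set Set.Ioc_subset_Ioi_self
          _ = _ := by
              rw [lintegral_const_mul _ (by fun_prop), sInt (by linarith) (by linarith) hV0, 
                ← ENNReal.ofReal_mul (by positivity)]
              congr 1
              rw [Real.rpow_neg hV0.le]
              field_simp
    _ = _ := by simp

theorem main_ineq {n k : ℕ} {ν : Measure (Fin n → ℝ)} [IsProbabilityMeasure ν] {r : ℝ} (g : Good ν k r) 
    {p : ℝ} (hp : |p| < k - 1) (hr : 4 * exp AA * r ≤ 1) : 
    FF ν p * FF ν (-p) ≤ ENNReal.ofReal (16 * exp (2 * p ^ 2 / (k - 1) + 8 * AA * exp AA * k * r)) := by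
  have hk : (1:ℝ) ≤ k := by exact_mod_cast g.kpos
  have hk2 : (0:ℝ) < k - 1 := (abs_nonneg p).trans_lt hp
  have hpl := (plm_gmat k n).prod plm_real (fun x y => by simp [Real.exp_pos]) (by simp)
  set T := TT ν k 898
  set I := Set.Ioc (0:ℝ) 21
  have hTm : MeasurableSet (T ×ˢ I) := (meas_TT k _).prod measurableSet_Ioc
  have hUm : MeasurableSet ((Set.univ : Set (Fin k → Fin n → ℝ)) ×ˢ I) := MeasurableSet.univ.prod measurableSet_Ioc
  set f : ℝ → (Fin k → Fin n → ℝ) × ℝ → ℝ≥0∞ := 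
    fun q z => ENNReal.ofReal (z.2 ^ q) * hE ν 1 z.1 (fun _ => z.2) with hf
  have hfm : ∀ q, Measurable (f q) := fun q => by
    simp only [hf]
    fun_prop
  have main := plm_scale hpl (K := ENNReal.ofReal (exp (2 * p ^ 2 / (k - 1) + 8 * AA * exp AA * k * r)))
    (by simp [Real.exp_pos]) (by simp) (u := (T ×ˢ I).indicator (f (k + p - 1)))
    (v := (T ×ˢ I).indicator (f (k + -p - 1))) (w := (Set.univ ×ˢ I).indicator (f (k - 1)))
    ((hfm _).indicator hTm) ((hfm _).indicator hTm) ((hfm _).indicator hUm) (by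
      rintro ⟨Γ, s⟩ ⟨Γ', s'⟩
      by_cases h1 : (Γ, s) ∈ T ×ˢ I
      swap
      · rw [Set.indicator_of_notMem h1]; simp
      by_cases h2 : (Γ', s') ∈ T ×ˢ I
      swap
      · rw [Set.indicator_of_notMem h2]; simp
      obtain ⟨hΓ, hs⟩ := h1
      obtain ⟨hΓ', hs'⟩ := h2
      simp only at hΓ hs hΓ' hs'
      have h3 : (1/2:ℝ) • ((Γ, s) + (Γ', s')) ∈ (Set.univ : Set (Fin k → Fin n → ℝ)) ×ˢ I := by
        refine ⟨trivial, ?_⟩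
        simp only [Prod.mk_add_mk, Prod.smul_mk, smul_eq_mul]
        constructor <;> linarith [hs.1, hs.2, hs'.1, hs'.2]
      rw [Set.indicator_of_mem (show (Γ, s) ∈ T ×ˢ I from ⟨hΓ, hs⟩), Set.indicator_of_mem (show (Γ', s') ∈ T ×ˢ I from ⟨hΓ', hs'⟩), Set.indicator_of_mem h3]
      simp only [hf, Prod.mk_add_mk, Prod.smul_mk, smul_eq_mul, mul_one]
      have hmid := hE_mid g (l := 1) (t := 441) (C := 898) (A := AA) one_pos (by norm_num) (by norm_num) 
        (by rw [AA]; norm_num) (by simpa using hr) hΓ hΓ' (s := fun _ => s) (s' := fun _ => s')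
        (by simp only [Finset.sum_const, Finset.card_univ, Fintype.card_fin, nsmul_eq_mul]
            have h9 : s ^ 2 ≤ 441 := by nlinarith [hs.1, hs.2]
            have h10 : k * s ^ 2 ≤ k * 441 := mul_le_mul_of_nonneg_left h9 (by linarith)
            linarith)
        (by simp only [Finset.sum_const, Finset.card_univ, Fintype.card_fin, nsmul_eq_mul]
            have h9 : s' ^ 2 ≤ 441 := by nlinarith [hs'.1, hs'.2]
            have h10 : k * s' ^ 2 ≤ k * 441 := mul_le_mul_of_nonneg_left h9 (by linarith)
            linarith)
      have em : ((1/2:ℝ) • ((fun _ => s) + (fun _ => s') : Fin k → ℝ)) = fun _ => (1/2:ℝ) * (s + s') := by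
        ext i; simp
      rw [em, one_mul] at hmid
      have ham := amgm_s (m := (k:ℝ) - 1) hk2 hp hs.1 hs'.1
      have ham' := ENNReal.ofReal_le_ofReal ham
      have hs0 : 0 < s := hs.1
      have hs0' : 0 < s' := hs'.1
      rw [ENNReal.ofReal_mul (by positivity), ENNReal.ofReal_mul (by positivity), ENNReal.ofReal_pow (by positivity)] at ham'
      rw [show (k:ℝ) + p - 1 = k - 1 + p by ring, show (k:ℝ) + -p - 1 = k - 1 - p by ring, Real.exp_add, 
        ENNReal.ofReal_mul (by positivity)]
      have := mul_le_mul' ham' hmid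
      have en : ∑ i, ∑ j, (Γ i j - Γ' i j) ^ 2 = nrm (Γ - Γ') := by simp [nrm]
      rw [en]
      calc _ = _ := by ring
        _ ≤ _ := this
        _ = _ := by ring)
  rw [lintegral_indicator hTm, lintegral_indicator hTm, lintegral_indicator hUm] at main
  have hpk : |p| < k := by linarith
  have h1 := u_low g (p := p) hpk
  have h2 := u_low g (p := -p) (by rwa [abs_neg])
  have h3 := w_up (n := n) (ν := ν) g.kpos
  obtain ⟨hp1, hp2⟩ := abs_lt.mp hpk
  have c1 := cq_pos (by linarith : (0:ℝ) < k) (by linarith : (0:ℝ) < k + p)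
  have c2 := cq_pos (by linarith : (0:ℝ) < k) (by linarith : (0:ℝ) < k + -p)
  have c3 := cq_logconv (by linarith : (0:ℝ) < k) hpk
  set c := 1/16 * (cq k (k+p) * cq k (k+-p)) with hc
  have hc0 : 0 < c := by positivity
  set E := exp (2 * p ^ 2 / (k - 1) + 8 * AA * exp AA * k * r) with hE
  have h4 : ENNReal.ofReal c * (FF ν p * FF ν (-p)) ≤ ENNReal.ofReal (c * (16 * E)) := by
    calc _ = (ENNReal.ofReal (1/4 * cq k (k + p)) * FF ν p) * (ENNReal.ofReal (1/4 * cq k (k + -p)) * FF ν (-p)) := by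
          rw [show ∀ a b c d : ℝ≥0∞, a * b * (c * d) = (a * c) * (b * d) by intros; ring, 
            ← ENNReal.ofReal_mul (by positivity), hc]
          congr 2; ring
      _ ≤ _ := mul_le_mul' h1 h2
      _ ≤ _ := main
      _ ≤ ENNReal.ofReal E * (ENNReal.ofReal (cq k k)) ^ 2 := by gcongr
      _ = ENNReal.ofReal (E * (cq k k) ^ 2) := by
          rw [ENNReal.ofReal_mul (exp_pos _).le, ENNReal.ofReal_pow (cq_pos (by linarith) (by linarith)).le]
      _ ≤ _ := by
          refine ENNReal.ofReal_le_ofReal ?_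
          rw [hc]
          have : E * (cq k k) ^ 2 ≤ E * (cq k (k+p) * cq k (k - p)) := by gcongr
          rw [← sub_eq_add_neg]
          linarith
  rw [ENNReal.ofReal_mul hc0.le] at h4
  exact (ENNReal.mul_le_mul_iff_right (by simpa using hc0) (by simp)).mp h4
end GM

namespace GM
set_option linter.all false

lemma ms_lt {n : ℕ} (u : ℝ) : MeasurableSet {y : Fin n → ℝ | u < y ⬝ᵥ y} :=
  measurableSet_lt measurable_const (by fun_prop)
lemma ms_le {n : ℕ} (u : ℝ) : MeasurableSet {y : Fin n → ℝ | y ⬝ᵥ y ≤ u} :=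
  measurableSet_le (by fun_prop) measurable_const

lemma lc_sets {E : Type*} [AddCommGroup E] [Module ℝ E] [MeasurableSpace E] {ν : Measure E}
    (hν : PLM ν (fun _ _ => 1)) {A B C : Set E} (hA : MeasurableSet A) (hB : MeasurableSet B)
    (hC : MeasurableSet C) (h : ∀ x ∈ A, ∀ y ∈ B, (1/2:ℝ) • (x + y) ∈ C) : ν A * ν B ≤ ν C ^ 2 := by
  have := hν (A.indicator 1) (B.indicator 1) (C.indicator 1) (measurable_one.indicator hA) 
    (measurable_one.indicator hB) (measurable_one.indicator hC) (by
      intro x y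
      by_cases hx : x ∈ A
      · by_cases hy : y ∈ B
        · simp only [Set.indicator_of_mem hx, Set.indicator_of_mem hy, Set.indicator_of_mem (h x hx y hy)]
          simp
        · simp [Set.indicator_of_notMem hy]
      · simp [Set.indicator_of_notMem hx])
  simpa [lintegral_indicator_one, hA, hB, hC] using this

lemma mid_large {n : ℕ} {a b : ℝ} (ha : 0 ≤ a) (hab : a ≤ b) {x y : Fin n → ℝ} (hx : x ⬝ᵥ x ≤ a ^ 2) (hy : b ^ 2 < y ⬝ᵥ y) :
    ((b - a) / 2) ^ 2 < ((1/2:ℝ) • (x + y)) ⬝ᵥ ((1/2:ℝ) • (x + y)) := by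
  have e : ((1/2:ℝ) • (x + y)) ⬝ᵥ ((1/2:ℝ) • (x + y)) = (x ⬝ᵥ x + 2 * (x ⬝ᵥ y) + y ⬝ᵥ y) / 4 := by
    simp only [smul_dotProduct, dotProduct_smul, add_dotProduct, dotProduct_add, smul_eq_mul]
    rw [dotProduct_comm y x]; ring
  rw [e]
  have h := cs_dot x y
  have hx0 := dot_self_nonneg x
  set p := x ⬝ᵥ x
  set q := y ⬝ᵥ y
  set s := x ⬝ᵥ y
  have hq0 : 0 < q := by nlinarith [sq_nonneg b]
  set P := √p with hP
  set Q := √q with hQ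
  have hP2 : P ^ 2 = p := Real.sq_sqrt hx0
  have hQ2 : Q ^ 2 = q := Real.sq_sqrt hq0.le
  have hPa : P ≤ a := by rw [hP]; exact Real.sqrt_le_iff.mpr ⟨ha, hx⟩
  have hQb : b < Q := by rw [hQ]; exact Real.lt_sqrt_of_sq_lt hy
  have hP0 : 0 ≤ P := Real.sqrt_nonneg _
  have hQ0 : 0 < Q := Real.sqrt_pos.mpr hq0
  have hs : -(P * Q) ≤ s := by
    have : |s| ≤ P * Q := by
      apply abs_le_of_sq_le_sq _ (by positivity)
      rw [mul_pow, hP2, hQ2]; exact h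
    exact (abs_le.mp this).1
  have : (b - a) ^ 2 < (Q - P) ^ 2 := by
    apply pow_lt_pow_left₀ (by linarith) (by linarith) (by norm_num)
  nlinarith

lemma borell_step {n : ℕ} {ν : Measure (Fin n → ℝ)} (hν : PLM ν (fun _ _ => 1)) {u0 u : ℝ} (h0 : 0 < u0)
    (hu : u0 ≤ u) (h34 : ENNReal.ofReal (3/4) ≤ ν {y | y ⬝ᵥ y ≤ u0}) {a : ℝ} (ha : 0 ≤ a)
    (h : ν {y | u < y ⬝ᵥ y} ≤ ENNReal.ofReal a) : ν {y | u * 9 < y ⬝ᵥ y} ≤ ENNReal.ofReal (2 * a ^ 2) := by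
  have h1 : ν {y | y ⬝ᵥ y ≤ u0} * ν {y | u * 9 < y ⬝ᵥ y} ≤ ν {y | u < y ⬝ᵥ y} ^ 2 := by
    refine lc_sets hν (ms_le _) (ms_lt _) (ms_lt _) ?_
    intro x hx y hy
    have hu0 : 0 < u := by linarith
    have := mid_large (a := √u) (b := 3 * √u) (Real.sqrt_nonneg _) (by linarith [Real.sqrt_nonneg u]) 
      (x := x) (y := y) (by rw [Real.sq_sqrt hu0.le]; exact le_trans hx hu)
      (by rw [mul_pow, Real.sq_sqrt hu0.le]; have hy : u * 9 < y ⬝ᵥ y := hy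
          linarith)
    rw [show (3 * √u - √u)/2 = √u by ring, Real.sq_sqrt hu0.le] at this
    exact this
  have h2 : ENNReal.ofReal (3/4) * ν {y | u * 9 < y ⬝ᵥ y} ≤ ENNReal.ofReal (3/4) * ENNReal.ofReal (2 * a ^ 2) := by
    calc _ ≤ _ := mul_le_mul' h34 le_rfl
      _ ≤ _ := h1
      _ ≤ ENNReal.ofReal a ^ 2 := by gcongr
      _ = ENNReal.ofReal (a ^ 2) := by rw [ENNReal.ofReal_pow ha]
      _ ≤ _ := by
        rw [← ENNReal.ofReal_mul (by norm_num)]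
        apply ENNReal.ofReal_le_ofReal
        nlinarith [sq_nonneg a]
  exact (ENNReal.mul_le_mul_iff_right (by simp) (by simp)).mp h2

lemma borell {n : ℕ} {ν : Measure (Fin n → ℝ)} (hν : PLM ν (fun _ _ => 1)) {u0 u : ℝ} (h0 : 0 < u0)
    (hu : u0 ≤ u) (h34 : ENNReal.ofReal (3/4) ≤ ν {y | y ⬝ᵥ y ≤ u0}) {a : ℝ} (ha : 0 ≤ a)
    (h : ν {y | u < y ⬝ᵥ y} ≤ ENNReal.ofReal a) (j : ℕ) : 
    ν {y | u * 9 ^ j < y ⬝ᵥ y} ≤ ENNReal.ofReal ((2 * a) ^ (2 ^ j) / 2) := by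
  induction j with
  | zero => simpa using h
  | succ j ih =>
    have h9 : (1:ℝ) ≤ 9 ^ j := one_le_pow₀ (by norm_num)
    have := borell_step hν h0 (u := u * 9 ^ j) (by nlinarith) h34 (by positivity) ih
    rw [pow_succ, ← mul_assoc]
    refine this.trans (le_of_eq ?_)
    congr 1
    rw [pow_succ 2 j, pow_mul]; ring

lemma borell_int {n : ℕ} {ν : Measure (Fin n → ℝ)} (hν : PLM ν (fun _ _ => 1)) {u0 u : ℝ} (h0 : 0 < u0)
    (hu : u0 ≤ u) (hu1 : 1 ≤ u) (h34 : ENNReal.ofReal (3/4) ≤ ν {y | y ⬝ᵥ y ≤ u0}) {a : ℝ} (ha : 0 ≤ a) (ha2 : 2 * a ≤ 1)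
    (h : ν {y | u < y ⬝ᵥ y} ≤ ENNReal.ofReal a) {m q : ℝ} (hm : 0 ≤ m) (hq : (9 * u) ^ m * (2 * a) ≤ q) (hq2 : q ≤ 1/2) :
    ∫⁻ y in {y | u < y ⬝ᵥ y}, ENNReal.ofReal ((y ⬝ᵥ y) ^ m) ∂ν ≤ ENNReal.ofReal q := by
  have hq0 : 0 ≤ q := le_trans (by positivity) hq
  set f : ℕ → (Fin n → ℝ) → ℝ≥0∞ := fun j => 
    {y | u * 9 ^ j < y ⬝ᵥ y}.indicator (fun _ => ENNReal.ofReal ((u * 9 ^ (j+1)) ^ m)) with hf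
  have hpt : ∀ y ∈ {y : Fin n → ℝ | u < y ⬝ᵥ y}, ENNReal.ofReal ((y ⬝ᵥ y) ^ m) ≤ ∑' j, f j y := by
    intro y hy
    have hy : u < y ⬝ᵥ y := hy
    obtain ⟨j, hj1, hj2⟩ := exists_nat_pow_near (x := (y ⬝ᵥ y) / u) (y := (9:ℝ)) (by rw [le_div_iff₀ (by linarith)]; linarith) (by norm_num)
    rw [le_div_iff₀ (by linarith)] at hj1
    rw [div_lt_iff₀ (by linarith)] at hj2
    rcases hj1.lt_or_eq with hj1 | hj1
    · refine le_trans ?_ (ENNReal.le_tsum j)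
      rw [hf]
      simp only
      rw [Set.indicator_of_mem (by simp only [Set.mem_ofPred_eq]; linarith)]
      apply ENNReal.ofReal_le_ofReal
      apply Real.rpow_le_rpow (by linarith) (by linarith) hm
    · rcases j with _ | j
      · simp at hj1; linarith
      refine le_trans ?_ (ENNReal.le_tsum j)
      rw [hf]
      simp only
      rw [Set.indicator_of_mem (by 
        simp only [Set.mem_ofPred_eq, ← hj1, pow_succ]
        have : (0:ℝ) < 9 ^ j := by positivity
        nlinarith)]
      apply ENNReal.ofReal_le_ofReal
      apply Real.rpow_le_rpow (by linarith) (by linarith) hm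
  calc _ ≤ ∫⁻ y in {y | u < y ⬝ᵥ y}, ∑' j, f j y ∂ν := setLIntegral_mono' (ms_lt _) hpt
    _ ≤ ∫⁻ y, ∑' j, f j y ∂ν := setLIntegral_le_lintegral _ _
    _ = ∑' j, ∫⁻ y, f j y ∂ν := lintegral_tsum fun j => (measurable_const.indicator (ms_lt _)).aemeasurable
    _ ≤ ∑' j : ℕ, ENNReal.ofReal (q / 2 * (1/2) ^ j) := by
      refine ENNReal.tsum_le_tsum fun j => ?_
      rw [hf]
      simp only
      rw [lintegral_indicator_const (ms_lt _)]
      calc _ ≤ ENNReal.ofReal ((u * 9 ^ (j+1)) ^ m) * ENNReal.ofReal ((2 * a) ^ (2 ^ j) / 2) := 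
            mul_le_mul' le_rfl (borell hν h0 hu h34 ha h j)
        _ = ENNReal.ofReal ((u * 9 ^ (j+1)) ^ m * ((2 * a) ^ (2 ^ j) / 2)) := by
            rw [ENNReal.ofReal_mul (by positivity)]
        _ ≤ _ := by
            apply ENNReal.ofReal_le_ofReal
            have e1 : (u * 9 ^ (j+1)) ^ m ≤ ((9 * u) ^ m) ^ (j + 1) := by
              rw [← Real.rpow_natCast ((9 * u) ^ m), ← Real.rpow_mul (by positivity), mul_comm m, Real.rpow_mul (by positivity)]
              apply Real.rpow_le_rpow (by positivity) _ hm
              rw [Real.rpow_natCast, mul_pow, mul_comm]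
              gcongr
              exact le_self_pow₀ hu1 (by omega)
            have e2 : (2 * a) ^ (2 ^ j) ≤ (2 * a) ^ (j + 1) := by
              apply pow_le_pow_of_le_one (by positivity) ha2
              exact Nat.succ_le_of_lt Nat.lt_two_pow_self
            calc _ ≤ ((9 * u) ^ m) ^ (j + 1) * ((2 * a) ^ (j + 1) / 2) := by gcongr
              _ = ((9 * u) ^ m * (2 * a)) ^ (j + 1) / 2 := by rw [mul_pow]; ring
              _ ≤ q ^ (j + 1) / 2 := by gcongr
              _ = q / 2 * q ^ j := by rw [pow_succ]; ring
              _ ≤ _ := by gcongr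
    _ = ENNReal.ofReal (∑' j : ℕ, q / 2 * (1/2) ^ j) := by
      rw [ENNReal.ofReal_tsum_of_nonneg (fun j => by positivity)]
      exact (summable_geometric_of_lt_one (by norm_num) (by norm_num)).mul_left _
    _ = _ := by
      rw [tsum_mul_left, tsum_geometric_of_lt_one (by norm_num) (by norm_num)]
      congr 1; ring
end GM

namespace GM
set_option linter.all false

lemma Good.lm2 {n k : ℕ} {ν : Measure (Fin n → ℝ)} {r : ℝ} (g : Good ν k r) :
    ∫⁻ y, ENNReal.ofReal (y ⬝ᵥ y) ∂ν = 1 := by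
  rw [← ofReal_integral_eq_lintegral_ofReal (by simpa using g.int 1) (Filter.Eventually.of_forall dot_self_nonneg), g.m2]
  simp

lemma Good.markov {n k : ℕ} {ν : Measure (Fin n → ℝ)} {r : ℝ} (g : Good ν k r) {u : ℝ} (hu : 0 < u) :
    ν {y | u < y ⬝ᵥ y} ≤ ENNReal.ofReal (1/u) := by
  have h := mul_meas_ge_le_lintegral (μ := ν) (f := fun y : Fin n → ℝ => ENNReal.ofReal (y ⬝ᵥ y)) (by fun_prop) (ENNReal.ofReal u)
  rw [g.lm2] at h
  have h2 : ν {y | u < y ⬝ᵥ y} ≤ ν {y | ENNReal.ofReal u ≤ ENNReal.ofReal (y ⬝ᵥ y)} := 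
    measure_mono fun y hy => ENNReal.ofReal_le_ofReal (le_of_lt hy)
  rw [one_div, ENNReal.ofReal_inv_of_pos hu, ENNReal.le_inv_iff_mul_le, mul_comm]
  exact (mul_le_mul' le_rfl h2).trans h

lemma compl_lt {n : ℕ} (u : ℝ) : {y : Fin n → ℝ | u < y ⬝ᵥ y}ᶜ = {y | y ⬝ᵥ y ≤ u} := by ext; simp

lemma prob_le {n : ℕ} {ν : Measure (Fin n → ℝ)} [IsProbabilityMeasure ν] {u x : ℝ} (hx : 0 ≤ x)
    (h : ν {y | u < y ⬝ᵥ y} ≤ ENNReal.ofReal x) : ENNReal.ofReal (1 - x) ≤ ν {y | y ⬝ᵥ y ≤ u} := by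
  rw [← compl_lt, prob_compl_eq_one_sub (ms_lt u), ENNReal.ofReal_sub _ hx]
  simp only [ENNReal.ofReal_one]
  gcongr

lemma Good.p34 {n k : ℕ} {ν : Measure (Fin n → ℝ)} [IsProbabilityMeasure ν] {r : ℝ} (g : Good ν k r) :
    ENNReal.ofReal (3/4) ≤ ν {y | y ⬝ᵥ y ≤ 4} := by
  have := prob_le (by norm_num) (g.markov (u := 4) (by norm_num))
  norm_num at this ⊢
  exact this

/-- the regime in which the argument is run -/
structure Reg {n : ℕ} (ν : Measure (Fin n → ℝ)) (k : ℕ) (r : ℝ) : Prop extends Good ν k r where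
  kbig : (10:ℝ) ^ 6 ≤ k
  rsm : 8 * AA * exp AA * r ≤ 1 / 10 ^ 5

lemma Reg.r4 {n k : ℕ} {ν : Measure (Fin n → ℝ)} {r : ℝ} (g : Reg ν k r) : 4 * exp AA * r ≤ 1 := by
  have h := g.rsm
  have : 0 < exp AA * r := mul_pos (exp_pos _) g.rpos
  rw [show 8 * AA * exp AA * r = (8 * AA) * (exp AA * r) by ring] at h
  rw [AA] at *
  nlinarith

lemma Reg.main {n k : ℕ} {ν : Measure (Fin n → ℝ)} [IsProbabilityMeasure ν] {r : ℝ} (g : Reg ν k r) {p : ℝ} (hp : |p| < k - 1) :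
    FF ν p * FF ν (-p) ≤ ENNReal.ofReal (16 * exp (2 * p ^ 2 / (k - 1) + 8 * AA * exp AA * k * r)) :=
  main_ineq g.toGood hp g.r4

lemma Reg.rk {n k : ℕ} {ν : Measure (Fin n → ℝ)} {r : ℝ} (g : Reg ν k r) : 
    8 * AA * exp AA * k * r ≤ k / 10 ^ 5 := by
  have h := g.rsm
  have hk := g.kbig
  have : k * (8 * AA * exp AA * r) ≤ k * (1 / 10 ^ 5) := mul_le_mul_of_nonneg_left h (by linarith)
  linarith

lemma set_low {n : ℕ} {ν : Measure (Fin n → ℝ)} {S : Set (Fin n → ℝ)} (hS : MeasurableSet S) {c : ℝ≥0∞} {f : (Fin n → ℝ) → ℝ≥0∞} 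
    {T : Set (Fin n → ℝ)} (hST : S ⊆ T) (h : ∀ y ∈ S, c ≤ f y) : c * ν S ≤ ∫⁻ y in T, f y ∂ν := by
  calc c * ν S = ∫⁻ y in S, c ∂ν := by simp
    _ ≤ ∫⁻ y in S, f y ∂ν := setLIntegral_mono' hS h
    _ ≤ _ := lintegral_mono_set hST

lemma ofReal_cancel {a b : ℝ} {x : ℝ≥0∞} (ha : 0 < a) (h : ENNReal.ofReal a * x ≤ ENNReal.ofReal b) : 
    x ≤ ENNReal.ofReal (b / a) := by
  rw [ENNReal.ofReal_div_of_pos ha, ENNReal.le_div_iff_mul_le (by simp [ha]) (by simp)]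
  rwa [mul_comm]

lemma Reg.a0 {n k : ℕ} {ν : Measure (Fin n → ℝ)} [IsProbabilityMeasure ν] {r : ℝ} (g : Reg ν k r) :
    ν {y | 16 < y ⬝ᵥ y ∧ y ⬝ᵥ y ≤ 100} ≤ ENNReal.ofReal (exp (-k/50)) := by
  have hk := g.kbig
  set p : ℝ := (k - 1) / 8 with hp
  have hp0 : 0 < p := by rw [hp]; linarith
  have h := g.main (p := p) (by rw [abs_of_pos hp0, hp]; linarith)
  have h1 : ENNReal.ofReal (17 ^ (p/2)) * ν {y | 16 < y ⬝ᵥ y ∧ y ⬝ᵥ y ≤ 100} ≤ FF ν p := by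
    refine set_low ((ms_lt _).inter (ms_le _)) (fun y hy => hy.2) fun y hy => ENNReal.ofReal_le_ofReal ?_
    gcongr; linarith [show 16 < y ⬝ᵥ y from hy.1]
  have h2 : ENNReal.ofReal (5 ^ (-p/2)) * ν {y | y ⬝ᵥ y ≤ 4} ≤ FF ν (-p) := by
    refine set_low (ms_le _) (fun y hy => ?_) fun y hy => ENNReal.ofReal_le_ofReal ?_
    · have hy : y ⬝ᵥ y ≤ 4 := hy
      show y ⬝ᵥ y ≤ 100; linarith
    · have hy : y ⬝ᵥ y ≤ 4 := hy
      have := dot_self_nonneg y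
      apply Real.rpow_le_rpow_of_nonpos (by linarith) (by linarith) (by linarith)
  have h3 : ENNReal.ofReal (17 ^ (p/2) * (5 ^ (-p/2) * (3/4))) * ν {y | 16 < y ⬝ᵥ y ∧ y ⬝ᵥ y ≤ 100} ≤ 
      ENNReal.ofReal (16 * exp (2 * p ^ 2 / (k - 1) + 8 * AA * exp AA * k * r)) := by
    refine le_trans ?_ h
    refine le_trans ?_ (mul_le_mul' h1 (le_trans (mul_le_mul' le_rfl g.p34) h2))
    rw [ENNReal.ofReal_mul (by positivity), ENNReal.ofReal_mul (by positivity)]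
    apply le_of_eq; ring
  refine (ofReal_cancel (by positivity) h3).trans (ENNReal.ofReal_le_ofReal ?_)
  rw [div_le_iff₀ (by positivity)]
  have hrk := g.rk
  have e1 : (17:ℝ) ^ (p/2) * 5 ^ (-p/2) = (17/5) ^ (p/2) := by
    rw [Real.div_rpow (by norm_num) (by norm_num), neg_div, Real.rpow_neg (by norm_num)]; rfl
  have e2 : exp (p/2) ≤ (17/5) ^ (p/2) := by
    have : exp (p/2) = (exp 1) ^ (p/2) := by rw [← Real.exp_mul]; simp
    rw [this]
    have := Real.exp_one_lt_d9
    gcongr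
    linarith
  have e3 : (16:ℝ) ≤ exp 4 * (3/4) := by
    have := Real.exp_one_gt_d9
    have h5 : (2.7:ℝ)^4 ≤ exp 1 ^ 4 := by gcongr; linarith
    rw [← Real.exp_nat_mul] at h5
    norm_num at h5
    linarith
  calc _ ≤ (exp 4 * (3/4)) * exp (2 * p ^ 2 / (k - 1) + 8 * AA * exp AA * k * r) := by gcongr
    _ = (3/4) * exp (4 + (2 * p ^ 2 / (k - 1) + 8 * AA * exp AA * k * r)) := by rw [Real.exp_add 4]; ring
    _ ≤ (3/4) * exp (-k/50 + p/2) := by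
      refine mul_le_mul_of_nonneg_left (Real.exp_le_exp.mpr ?_) (by norm_num)
      have : 2 * p ^ 2 / (k - 1) = (k-1)/32 := by
        rw [hp]; have : (k:ℝ) - 1 ≠ 0 := by linarith
        field_simp; ring
      rw [this, hp]; linarith
    _ = exp (-k/50) * (exp (p/2) * (3/4)) := by rw [Real.exp_add]; ring
    _ ≤ exp (-k/50) * ((17/5) ^ (p/2) * (3/4)) := by gcongr
    _ = _ := by rw [← e1]; ring

lemma exp_ge {x : ℝ} (hx : 0 ≤ x) : 1 + x + x^2/2 ≤ exp x := Real.quadratic_le_exp_of_nonneg hx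

lemma Reg.x100 {n k : ℕ} {ν : Measure (Fin n → ℝ)} [IsProbabilityMeasure ν] {r : ℝ} (g : Reg ν k r) :
    ν {y | 100 < y ⬝ᵥ y} ≤ ENNReal.ofReal (exp (-k/50)) := by
  have hk := g.kbig
  have hA := g.a0
  set a := exp (-k/50:ℝ) with ha
  have ha0 : 0 < a := exp_pos _
  have hasm : a ≤ 1/10 := by
    have := exp_ge (x := k/50) (by positivity)
    rw [ha, neg_div, Real.exp_neg, inv_le_comm₀ (exp_pos _) (by norm_num)]
    nlinarith [sq_nonneg (k/50:ℝ)]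
  have h1 : ν {y | y ⬝ᵥ y ≤ 4} * ν {y | 100 < y ⬝ᵥ y} ≤ ν {y | 16 < y ⬝ᵥ y} ^ 2 := by
    refine lc_sets g.lc (ms_le _) (ms_lt _) (ms_lt _) ?_
    intro x hx y hy
    have hx : x ⬝ᵥ x ≤ 4 := hx
    have hy : 100 < y ⬝ᵥ y := hy
    have := mid_large (a := 2) (b := 10) (by norm_num) (by norm_num) (x := x) (y := y) (by linarith) (by linarith)
    norm_num at this ⊢
    linarith
  have h2 : ν {y | 16 < y ⬝ᵥ y} ≤ ENNReal.ofReal a + ν {y | 100 < y ⬝ᵥ y} := by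
    refine le_trans (measure_mono ?_) ((measure_union_le {y | 16 < y ⬝ᵥ y ∧ y ⬝ᵥ y ≤ 100} _).trans (add_le_add hA le_rfl))
    intro y hy
    by_cases h : 100 < y ⬝ᵥ y
    · right; exact h
    · left; exact ⟨hy, not_lt.mp h⟩
  have h3 := g.markov (u := 100) (by norm_num)
  have hx : ν {y | 100 < y ⬝ᵥ y} = ENNReal.ofReal (ν {y | 100 < y ⬝ᵥ y}).toReal := by
    rw [ENNReal.ofReal_toReal (measure_ne_top _ _)]
  set x := (ν {y | 100 < y ⬝ᵥ y}).toReal with hxx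
  have hx0 : 0 ≤ x := ENNReal.toReal_nonneg
  rw [hx] at h1 h2 h3 ⊢
  rw [ENNReal.ofReal_le_ofReal_iff (by norm_num)] at h3
  have h4 : ENNReal.ofReal (3/4 * x) ≤ ENNReal.ofReal ((a + x)^2) := by
    rw [ENNReal.ofReal_mul (by norm_num), ENNReal.ofReal_pow (by positivity), ENNReal.ofReal_add ha0.le hx0]
    refine (mul_le_mul' g.p34 le_rfl).trans (h1.trans ?_)
    gcongr
  rw [ENNReal.ofReal_le_ofReal_iff (by positivity)] at h4
  apply ENNReal.ofReal_le_ofReal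
  nlinarith [sq_nonneg (a - x)]

lemma exp_neg_le {x c : ℝ} (hc : 0 < c) (hx : c ≤ x) : exp (-x) ≤ 1 / c := by
  rw [Real.exp_neg, one_div]
  exact inv_anti₀ hc (by linarith [Real.add_one_le_exp x])

lemma Reg.tail {n k : ℕ} {ν : Measure (Fin n → ℝ)} [IsProbabilityMeasure ν] {r : ℝ} (g : Reg ν k r) {m : ℝ} 
    (hm : 0 ≤ m) (hmk : m ≤ k / 1000) :
    ∫⁻ y in {y | 100 < y ⬝ᵥ y}, ENNReal.ofReal ((y ⬝ᵥ y) ^ m) ∂ν ≤ ENNReal.ofReal (exp (-k/200)) := by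
  have hk := g.kbig
  refine borell_int g.lc (u0 := 4) (by norm_num) (by norm_num) (by norm_num) g.p34 (exp_pos _).le ?_ g.x100 hm ?_ ?_
  · have := exp_neg_le (x := k/50) (c := 2) (by norm_num) (by linarith)
    rw [neg_div]; linarith
  · have e1 : (9 * 100 : ℝ) ^ m ≤ exp (7 * m) := by
      rw [Real.exp_mul]
      apply Real.rpow_le_rpow (by norm_num) _ hm
      have := Real.exp_one_gt_d9
      have h5 : (2.7:ℝ)^7 ≤ exp 1 ^ 7 := by gcongr; linarith
      rw [← Real.exp_nat_mul] at h5
      norm_num at h5 ⊢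
      linarith
    have e2 : (2:ℝ) ≤ exp 1 := by have := Real.exp_one_gt_d9; linarith
    calc _ ≤ exp (7 * m) * (exp 1 * exp (-k/50)) := by gcongr
      _ = exp (7 * m + (1 + -k/50)) := by rw [Real.exp_add, Real.exp_add]
      _ ≤ _ := by
        rw [Real.exp_le_exp]; linarith
  · have := exp_neg_le (x := k/200) (c := 2) (by norm_num) (by linarith)
    rw [neg_div]; linarith
end GM

namespace GM
set_option linter.all false

def GV {n : ℕ} (ν : Measure (Fin n → ℝ)) (p : ℝ) : ℝ≥0∞ := 
  ∫⁻ y in {y | y ⬝ᵥ y ≤ 100}, ENNReal.ofReal (((1 + y ⬝ᵥ y) / 2) ^ (p / 2)) ∂ν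

lemma FF_eq {n : ℕ} (ν : Measure (Fin n → ℝ)) (p : ℝ) : FF ν p = ENNReal.ofReal (2 ^ (p/2)) * GV ν p := by
  rw [FF, GV, ← lintegral_const_mul _ (by fun_prop)]
  refine lintegral_congr fun y => ?_
  have := dot_self_nonneg y
  rw [← ENNReal.ofReal_mul (by positivity), ← Real.mul_rpow (by norm_num) (by linarith)]
  congr 2; ring

lemma bern {V s : ℝ} (hV : 0 < V) (hs : s ≤ 0 ∨ 1 ≤ s) : 1 + s * (V - 1) ≤ V ^ s := by
  rcases hs with hs | hs
  · have h := Real.add_one_le_exp (log V * s)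
    rw [Real.rpow_def_of_pos hV]
    have h2 := Real.log_le_sub_one_of_pos hV
    nlinarith
  · have := one_add_mul_self_le_rpow_one_add (s := V - 1) (by linarith) hs
    simpa using this

lemma Reg.GV_low {n k : ℕ} {ν : Measure (Fin n → ℝ)} [IsProbabilityMeasure ν] {r : ℝ} (g : Reg ν k r) {p : ℝ} 
    (hp : p ≤ 0 ∨ 2 ≤ p) (hpk : |p| ≤ k / 1000) : ENNReal.ofReal (1/2) ≤ GV ν p := by
  have hk := g.kbig
  have hint1 : Integrable (fun y : Fin n → ℝ => y ⬝ᵥ y) ν := by simpa using g.int 1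
  set s := p / 2 with hs
  have hs2 : s ≤ 0 ∨ 1 ≤ s := by rcases hp with hp | hp; left; linarith; right; linarith
  have hsk : |s| ≤ k / 2000 := by rw [hs, abs_div, abs_of_pos (by norm_num : (0:ℝ) < 2)]; linarith
  set G : (Fin n → ℝ) → ℝ := fun y => 1 + s * ((1 + y ⬝ᵥ y) / 2 - 1) with hG
  have hGi : Integrable G ν := by
    refine (integrable_const _).add (Integrable.const_mul ?_ _)
    exact (((integrable_const _).add hint1).div_const _).sub (integrable_const _)
  have hG1 : ∫ y, G y ∂ν = 1 := by
    have e : G = fun y => (1 - s/2) + (s/2) * (y ⬝ᵥ y) := by ext y; rw [hG]; ring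
    rw [e, integral_add (integrable_const _) (hint1.const_mul _), integral_const_mul, g.m2]
    simp
  have hsplit := integral_add_compl (ms_le (n := n) 100) hGi
  have hcompl : {y : Fin n → ℝ | y ⬝ᵥ y ≤ 100}ᶜ = {y | 100 < y ⬝ᵥ y} := by ext; simp
  rw [hcompl, hG1] at hsplit
  have htail : ∫ y in {y | 100 < y ⬝ᵥ y}, y ⬝ᵥ y ∂ν ≤ exp (-k/200) := by
    have := g.tail (m := 1) (by norm_num) (by linarith)
    simp only [Real.rpow_one] at this
    rw [← ofReal_integral_eq_lintegral_ofReal hint1.integrableOn (Filter.Eventually.of_forall dot_self_nonneg)] at this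
    exact (ENNReal.ofReal_le_ofReal_iff (exp_pos _).le).mp this
  have hGt : ∫ y in {y | 100 < y ⬝ᵥ y}, G y ∂ν ≤ ∫ y in {y | 100 < y ⬝ᵥ y}, (1 + |s|) * (y ⬝ᵥ y) ∂ν := by
    refine setIntegral_mono_on hGi.integrableOn (hint1.const_mul _).integrableOn (ms_lt _) fun y hy => ?_
    have hy : 100 < y ⬝ᵥ y := hy
    simp only [hG]
    have h1 := le_abs_self s
    have h2 := abs_nonneg s
    nlinarith
  rw [integral_const_mul] at hGt
  have hlow : 1/2 ≤ ∫ y in {y | y ⬝ᵥ y ≤ 100}, G y ∂ν := by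
    have h1 : (1 + |s|) * ∫ y in {y | 100 < y ⬝ᵥ y}, y ⬝ᵥ y ∂ν ≤ (1 + k/2000) * (1 / (k/200)) := by
      have := exp_neg_le (x := k/200) (c := k/200) (by linarith) le_rfl
      rw [← neg_div] at this
      refine mul_le_mul (by linarith) (htail.trans this) ?_ (by positivity)
      exact integral_nonneg dot_self_nonneg
    have h2 : (1 + (k:ℝ)/2000) * (1 / (k/200)) ≤ 1/2 := by
      rw [mul_one_div, div_le_iff₀ (by linarith)]; linarith
    linarith
  refine (ENNReal.ofReal_le_ofReal hlow).trans ((ofReal_integral_le hGi.integrableOn).trans ?_)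
  refine lintegral_mono fun y => ENNReal.ofReal_le_ofReal ?_
  have := dot_self_nonneg y
  exact bern (by linarith) hs2

lemma Reg.GV_up {n k : ℕ} {ν : Measure (Fin n → ℝ)} [IsProbabilityMeasure ν] {r : ℝ} (g : Reg ν k r) {p : ℝ} 
    (hp : 2 ≤ |p|) (hpk : |p| ≤ k / 1000) : 
    GV ν p ≤ ENNReal.ofReal (32 * exp (2 * p ^ 2 / (k - 1) + 8 * AA * exp AA * k * r)) := by
  have hk := g.kbig
  have h := g.main (p := p) (by linarith)
  have h2 : ENNReal.ofReal (1/2) ≤ GV ν (-p) := by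
    refine g.GV_low ?_ (by rwa [abs_neg])
    rcases le_abs'.mp hp with h | h
    · right; linarith
    · left; linarith
  rw [FF_eq, FF_eq] at h
  have h3 : ENNReal.ofReal (1/2) * GV ν p ≤ ENNReal.ofReal (16 * exp (2 * p ^ 2 / (k - 1) + 8 * AA * exp AA * k * r)) := by
    refine le_trans ?_ h
    calc _ = ENNReal.ofReal (2 ^ (p/2) * 2 ^ (-p/2)) * (GV ν p * ENNReal.ofReal (1/2)) := by
          rw [← Real.rpow_add (by norm_num), show p/2 + -p/2 = 0 by ring]; simp [mul_comm]
      _ = ENNReal.ofReal (2 ^ (p/2)) * GV ν p * (ENNReal.ofReal (2 ^ (-p/2)) * ENNReal.ofReal (1/2)) := by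
          rw [ENNReal.ofReal_mul (by positivity)]; ring
      _ ≤ _ := mul_le_mul' le_rfl (mul_le_mul' le_rfl h2)
  refine (ofReal_cancel (by norm_num) h3).trans (le_of_eq ?_)
  congr 1; ring

/-- positive moments -/
lemma Reg.pos_mom {n k : ℕ} {ν : Measure (Fin n → ℝ)} [IsProbabilityMeasure ν] {r : ℝ} (g : Reg ν k r) {p : ℝ} 
    (hp : 1 ≤ p) (hpk : 2 * p ≤ k / 1000) : 
    ∫⁻ y, ENNReal.ofReal ((y ⬝ᵥ y) ^ (p/2)) ∂ν ≤ 
      ENNReal.ofReal (33 * exp (8 * p ^ 2 / (k - 1) + 8 * AA * exp AA * k * r)) := by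
  have hk := g.kbig
  have h := g.GV_up (p := 2 * p) (by rw [abs_of_pos (by linarith)]; linarith) (by rw [abs_of_pos (by linarith)]; linarith)
  rw [← lintegral_add_compl _ (ms_le (n := n) 100)]
  have hcompl : {y : Fin n → ℝ | y ⬝ᵥ y ≤ 100}ᶜ = {y | 100 < y ⬝ᵥ y} := by ext; simp
  rw [hcompl]
  have ht := g.tail (m := p/2) (by linarith) (by linarith)
  have h1 : ∫⁻ y in {y | y ⬝ᵥ y ≤ 100}, ENNReal.ofReal ((y ⬝ᵥ y) ^ (p/2)) ∂ν ≤ GV ν (2 * p) := by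
    refine lintegral_mono fun y => ENNReal.ofReal_le_ofReal ?_
    have h0 := dot_self_nonneg y
    rw [Real.rpow_div_two_eq_sqrt _ h0, show 2 * p / 2 = p by ring]
    gcongr
    have := Real.sq_sqrt h0
    nlinarith [sq_nonneg (√(y ⬝ᵥ y) - 1)]
  refine (add_le_add (h1.trans h) ht).trans ?_
  rw [← ENNReal.ofReal_add (by positivity) (by positivity)]
  apply ENNReal.ofReal_le_ofReal
  rw [show 2 * (2 * p) ^ 2 = 8 * p ^ 2 by ring]
  have e1 : exp (-k/200) ≤ 1 := by rw [Real.exp_le_one_iff]; linarith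
  have e2 : 1 ≤ exp (8 * p ^ 2 / (k - 1) + 8 * AA * exp AA * k * r) := by
    rw [Real.one_le_exp_iff]
    have := g.rpos
    have : 0 < k - (1:ℝ) := by linarith
    have : 0 < AA := by rw [AA]; norm_num
    positivity
  linarith

/-- negative moments away from zero -/
lemma Reg.neg_mom1 {n k : ℕ} {ν : Measure (Fin n → ℝ)} [IsProbabilityMeasure ν] {r : ℝ} (g : Reg ν k r) {p : ℝ} 
    (hp : 1 ≤ p) (hpk : 3 * p ≤ k / 1000) : 
    ∫⁻ y in {y | 1/4 < y ⬝ᵥ y}, ENNReal.ofReal ((y ⬝ᵥ y) ^ (-p/2)) ∂ν ≤ 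
      ENNReal.ofReal (33 * exp (18 * p ^ 2 / (k - 1) + 8 * AA * exp AA * k * r)) := by
  have hk := g.kbig
  have h := g.GV_up (p := -(3 * p)) (by rw [abs_neg, abs_of_pos (by linarith)]; linarith) 
    (by rw [abs_neg, abs_of_pos (by linarith)]; linarith)
  have hpt : ∀ y ∈ {y : Fin n → ℝ | 1/4 < y ⬝ᵥ y}, ENNReal.ofReal ((y ⬝ᵥ y) ^ (-p/2)) ≤
      1 + {y | y ⬝ᵥ y ≤ 100}.indicator (fun y => ENNReal.ofReal (((1 + y ⬝ᵥ y) / 2) ^ (-(3 * p) / 2))) y := by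
    intro y hy
    have hy : 1/4 < y ⬝ᵥ y := hy
    by_cases h1 : 1 ≤ y ⬝ᵥ y
    · refine le_trans ?_ le_self_add
      rw [← ENNReal.ofReal_one]
      exact ENNReal.ofReal_le_ofReal (Real.rpow_le_one_of_one_le_of_nonpos h1 (by linarith))
    · refine le_trans ?_ le_add_self
      rw [Set.indicator_of_mem (by simp only [Set.mem_ofPred_eq]; linarith)]
      apply ENNReal.ofReal_le_ofReal
      rw [show -(3 * p)/2 = (3:ℕ) * (-p/2) by push_cast; ring, Real.rpow_mul (by linarith), Real.rpow_natCast]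
      apply Real.rpow_le_rpow_of_nonpos (by positivity) _ (by linarith)
      set u := y ⬝ᵥ y
      have : (1 - u) * (u^2 + 4 * u - 1) ≥ 0 := mul_nonneg (by linarith) (by nlinarith)
      nlinarith
  calc _ ≤ ∫⁻ y in {y | 1/4 < y ⬝ᵥ y}, (1 + {y | y ⬝ᵥ y ≤ 100}.indicator (fun y => ENNReal.ofReal (((1 + y ⬝ᵥ y) / 2) ^ (-(3 * p) / 2))) y) ∂ν := 
        setLIntegral_mono' (ms_lt _) hpt
    _ ≤ ∫⁻ y, (1 + {y | y ⬝ᵥ y ≤ 100}.indicator (fun y => ENNReal.ofReal (((1 + y ⬝ᵥ y) / 2) ^ (-(3 * p) / 2))) y) ∂ν := 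
        setLIntegral_le_lintegral _ _
    _ = 1 + GV ν (-(3 * p)) := by
        rw [lintegral_add_left measurable_const, lintegral_indicator (ms_le _)]
        simp [GV]
    _ ≤ 1 + ENNReal.ofReal (32 * exp (2 * (-(3*p)) ^ 2 / (k - 1) + 8 * AA * exp AA * k * r)) := by gcongr
    _ = ENNReal.ofReal (1 + 32 * exp (2 * (-(3*p)) ^ 2 / (k - 1) + 8 * AA * exp AA * k * r)) := by
        rw [ENNReal.ofReal_add (by norm_num) (by positivity), ENNReal.ofReal_one]
    _ ≤ _ := by
        apply ENNReal.ofReal_le_ofReal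
        rw [show 2 * (-(3 * p)) ^ 2 = 18 * p ^ 2 by ring]
        have e2 : 1 ≤ exp (18 * p ^ 2 / (k - 1) + 8 * AA * exp AA * k * r) := by
          rw [Real.one_le_exp_iff]
          have := g.rpos
          have : 0 < k - (1:ℝ) := by linarith
          have : 0 < AA := by rw [AA]; norm_num
          positivity
        linarith

lemma Reg.small1 {n k : ℕ} {ν : Measure (Fin n → ℝ)} [IsProbabilityMeasure ν] {r : ℝ} (g : Reg ν k r) : 
    ν {y | y ⬝ᵥ y ≤ 1/4} ≤ ENNReal.ofReal (32 * exp (-k/10000)) := by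
  have hk := g.kbig
  set p : ℝ := -(k/1000) with hp
  have hpa : |p| = k/1000 := by rw [hp, abs_neg, abs_of_pos (by linarith)]
  have h := g.GV_up (p := p) (by rw [hpa]; linarith) hpa.le
  have h1 : ENNReal.ofReal ((5/8) ^ (p/2)) * ν {y | y ⬝ᵥ y ≤ 1/4} ≤ GV ν p := by
    refine set_low (ms_le _) (fun y hy => ?_) fun y hy => ENNReal.ofReal_le_ofReal ?_
    · have hy : y ⬝ᵥ y ≤ 1/4 := hy
      show y ⬝ᵥ y ≤ 100; linarith
    · have hy : y ⬝ᵥ y ≤ 1/4 := hy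
      have := dot_self_nonneg y
      apply Real.rpow_le_rpow_of_nonpos (by linarith) (by linarith) (by linarith)
  refine (ofReal_cancel (by positivity) (h1.trans h)).trans (ENNReal.ofReal_le_ofReal ?_)
  rw [div_le_iff₀ (by positivity), mul_assoc 32 (exp _)]
  apply mul_le_mul_of_nonneg_left _ (by norm_num)
  have e1 : exp (-(2/5) * (p/2)) ≤ (5/8) ^ (p/2) := by
    rw [Real.exp_mul]
    apply Real.rpow_le_rpow_of_nonpos (by norm_num) _ (by linarith)
    rw [Real.exp_neg]
    rw [show (5/8:ℝ) = (8/5)⁻¹ by norm_num]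
    apply inv_anti₀ (exp_pos _)
    apply le_of_pow_le_pow_left₀ (n := 5) (by norm_num) (by norm_num)
    have := Real.exp_one_lt_d9
    have h5 : exp 1 ^ 2 ≤ (2.72:ℝ)^2 := by gcongr; linarith
    rw [← Real.exp_nat_mul] at h5 ⊢
    norm_num at h5 ⊢
    linarith
  have hrk := g.rk
  calc _ ≤ exp (-k/10000 + -(2/5) * (p/2)) := by
        rw [Real.exp_le_exp]
        have : 2 * p ^ 2 / (k - 1) ≤ k / 10^5 := by
          rw [hp, div_le_iff₀ (by linarith)]
          nlinarith
        rw [hp]; linarith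
    _ = exp (-k/10000) * exp (-(2/5) * (p/2)) := by rw [Real.exp_add]
    _ ≤ _ := by gcongr
end GM

namespace GM
set_option linter.all false

lemma gaussVol {k : ℕ} {l : ℝ} (hl : 0 < l) (a : Fin k → ℝ) :
    ∫⁻ y : Fin k → ℝ, ENNReal.ofReal (exp (-(l * ∑ i, (y i - a i) ^ 2) / 2)) = ENNReal.ofReal (√(2 * π / l) ^ k) := by
  have e1 : ∀ y : Fin k → ℝ, ENNReal.ofReal (exp (-(l * ∑ i, (y i - a i) ^ 2) / 2)) = 
      ∏ i, ENNReal.ofReal (exp (-(l * (y i - a i) ^ 2) / 2)) := by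
    intro y
    rw [← ENNReal.ofReal_prod_of_nonneg (fun i _ => (exp_pos _).le), ← Real.exp_sum]
    congr 2
    rw [Finset.mul_sum, ← Finset.sum_neg_distrib, Finset.sum_div]
  simp only [e1]
  rw [volume_pi, lintegral_pi_prod (fun i x => ENNReal.ofReal (exp (-(l * (x - a i) ^ 2) / 2))) (by fun_prop)]
  have e2 : ∀ i, ∫⁻ x, ENNReal.ofReal (exp (-(l * (x - a i) ^ 2) / 2)) = ENNReal.ofReal (√(2 * π / l)) := by
    intro i
    rw [lintegral_sub_right_eq_self (fun x => ENNReal.ofReal (exp (-(l * x ^ 2) / 2)))]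
    have e3 : ∀ x : ℝ, exp (-(l * x ^ 2) / 2) = exp (-(l/2) * x ^ 2) := fun x => by congr 1; ring
    simp only [e3]
    rw [← ofReal_integral_eq_lintegral_ofReal (integrable_exp_neg_mul_sq (by positivity)) 
      (Filter.Eventually.of_forall fun x => (exp_pos _).le), integral_gaussian]
    congr 2; field_simp
  simp only [e2, Finset.prod_const, Finset.card_univ, Fintype.card_fin]
  rw [ENNReal.ofReal_pow (Real.sqrt_nonneg _)]

lemma volQ {k : ℕ} (a : Fin k → ℝ) : 
    volume {y : Fin k → ℝ | ∑ i, (y i - a i) ^ 2 ≤ 2 * k} ≤ ENNReal.ofReal (exp (2 * k)) := by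
  have h0 : MeasurableSet {y : Fin k → ℝ | ∑ i, (y i - a i) ^ 2 ≤ 2 * k} := measurableSet_le (by fun_prop) measurable_const
  calc _ = ENNReal.ofReal 1 * volume {y : Fin k → ℝ | ∑ i, (y i - a i) ^ 2 ≤ 2 * k} := by simp
    _ = ∫⁻ y in {y : Fin k → ℝ | ∑ i, (y i - a i) ^ 2 ≤ 2 * k}, ENNReal.ofReal 1 := by simp
    _ ≤ ∫⁻ y in {y : Fin k → ℝ | ∑ i, (y i - a i) ^ 2 ≤ 2 * k}, ENNReal.ofReal (exp k) * 
        ENNReal.ofReal (exp (-(1 * ∑ i, (y i - a i) ^ 2) / 2)) := by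
        refine setLIntegral_mono' h0 fun y hy => ?_
        rw [← ENNReal.ofReal_mul (exp_pos _).le, ← Real.exp_add]
        apply ENNReal.ofReal_le_ofReal
        rw [Real.one_le_exp_iff]
        have hy : ∑ i, (y i - a i) ^ 2 ≤ 2 * k := hy
        linarith
    _ ≤ ∫⁻ y : Fin k → ℝ, ENNReal.ofReal (exp k) * 
        ENNReal.ofReal (exp (-(1 * ∑ i, (y i - a i) ^ 2) / 2)) := setLIntegral_le_lintegral _ _
    _ = ENNReal.ofReal (exp k * √(2 * π) ^ k) := by
        rw [lintegral_const_mul _ (by fun_prop), gaussVol one_pos, ENNReal.ofReal_mul (exp_pos _).le, div_one]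
    _ ≤ _ := by
        apply ENNReal.ofReal_le_ofReal
        rw [show (2:ℝ) * k = k + k by ring, Real.exp_add]
        gcongr
        rw [show exp (k:ℝ) = exp 1 ^ k by rw [← Real.exp_nat_mul]; simp]
        gcongr
        rw [Real.sqrt_le_left (exp_pos _).le]
        have := Real.exp_one_gt_d9
        have := Real.pi_lt_d2
        nlinarith

def AB : ℝ := 9200
structure Reg2 {n : ℕ} (ν : Measure (Fin n → ℝ)) (k : ℕ) (r : ℝ) : Prop extends Reg ν k r where
  rsm2 : 4 * AB * exp AB * (2 * 200 * r) ≤ 1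

lemma Reg.mid {n k : ℕ} {ν : Measure (Fin n → ℝ)} [IsProbabilityMeasure ν] {r : ℝ} (g : Reg ν k r) : 
    ENNReal.ofReal (1/2) ≤ ν ({y | y ⬝ᵥ y ≤ 100} ∩ {y | 1/4 < y ⬝ᵥ y}) := by
  have hk := g.kbig
  have h1 := g.x100
  have h2 := g.small1
  have h3 : ν ({y | y ⬝ᵥ y ≤ 100} ∩ {y | 1/4 < y ⬝ᵥ y})ᶜ ≤ ENNReal.ofReal (1/2) := by
    have : ({y : Fin n → ℝ | y ⬝ᵥ y ≤ 100} ∩ {y | 1/4 < y ⬝ᵥ y})ᶜ = {y | 100 < y ⬝ᵥ y} ∪ {y | y ⬝ᵥ y ≤ 1/4} := by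
      ext y; simp only [Set.mem_compl_iff, Set.mem_inter_iff, Set.mem_ofPred_eq, Set.mem_union, not_and_or, not_le, not_lt]
    rw [this]
    refine (measure_union_le _ _).trans ((add_le_add h1 h2).trans ?_)
    rw [← ENNReal.ofReal_add (by positivity) (by positivity)]
    apply ENNReal.ofReal_le_ofReal
    have e1 := exp_neg_le (x := k/50) (c := 20000) (by norm_num) (by linarith)
    have e2 : exp (-k/10000:ℝ) ≤ 1/100 := by
      have := exp_neg_le (x := k/10000) (c := 100) (by norm_num) (by linarith)
      rwa [← neg_div] at this
    have e3 : exp (-k/10000:ℝ) ≤ 1/100/50 := by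
      have h := exp_ge (x := k/10000) (by positivity)
      rw [neg_div, Real.exp_neg, inv_le_comm₀ (exp_pos _) (by norm_num)]
      nlinarith
    rw [← neg_div] at e1
    linarith
  have h4 := prob_compl_eq_one_sub (μ := ν) ((ms_le (n := n) 100).inter (ms_lt (1/4)))
  rw [h4] at h3
  have h5 : (1:ℝ≥0∞) ≤ ENNReal.ofReal (1/2) + ν ({y | y ⬝ᵥ y ≤ 100} ∩ {y | 1/4 < y ⬝ᵥ y}) := tsub_le_iff_right.mp h3
  have h6 : (1:ℝ≥0∞) = ENNReal.ofReal (1/2) + ENNReal.ofReal (1/2) := by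
    rw [← ENNReal.ofReal_add (by norm_num) (by norm_num)]; norm_num
  rw [h6] at h5
  exact (ENNReal.add_le_add_iff_left (by simp)).mp h5

lemma hE_T_low {n k : ℕ} {ν : Measure (Fin n → ℝ)} [IsProbabilityMeasure ν] {r : ℝ} (g : Reg2 ν k r) 
    {s : Fin k → ℝ} (hs : ∑ i, s i ^ 2 ≤ 2 * k) :
    ENNReal.ofReal (1/4 * exp (-9 * k)) ≤ ∫⁻ Γ in TT ν k 44, hE ν 200 Γ s ∂(gmat k n) := by
  have hk := g.kbig
  have hsw : ∫⁻ Γ in TT ν k 44, hE ν 200 Γ s ∂(gmat k n) = 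
      ∫⁻ y, (∫⁻ Γ in TT ν k 44, ENNReal.ofReal (exp (-(200 * Qf Γ s y) / 2)) ∂(gmat k n)) ∂ν := by
    simp only [hE]
    exact lintegral_lintegral_swap (by simp only [Function.uncurry_def]; fun_prop)
  rw [hsw]
  have hT := TTc g.toGood (C := 44) (by norm_num)
  have e148 : (20001:ℝ) ≤ exp 10 := by
    have := Real.exp_one_gt_d9
    have h5 : (2.7:ℝ)^10 ≤ exp 1 ^ 10 := by gcongr; linarith
    rw [← Real.exp_nat_mul] at h5
    norm_num at h5 ⊢
    linarith
  have e1 : exp (-(5 * k)) ≤ (20001:ℝ) ^ (-(k/2:ℝ)) := by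
    calc exp (-(5 * k)) = (exp 10) ^ (-(k/2:ℝ)) := by rw [← Real.exp_mul]; congr 1; ring
      _ ≤ _ := Real.rpow_le_rpow_of_nonpos (by norm_num) e148 (by linarith)
  have key : ∀ y ∈ ({y : Fin n → ℝ | y ⬝ᵥ y ≤ 100} ∩ {y | 1/4 < y ⬝ᵥ y}), ENNReal.ofReal (1/2 * exp (-9 * k)) ≤ 
      ∫⁻ Γ in TT ν k 44, ENNReal.ofReal (exp (-(200 * Qf Γ s y) / 2)) ∂(gmat k n) := by
    rintro y ⟨hy1, hy2⟩
    have hy1 : y ⬝ᵥ y ≤ 100 := hy1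
    have hy2 : 1/4 < y ⬝ᵥ y := hy2
    have hG : exp (-9 * k) ≤ (1 + 200 * (y ⬝ᵥ y)) ^ (-(k/2:ℝ)) * exp (-(200 * (∑ i, s i ^ 2) / (2 * (1 + 200 * (y ⬝ᵥ y))))) := by
      rw [show (-9:ℝ) * k = -(5*k) + -(4 * k) by ring, Real.exp_add]
      apply mul_le_mul _ _ (exp_pos _).le (by positivity)
      · refine e1.trans (Real.rpow_le_rpow_of_nonpos (by linarith) (by linarith) (by linarith))
      · rw [Real.exp_le_exp, neg_le_neg_iff, div_le_iff₀ (by linarith)]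
        nlinarith
    have := gET (C := 44) (l := 200) (by norm_num) s y (by positivity) hT (le_trans ?_ hG)
    · refine le_trans (ENNReal.ofReal_le_ofReal ?_) this
      linarith
    · have e2 : (2:ℝ) ^ (k/2:ℝ) ≤ exp k := by
        rw [Real.exp_eq_exp_ℝ, ← Real.exp_eq_exp_ℝ, show exp (k:ℝ) = (exp 2) ^ (k/2:ℝ) by rw [← Real.exp_mul]; congr 1; ring]
        gcongr
        have := Real.add_one_le_exp (2:ℝ); linarith
      have e3 : (2:ℝ) ≤ exp k := by have := Real.add_one_le_exp (k:ℝ); linarith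
      calc 2 * (exp (-(44 * k/4)) * 2 ^ (k/2:ℝ)) ≤ exp k * (exp (-(44 * k/4)) * exp k) := by gcongr
        _ = exp (-9 * k) := by rw [← Real.exp_add, ← Real.exp_add]; congr 1; ring
  refine le_trans ?_ (setLIntegral_le_lintegral ({y : Fin n → ℝ | y ⬝ᵥ y ≤ 100} ∩ {y | 1/4 < y ⬝ᵥ y}) _)
  refine le_trans ?_ (set_low ((ms_le _).inter (ms_lt _)) le_rfl key)
  refine le_trans ?_ (mul_le_mul' le_rfl g.mid)
  rw [← ENNReal.ofReal_mul (by positivity)]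
  apply le_of_eq; congr 1; ring

lemma bad_prob {n k : ℕ} {ν : Measure (Fin n → ℝ)} [IsProbabilityMeasure ν] {r : ℝ} (g : Reg2 ν k r) 
    {s : Fin k → ℝ} (hs : ∑ i, s i ^ 2 ≤ 2 * k) :
    gmat k n {Γ | hE ν 200 Γ s ≤ ENNReal.ofReal (exp (-14 * k))} ≤ ENNReal.ofReal (4 * exp (-4 * k)) := by
  have hk := g.kbig
  set x := exp (-14 * (k:ℝ)) with hx
  have hr2 := g.rsm2
  have hAB : AB = 200 * (2 + 44) := by rw [AB]; norm_num
  have hT := meas_TT (ν := ν) k 44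
  have hB : MeasurableSet {Γ : Fin k → Fin n → ℝ | hE ν 200 Γ s ≤ ENNReal.ofReal x} := 
    measurableSet_le (by fun_prop) measurable_const
  have hr1 : 4 * exp AB * (2 * 200 * r) ≤ 1 := by
    have : 0 < exp AB * r := mul_pos (exp_pos _) g.rpos
    rw [AB] at *
    nlinarith
  have main := plm_scale (plm_gmat k n) (K := ENNReal.ofReal (exp k)) (by simp [exp_pos]) (by simp)
    (u := (TT ν k 44).indicator (fun Γ => hE ν 200 Γ s)) 
    (v := {Γ | hE ν 200 Γ s ≤ ENNReal.ofReal x}.indicator (fun Γ => ENNReal.ofReal x⁻¹))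
    (w := fun _ => 1) ((by fun_prop : Measurable (fun Γ : Fin k → Fin n → ℝ => hE ν 200 Γ s)).indicator hT)
    (measurable_const.indicator hB) measurable_const (by
      intro Γ Γ'
      by_cases h1 : Γ ∈ TT ν k 44
      swap
      · rw [Set.indicator_of_notMem h1]; simp
      by_cases h2 : Γ' ∈ {Γ | hE ν 200 Γ s ≤ ENNReal.ofReal x}
      swap
      · rw [Set.indicator_of_notMem h2]; simp
      rw [Set.indicator_of_mem h1, Set.indicator_of_mem h2]
      have hl := lip g.toGood (l := 200) (t := 2) (C := 44) (κ := 2) (A := AB) (by norm_num) (by norm_num) (by norm_num) 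
        (by norm_num) hAB hr1 h1 hs Γ'
      have h2 : hE ν 200 Γ' s ≤ ENNReal.ofReal x := h2
      have en : ∑ i, ∑ j, (Γ i j - Γ' i j) ^ 2 = nrm (Γ' - Γ) := by 
        simp only [nrm, Pi.sub_apply]
        refine Finset.sum_congr rfl fun i _ => Finset.sum_congr rfl fun j _ => by ring
      rw [en]
      calc _ ≤ ENNReal.ofReal (exp (nrm (Γ' - Γ) / (2 * 2) + 4 * AB * exp AB * k * (2 * 200 * r))) * ENNReal.ofReal x
            * ENNReal.ofReal x⁻¹ := mul_le_mul' (hl.trans (mul_le_mul' le_rfl h2)) le_rfl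
        _ = ENNReal.ofReal (exp (nrm (Γ' - Γ) / (2 * 2) + 4 * AB * exp AB * k * (2 * 200 * r))) := by
            rw [mul_assoc, ← ENNReal.ofReal_mul (exp_pos _).le, mul_inv_cancel₀ (exp_pos _).ne']; simp
        _ ≤ ENNReal.ofReal (exp (k + nrm (Γ' - Γ) / 4)) := by
            apply ENNReal.ofReal_le_ofReal
            rw [Real.exp_le_exp]
            have : k * (4 * AB * exp AB * (2 * 200 * r)) ≤ k * 1 := mul_le_mul_of_nonneg_left hr2 (by linarith)
            linarith
        _ = _ := by rw [Real.exp_add, ENNReal.ofReal_mul (exp_pos _).le]; simp)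
  rw [lintegral_indicator hT, lintegral_indicator hB] at main
  simp only [lintegral_const, MeasurableSet.univ, Measure.restrict_apply, Set.univ_inter, measure_univ, mul_one, one_pow] at main
  have h2 := (mul_le_mul' (hE_T_low g hs) (le_refl _)).trans main
  rw [← mul_assoc, ← ENNReal.ofReal_mul (by positivity)] at h2
  refine (ofReal_cancel (by positivity) h2).trans (ENNReal.ofReal_le_ofReal ?_)
  rw [div_le_iff₀ (by positivity), hx, ← Real.exp_neg]
  calc exp (k:ℝ) = exp (-4 * k + (-9 * k + -(-14 * k))) := by congr 1; ring
    _ = 4 * exp (-4 * k) * (1/4 * exp (-9 * k) * exp (-(-14 * k))) := by rw [Real.exp_add, Real.exp_add]; ring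
    _ ≤ _ := le_rfl
end GM

namespace GM
set_option linter.all false

def badP {n : ℕ} (ν : Measure (Fin n → ℝ)) (k : ℕ) : Set ((Fin k → Fin n → ℝ) × (Fin k → ℝ)) :=
  {q | ∑ i, q.2 i ^ 2 ≤ 2 * k} ∩ {q | hE ν 200 q.1 q.2 ≤ ENNReal.ofReal (exp (-14 * k))}

def Gs {n : ℕ} (ν : Measure (Fin n → ℝ)) (k : ℕ) : Set (Fin k → Fin n → ℝ) :=
  {Γ | volume (Prod.mk Γ ⁻¹' badP ν k) < ENNReal.ofReal ((1/2) ^ k)}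

lemma ms_badP {n : ℕ} (ν : Measure (Fin n → ℝ)) [SFinite ν] (k : ℕ) : MeasurableSet (badP ν k) :=
  (measurableSet_le (by fun_prop) measurable_const).inter (measurableSet_le (by fun_prop) measurable_const)

lemma ms_Gs {n : ℕ} (ν : Measure (Fin n → ℝ)) [SFinite ν] (k : ℕ) : MeasurableSet (Gs ν k) :=
  measurableSet_lt (measurable_measure_prodMk_left (ms_badP ν k)) measurable_const

lemma Gs_prob {n k : ℕ} {ν : Measure (Fin n → ℝ)} [IsProbabilityMeasure ν] {r : ℝ} (g : Reg2 ν k r) :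
    gmat k n (Gs ν k)ᶜ ≤ ENNReal.ofReal (1/2 * 2 ^ (-(k/2:ℝ))) := by
  have hk := g.kbig
  have h1 : ((gmat k n).prod (volume : Measure (Fin k → ℝ))) (badP ν k) ≤ ENNReal.ofReal (4 * exp (-4 * k)) * ENNReal.ofReal (exp (2 * k)) := by
    rw [Measure.prod_apply_symm (ms_badP ν k)]
    have hQ : MeasurableSet {s : Fin k → ℝ | ∑ i, (s i - (0 : Fin k → ℝ) i) ^ 2 ≤ 2 * k} := measurableSet_le (by fun_prop) measurable_const
    calc _ ≤ ∫⁻ s, {s : Fin k → ℝ | ∑ i, (s i - (0 : Fin k → ℝ) i) ^ 2 ≤ 2 * k}.indicator (fun _ => ENNReal.ofReal (4 * exp (-4 * k))) s := by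
          refine lintegral_mono fun s => ?_
          by_cases hs : ∑ i, s i ^ 2 ≤ 2 * k
          · rw [Set.indicator_of_mem (by show ∑ i, (s i - (0 : Fin k → ℝ) i) ^ 2 ≤ 2 * k; simpa using hs)]
            refine le_trans (measure_mono ?_) (bad_prob g hs)
            intro Γ hΓ
            exact hΓ.2
          · have : (fun Γ : Fin k → Fin n → ℝ => (Γ, s)) ⁻¹' badP ν k = ∅ := by
              ext Γ
              simp only [Set.mem_preimage, Set.mem_empty_iff_false, iff_false]
              intro h; exact hs h.1
            rw [this]; simp
      _ = ENNReal.ofReal (4 * exp (-4 * k)) * volume {s : Fin k → ℝ | ∑ i, (s i - (0 : Fin k → ℝ) i) ^ 2 ≤ 2 * k} := by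
          rw [lintegral_indicator hQ]; simp
      _ ≤ _ := mul_le_mul' le_rfl (volQ _)
  rw [Measure.prod_apply (ms_badP ν k)] at h1
  have h2 := mul_meas_ge_le_lintegral (μ := gmat k n) (measurable_measure_prodMk_left (ν := (volume : Measure (Fin k → ℝ))) (ms_badP ν k)) 
    (ENNReal.ofReal ((1/2) ^ k))
  have h3 : {Γ : Fin k → Fin n → ℝ | ENNReal.ofReal ((1/2) ^ k) ≤ volume (Prod.mk Γ ⁻¹' badP ν k)} = (Gs ν k)ᶜ := by
    ext Γ
    exact (not_lt (a := volume (Prod.mk Γ ⁻¹' badP ν k)) (b := ENNReal.ofReal ((1/2) ^ k))).symm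
  rw [h3] at h2
  have h4 := h2.trans h1
  rw [← ENNReal.ofReal_mul (by positivity)] at h4
  refine (ofReal_cancel (by positivity) h4).trans (ENNReal.ofReal_le_ofReal ?_)
  rw [div_le_iff₀ (by positivity)]
  have e1 : exp (-(k/2:ℝ)) ≤ 2 ^ (-(k/2:ℝ)) := by
    rw [show -(k/2:ℝ) = 1 * -(k/2:ℝ) by ring, Real.exp_mul, one_mul]
    exact Real.rpow_le_rpow_of_nonpos (by norm_num) (by have := Real.add_one_le_exp (1:ℝ); linarith) (by linarith)
  have e2 : exp (-(k:ℝ)) ≤ (1/2)^k := by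
    rw [show -(k:ℝ) = k * (-1) by ring, Real.exp_nat_mul]
    gcongr
    rw [Real.exp_neg, inv_le_comm₀ (exp_pos _) (by norm_num)]
    have := Real.add_one_le_exp (1:ℝ); norm_num at *; linarith
  have e3 : 8 ≤ exp (k/2:ℝ) := by have := Real.add_one_le_exp (k/2:ℝ); linarith
  calc 4 * exp (-4 * k) * exp (2 * k) = 1/2 * (8 * exp (-2 * k)) := by rw [mul_assoc, ← Real.exp_add]; ring_nf
    _ ≤ 1/2 * (exp (k/2:ℝ) * exp (-2 * k)) := by gcongr
    _ = 1/2 * exp (-(k/2:ℝ)) * exp (-(k:ℝ)) := by rw [mul_assoc, ← Real.exp_add, ← Real.exp_add]; ring_nf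
    _ ≤ _ := by gcongr

lemma exists_s {n k : ℕ} {ν : Measure (Fin n → ℝ)} {Γ : Fin k → Fin n → ℝ} 
    (hΓ : Γ ∈ Gs ν k) {a : Fin k → ℝ} (ha : ∑ i, a i ^ 2 = k) :
    ∃ s : Fin k → ℝ, ∑ i, (s i - a i) ^ 2 ≤ k / 16 ∧ ENNReal.ofReal (exp (-14 * k)) < hE ν 200 Γ s := by
  by_contra! hcon
  have hsub : Set.Icc (fun i => a i - 1/4) (fun i => a i + 1/4) ⊆ Prod.mk Γ ⁻¹' badP ν k := by
    intro s hs
    have h1 : ∀ i, (s i - a i) ^ 2 ≤ 1/16 := by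
      intro i
      have := hs.1 i
      have := hs.2 i
      simp only at *
      nlinarith
    have h2 : ∑ i, (s i - a i) ^ 2 ≤ k / 16 := by
      calc _ ≤ ∑ i : Fin k, (1/16:ℝ) := Finset.sum_le_sum fun i _ => h1 i
        _ = k/16 := by simp; ring
    refine ⟨?_, hcon s h2⟩
    show ∑ i, s i ^ 2 ≤ 2 * k
    have h3 : ∑ i, s i ^ 2 ≤ ∑ i, (5/4 * a i ^ 2 + 5 * (s i - a i) ^ 2) := by
      refine Finset.sum_le_sum fun i _ => ?_
      nlinarith [sq_nonneg (a i - 4 * (s i - a i))]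
    rw [Finset.sum_add_distrib, ← Finset.mul_sum, ← Finset.mul_sum, ha] at h3
    have : (0:ℝ) ≤ k := by positivity
    linarith
  have h1 := measure_mono (μ := volume) hsub
  rw [Real.volume_Icc_pi] at h1
  have h2 : ∏ i : Fin k, ENNReal.ofReal ((a i + 1/4) - (a i - 1/4)) = ENNReal.ofReal ((1/2)^k) := by
    have : ∀ i, (a i + 1/4) - (a i - 1/4) = 1/2 := fun i => by ring
    simp only [this, Finset.prod_const, Finset.card_univ, Fintype.card_fin]
    rw [ENNReal.ofReal_pow (by norm_num)]
  rw [h2] at h1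
  exact absurd hΓ (not_lt.mpr h1)

lemma prob_low {n k : ℕ} {ν : Measure (Fin n → ℝ)} [IsProbabilityMeasure ν] (hk : 1 ≤ k) {Γ : Fin k → Fin n → ℝ} {s : Fin k → ℝ}
    (h : ENNReal.ofReal (exp (-14 * k)) < hE ν 200 Γ s) :
    ENNReal.ofReal (1/2 * exp (-14 * k)) ≤ ν {z | Qf Γ s z ≤ k / 4} := by
  have hm : MeasurableSet {z | Qf Γ s z ≤ k / 4} := measurableSet_le (by fun_prop) measurable_const
  have h1 : hE ν 200 Γ s ≤ ν {z | Qf Γ s z ≤ k / 4} + ENNReal.ofReal (exp (-25 * k)) := by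
    unfold hE
    rw [← lintegral_add_compl _ hm]
    apply add_le_add
    · refine le_trans (setLIntegral_mono' (g := fun _ => 1) hm fun z _ => ?_) (by simp)
      rw [ENNReal.ofReal_le_one, Real.exp_le_one_iff]
      have := Qf_nonneg Γ s z; linarith
    · calc _ ≤ ∫⁻ z in {z | Qf Γ s z ≤ k / 4}ᶜ, ENNReal.ofReal (exp (-25 * k)) ∂ν := by
            refine setLIntegral_mono' hm.compl fun z hz => ?_
            apply ENNReal.ofReal_le_ofReal
            rw [Real.exp_le_exp]
            have hz : ¬ (Qf Γ s z ≤ k / 4) := hz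
            linarith
        _ ≤ ∫⁻ z, ENNReal.ofReal (exp (-25 * k)) ∂ν := setLIntegral_le_lintegral _ _
        _ = _ := by simp
  have h2 : ENNReal.ofReal (exp (-25 * k)) ≤ ENNReal.ofReal (1/2 * exp (-14 * k)) := by
    apply ENNReal.ofReal_le_ofReal
    have e : 2 ≤ exp (11 * k:ℝ) := by
      have := Real.add_one_le_exp (11 * k:ℝ)
      have : (1:ℝ) ≤ k := by exact_mod_cast hk
      linarith
    have : exp (-14 * k : ℝ) = exp (11 * k) * exp (-25 * k) := by rw [← Real.exp_add]; ring_nf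
    rw [this]
    have := exp_pos (-25 * k : ℝ)
    nlinarith
  have h3 : ENNReal.ofReal (1/2 * exp (-14 * k)) + ENNReal.ofReal (1/2 * exp (-14 * k)) ≤ ν {z | Qf Γ s z ≤ k / 4} + ENNReal.ofReal (1/2 * exp (-14 * k)) := by
    rw [← ENNReal.ofReal_add (by positivity) (by positivity)]
    refine le_trans (le_of_eq (by congr 1; ring)) (h.le.trans (h1.trans (add_le_add le_rfl h2)))
  exact (ENNReal.add_le_add_iff_right ENNReal.ofReal_ne_top).mp h3

lemma exists_y {n k : ℕ} {ν : Measure (Fin n → ℝ)} [IsProbabilityMeasure ν] (hk : 1 ≤ k) {Γ : Fin k → Fin n → ℝ} {s : Fin k → ℝ}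
    (h : ENNReal.ofReal (1/2 * exp (-14 * k)) ≤ ν {z | Qf Γ s z ≤ k / 4}) {δ : ℝ} (hδ : 0 < δ) (hδ1 : δ ≤ 1/10) :
    ∃ y : Fin k → ℝ, ∑ i, (y i - s i) ^ 2 ≤ 0.36 * k ∧ ENNReal.ofReal (exp (-18 * k) * δ ^ k) ≤ hE ν (δ ^ 2)⁻¹ Γ y := by
  by_contra! hcon
  have hk1 : (1:ℝ) ≤ k := by exact_mod_cast hk
  set R : Set (Fin k → ℝ) := {y | ∑ i, (y i - s i) ^ 2 ≤ 0.36 * k} with hR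
  have hRm : MeasurableSet R := measurableSet_le (by fun_prop) measurable_const
  have hm : MeasurableSet {z | Qf Γ s z ≤ k / 4} := measurableSet_le (by fun_prop) measurable_const
  have up : ∫⁻ y in R, hE ν (δ ^ 2)⁻¹ Γ y ≤ ENNReal.ofReal (exp (-18 * k) * δ ^ k) * ENNReal.ofReal (exp (2 * k)) := by
    calc _ ≤ ∫⁻ y in R, ENNReal.ofReal (exp (-18 * k) * δ ^ k) := setLIntegral_mono' hRm fun y hy => (hcon y hy).le
      _ = ENNReal.ofReal (exp (-18 * k) * δ ^ k) * volume R := by simp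
      _ ≤ _ := by
          refine mul_le_mul' le_rfl (le_trans (measure_mono ?_) (volQ s))
          intro y hy
          have hy : ∑ i, (y i - s i) ^ 2 ≤ 0.36 * k := hy
          show ∑ i, (y i - s i) ^ 2 ≤ 2 * k
          linarith
  have hsw : ∫⁻ y in R, hE ν (δ ^ 2)⁻¹ Γ y = 
      ∫⁻ z, (∫⁻ y in R, ENNReal.ofReal (exp (-((δ ^ 2)⁻¹ * Qf Γ y z) / 2))) ∂ν := by
    simp only [hE]
    exact lintegral_lintegral_swap (by simp only [Function.uncurry_def]; fun_prop)
  have key : ∀ z ∈ {z | Qf Γ s z ≤ k / 4}, ENNReal.ofReal (exp (-(k/2:ℝ)) * (2 * δ) ^ k) ≤ 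
      ∫⁻ y in R, ENNReal.ofReal (exp (-((δ ^ 2)⁻¹ * Qf Γ y z) / 2)) := by
    intro z hz
    have hz : Qf Γ s z ≤ k / 4 := hz
    set I := Set.Icc (fun i => Γ i ⬝ᵥ z - δ) (fun i => Γ i ⬝ᵥ z + δ) with hI
    have hIq : ∀ y ∈ I, Qf Γ y z ≤ k * δ ^ 2 := by
      intro y hy
      have h1 : ∀ i, (y i - Γ i ⬝ᵥ z) ^ 2 ≤ δ ^ 2 := by
        intro i
        have := hy.1 i
        have := hy.2 i
        simp only at *
        nlinarith
      calc _ ≤ ∑ i : Fin k, δ ^ 2 := Finset.sum_le_sum fun i _ => h1 i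
        _ = _ := by simp
    have hIR : I ⊆ R := by
      intro y hy
      have h1 := hIq y hy
      show ∑ i, (y i - s i) ^ 2 ≤ 0.36 * k
      have h2 : ∑ i, (y i - s i) ^ 2 ≤ ∑ i, (6/5 * (s i - Γ i ⬝ᵥ z) ^ 2 + 6 * (y i - Γ i ⬝ᵥ z) ^ 2) := by
        refine Finset.sum_le_sum fun i _ => ?_
        nlinarith [sq_nonneg ((s i - Γ i ⬝ᵥ z) + 5 * (y i - Γ i ⬝ᵥ z))]
      rw [Finset.sum_add_distrib, ← Finset.mul_sum, ← Finset.mul_sum] at h2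
      unfold Qf at hz h1
      have h3 : k * δ ^ 2 ≤ k * (1/100) := by gcongr; nlinarith
      norm_num
      linarith
    calc ENNReal.ofReal (exp (-(k/2:ℝ)) * (2 * δ) ^ k) = ENNReal.ofReal (exp (-(k/2:ℝ))) * volume I := by
          rw [hI, Real.volume_Icc_pi, ENNReal.ofReal_mul (exp_pos _).le]
          congr 1
          have : ∀ i, (Γ i ⬝ᵥ z + δ) - (Γ i ⬝ᵥ z - δ) = 2 * δ := fun i => by ring
          simp only [this, Finset.prod_const, Finset.card_univ, Fintype.card_fin]
          rw [ENNReal.ofReal_pow (by positivity)]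
      _ = ∫⁻ y in I, ENNReal.ofReal (exp (-(k/2:ℝ))) := by simp
      _ ≤ ∫⁻ y in I, ENNReal.ofReal (exp (-((δ ^ 2)⁻¹ * Qf Γ y z) / 2)) := by
          refine setLIntegral_mono' measurableSet_Icc fun y hy => ?_
          apply ENNReal.ofReal_le_ofReal
          rw [Real.exp_le_exp]
          have h1 := hIq y hy
          have h2 : (δ ^ 2)⁻¹ * Qf Γ y z ≤ k := by
            rw [inv_mul_le_iff₀ (by positivity)]; linarith
          linarith
      _ ≤ _ := lintegral_mono_set hIR
  have low : ENNReal.ofReal (exp (-(k/2:ℝ)) * (2 * δ) ^ k) * ENNReal.ofReal (1/2 * exp (-14 * k)) ≤ ∫⁻ y in R, hE ν (δ ^ 2)⁻¹ Γ y := by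
    rw [hsw]
    refine le_trans ?_ (setLIntegral_le_lintegral {z | Qf Γ s z ≤ k / 4} _)
    exact le_trans (mul_le_mul' le_rfl h) (set_low hm le_rfl key)
  have := low.trans up
  rw [← ENNReal.ofReal_mul (by positivity), ← ENNReal.ofReal_mul (by positivity), ENNReal.ofReal_le_ofReal_iff (by positivity), mul_pow] at this
  have e1 : (2:ℝ) ≤ 2 ^ k := by
    calc (2:ℝ) = 2 ^ 1 := by norm_num
      _ ≤ _ := pow_le_pow_right₀ (by norm_num) hk
  have e2 : exp (-18 * k) * δ ^ k * exp (2 * k) = exp (-16 * k) * δ ^ k := by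
    rw [mul_right_comm, ← Real.exp_add]; ring_nf
  have e3 : exp (-(k/2:ℝ)) * (2 ^ k * δ ^ k) * (1/2 * exp (-14 * k)) = (2 ^ k / 2) * (exp (-14.5 * k) * δ ^ k) := by
    have : exp (-14.5 * k : ℝ) = exp (-(k/2:ℝ)) * exp (-14 * k) := by rw [← Real.exp_add]; ring_nf
    rw [this]; ring
  rw [e2, e3] at this
  have e4 : exp (-16 * k : ℝ) < exp (-14.5 * k) := by rw [Real.exp_lt_exp]; norm_num; linarith
  have e5 : exp (-16 * k : ℝ) * δ ^ k < exp (-14.5 * k) * δ ^ k := by gcongr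
  have e6 : exp (-14.5 * k : ℝ) * δ ^ k ≤ (2 ^ k / 2) * (exp (-14.5 * k) * δ ^ k) := by
    apply le_mul_of_one_le_left (by positivity); linarith
  linarith

lemma sq_dot {k : ℕ} {u θ : Fin k → ℝ} (hθ : θ ⬝ᵥ θ = 1) {c : ℝ} (hc : 0 ≤ c) (h : ∑ i, u i ^ 2 ≤ c ^ 2 * k) : 
    - (c * √k) ≤ u ⬝ᵥ θ := by
  have h1 := cs_dot u θ
  have h2 : u ⬝ᵥ u = ∑ i, u i ^ 2 := by simp [dotProduct, sq]
  rw [hθ, mul_one, h2] at h1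
  have h3 : (u ⬝ᵥ θ) ^ 2 ≤ (c * √k) ^ 2 := by 
    rw [mul_pow, Real.sq_sqrt (by positivity)]; linarith
  exact (abs_le.mp (abs_le_of_sq_le_sq h3 (by positivity))).1

lemma exists_dir {n k : ℕ} {ν : Measure (Fin n → ℝ)} [IsProbabilityMeasure ν] (hk : 1 ≤ k) {Γ : Fin k → Fin n → ℝ} 
    (hΓ : Γ ∈ Gs ν k) {θ : Fin k → ℝ} (hθ : θ ⬝ᵥ θ = 1) {δ : ℝ} (hδ : 0 < δ) (hδ1 : δ ≤ 1/10) :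
    ∃ y : Fin k → ℝ, 0.15 * √k ≤ y ⬝ᵥ θ ∧ ENNReal.ofReal (exp (-18 * k) * δ ^ k) ≤ hE ν (δ ^ 2)⁻¹ Γ y := by
  have ha : ∑ i, ((√k • θ) i) ^ 2 = k := by
    have h2 : θ ⬝ᵥ θ = ∑ i, θ i ^ 2 := by simp [dotProduct, sq]
    simp only [Pi.smul_apply, smul_eq_mul, mul_pow]
    rw [← Finset.mul_sum, ← h2, hθ, Real.sq_sqrt (by positivity), mul_one]
  obtain ⟨s, hs, hs2⟩ := exists_s hΓ ha
  obtain ⟨y, hy, hy2⟩ := exists_y hk (prob_low hk hs2) hδ hδ1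
  refine ⟨y, ?_, hy2⟩
  have h1 := sq_dot (u := s - √k • θ) hθ (c := 1/4) (by norm_num) (by simp only [Pi.sub_apply]; linarith)
  have h2 := sq_dot (u := y - s) hθ (c := 0.6) (by norm_num) (by simp only [Pi.sub_apply]; norm_num at *; linarith)
  have h3 : y ⬝ᵥ θ = (y - s) ⬝ᵥ θ + (s - √k • θ) ⬝ᵥ θ + √k := by
    rw [sub_dotProduct, sub_dotProduct, smul_dotProduct, hθ]; simp
  rw [h3]
  norm_num at *; linarith
end GM

namespace GM
set_option linter.all false

lemma cont_hE {n k : ℕ} {ν : Measure (Fin n → ℝ)} [IsProbabilityMeasure ν] {l : ℝ} (hl : 0 < l) (Γ : Fin k → Fin n → ℝ) :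
    Continuous (fun s => hE ν l Γ s) := by
  simp only [hE_ofReal hl]
  refine ENNReal.continuous_ofReal.comp ?_
  refine continuous_of_dominated (bound := fun _ => 1) ?_ ?_ (integrable_const _) ?_
  · intro s; exact (by fun_prop : Measurable _).aestronglyMeasurable
  · intro s
    refine Filter.Eventually.of_forall fun y => ?_
    rw [Real.norm_eq_abs, abs_of_pos (exp_pos _), Real.exp_le_one_iff]
    have := Qf_nonneg Γ s y
    have : 0 ≤ l * Qf Γ s y := by positivity
    linarith
  · refine Filter.Eventually.of_forall fun y => ?_
    unfold Qf
    fun_prop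

lemma nearpt {k : ℕ} {L : Set (Fin k → ℝ)} (hL : IsClosed L) (hmid : ∀ x ∈ L, ∀ y ∈ L, (1/2:ℝ) • (x + y) ∈ L)
    (hne : L.Nonempty) {z : Fin k → ℝ} (hz : z ∉ L) : ∃ θ : Fin k → ℝ, θ ⬝ᵥ θ = 1 ∧ ∀ w ∈ L, w ⬝ᵥ θ ≤ z ⬝ᵥ θ := by
  obtain ⟨w0, hw0⟩ := hne
  have hF : Continuous (fun y : Fin k → ℝ => (y - z) ⬝ᵥ (y - z)) := by unfold dotProduct; fun_prop
  set D := (w0 - z) ⬝ᵥ (w0 - z) with hD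
  have hD0 : 0 ≤ D := dot_self_nonneg _
  have hK : IsCompact (L ∩ {y | (y - z) ⬝ᵥ (y - z) ≤ D}) := by
    refine IsCompact.of_isClosed_subset (isCompact_Icc (a := fun i => z i - √D) (b := fun i => z i + √D)) 
      (hL.inter (isClosed_le hF continuous_const)) ?_
    rintro y ⟨_, hy⟩
    have hy : (y - z) ⬝ᵥ (y - z) ≤ D := hy
    have h1 : ∀ i, |y i - z i| ≤ √D := by
      intro i
      apply Real.abs_le_sqrt
      refine le_trans ?_ hy
      have := Finset.single_le_sum (f := fun i => (y - z) i * (y - z) i) (fun i _ => mul_self_nonneg _) (Finset.mem_univ i)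
      rw [sq]; exact this
    constructor
    · intro i; have := (abs_le.mp (h1 i)).1; simp only; linarith
    · intro i; have := (abs_le.mp (h1 i)).2; simp only; linarith
  obtain ⟨q, hq, hqmin⟩ := hK.exists_isMinOn ⟨w0, hw0, le_refl D⟩ hF.continuousOn
  have hqm : ∀ y ∈ L, (q - z) ⬝ᵥ (q - z) ≤ (y - z) ⬝ᵥ (y - z) := by
    intro y hy
    by_cases h : (y - z) ⬝ᵥ (y - z) ≤ D
    · exact hqmin ⟨hy, h⟩
    · exact le_trans hq.2 (not_le.mp h).le
  have hqL := hq.1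
  have hseq : ∀ w ∈ L, ∀ m : ℕ, q + ((1/2:ℝ) ^ m) • (w - q) ∈ L := by
    intro w hw m
    induction m with
    | zero => simpa using hw
    | succ m ih =>
      have := hmid _ hqL _ ih
      convert this using 1
      ext i
      simp only [Pi.add_apply, Pi.smul_apply, Pi.sub_apply, smul_eq_mul]
      ring
  set d := z - q with hd
  have hw : ∀ w ∈ L, (w - q) ⬝ᵥ d ≤ 0 := by
    intro w hw
    have h1 : ∀ m : ℕ, 2 * ((w - q) ⬝ᵥ d) ≤ (1/2:ℝ)^m * ((w - q) ⬝ᵥ (w - q)) := by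
      intro m
      have h2 := hqm _ (hseq w hw m)
      set t := (1/2:ℝ)^m with ht
      have ht0 : 0 < t := by positivity
      have e1 : q + t • (w - q) - z = t • (w - q) - d := by rw [hd]; abel
      have e2 : q - z = - d := by rw [hd]; abel
      rw [e1, e2] at h2
      simp only [sub_dotProduct, dotProduct_sub, smul_dotProduct, dotProduct_smul, neg_dotProduct, dotProduct_neg, smul_eq_mul] at h2 ⊢
      have c1 : d ⬝ᵥ w = w ⬝ᵥ d := dotProduct_comm _ _
      have c2 : d ⬝ᵥ q = q ⬝ᵥ d := dotProduct_comm _ _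
      rw [c1, c2] at h2
      have h3 : t * (2 * (w ⬝ᵥ d - q ⬝ᵥ d)) ≤ t * (t * (w ⬝ᵥ w - w ⬝ᵥ q - (q ⬝ᵥ w - q ⬝ᵥ q))) := by nlinarith
      have := le_of_mul_le_mul_left h3 ht0
      linarith
    have h2 : Filter.Tendsto (fun m : ℕ => (1/2:ℝ)^m * ((w - q) ⬝ᵥ (w - q))) Filter.atTop (nhds (0 * ((w - q) ⬝ᵥ (w - q)))) :=
      (tendsto_pow_atTop_nhds_zero_of_lt_one (by norm_num) (by norm_num)).mul_const _
    have := ge_of_tendsto' h2 h1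
    linarith
  have hd0 : 0 < d ⬝ᵥ d := by
    rcases (dot_self_nonneg d).lt_or_eq with h | h
    · exact h
    · exfalso
      have := dotProduct_self_eq_zero.mp h.symm
      rw [hd, sub_eq_zero] at this
      exact hz (this ▸ hqL)
  have hs : 0 < √(d ⬝ᵥ d) := Real.sqrt_pos.mpr hd0
  refine ⟨(√(d ⬝ᵥ d))⁻¹ • d, ?_, ?_⟩
  · rw [smul_dotProduct, dotProduct_smul, smul_eq_mul, smul_eq_mul, ← mul_assoc, ← mul_inv, Real.mul_self_sqrt hd0.le, inv_mul_cancel₀ hd0.ne']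
  · intro w hwL
    rw [dotProduct_smul, dotProduct_smul, smul_eq_mul, smul_eq_mul]
    apply mul_le_mul_of_nonneg_left _ (by positivity)
    have h1 := hw w hwL
    have h2 : z ⬝ᵥ d = q ⬝ᵥ d + d ⬝ᵥ d := by rw [← add_dotProduct, hd]; congr 1; abel
    rw [sub_dotProduct] at h1
    linarith

lemma ball_low {n k : ℕ} {ν : Measure (Fin n → ℝ)} [IsProbabilityMeasure ν] (hν : PLM ν (fun _ _ => 1)) (hk : 1 ≤ k) {Γ : Fin k → Fin n → ℝ} 
    (hΓ : Γ ∈ Gs ν k) {δ : ℝ} (hδ : 0 < δ) (hδ1 : δ ≤ 1/10) {z : Fin k → ℝ} (hz : z ⬝ᵥ z < 0.0225 * k) :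
    ENNReal.ofReal (exp (-18 * k) * δ ^ k) ≤ hE ν (δ ^ 2)⁻¹ Γ z := by
  by_contra hcon
  have hl : 0 < (δ ^ 2)⁻¹ := by positivity
  set L := {y | ENNReal.ofReal (exp (-18 * k) * δ ^ k) ≤ hE ν (δ ^ 2)⁻¹ Γ y} with hL
  have hLc : IsClosed L := isClosed_le continuous_const (cont_hE hl Γ)
  have hmid : ∀ x ∈ L, ∀ y ∈ L, (1/2:ℝ) • (x + y) ∈ L := by
    intro x hx y hy
    have hx : ENNReal.ofReal (exp (-18 * k) * δ ^ k) ≤ hE ν (δ ^ 2)⁻¹ Γ x := hx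
    have hy : ENNReal.ofReal (exp (-18 * k) * δ ^ k) ≤ hE ν (δ ^ 2)⁻¹ Γ y := hy
    show ENNReal.ofReal (exp (-18 * k) * δ ^ k) ≤ hE ν (δ ^ 2)⁻¹ Γ _
    have h1 := (mul_le_mul' hx hy).trans (hE_lc hν hl Γ x y)
    rw [← sq] at h1
    exact (ENNReal.pow_le_pow_left_iff two_ne_zero).mp h1
  have hne : L.Nonempty := by
    have : Nonempty (Fin k) := ⟨⟨0, hk⟩⟩
    obtain ⟨y, _, hy⟩ := exists_dir hk hΓ (θ := Pi.single ⟨0, hk⟩ 1) (by simp) hδ hδ1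
    exact ⟨y, hy⟩
  obtain ⟨θ, hθ, hθL⟩ := nearpt hLc hmid hne (z := z) hcon
  obtain ⟨y, hy1, hy2⟩ := exists_dir hk hΓ hθ hδ hδ1
  have h1 := hθL y hy2
  have h2 := cs_dot z θ
  rw [hθ, mul_one] at h2
  have h3 : (0.15 * √k) ^ 2 ≤ (z ⬝ᵥ θ) ^ 2 := by
    apply pow_le_pow_left₀ (by positivity); linarith
  rw [mul_pow, Real.sq_sqrt (by positivity)] at h3
  norm_num at *; linarith

lemma psi_int {n k : ℕ} {ν : Measure (Fin n → ℝ)} [IsProbabilityMeasure ν] (Γ : Fin k → Fin n → ℝ) {l : ℝ} (hl : 0 < l) :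
    ∫⁻ y, hE ν l Γ y = ENNReal.ofReal (√(2 * π / l) ^ k) := by
  have : ∫⁻ y, hE ν l Γ y = ∫⁻ z, (∫⁻ y, ENNReal.ofReal (exp (-(l * Qf Γ y z) / 2))) ∂ν := by
    simp only [hE]
    exact lintegral_lintegral_swap (by simp only [Function.uncurry_def]; fun_prop)
  rw [this]
  have e : ∀ z, ∫⁻ y, ENNReal.ofReal (exp (-(l * Qf Γ y z) / 2)) = ENNReal.ofReal (√(2 * π / l) ^ k) := fun z => gaussVol hl (fun i => Γ i ⬝ᵥ z)
  simp only [e]; simp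

lemma psi0 {n k : ℕ} {ν : Measure (Fin n → ℝ)} [IsProbabilityMeasure ν] (hν : PLM ν (fun _ _ => 1)) (hk : 1 ≤ k) {Γ : Fin k → Fin n → ℝ} 
    (hΓ : Γ ∈ Gs ν k) {δ : ℝ} (hδ : 0 < δ) (hδ1 : δ ≤ 1/10) : hE ν (δ ^ 2)⁻¹ Γ 0 ≤ ENNReal.ofReal ((exp 25 * δ) ^ k) := by
  have hk1 : (1:ℝ) ≤ k := by exact_mod_cast hk
  have hl : 0 < (δ ^ 2)⁻¹ := by positivity
  set ω := exp (-18 * k) * δ ^ k with hω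
  have hω0 : 0 < ω := by positivity
  set I : ℝ := ∫ y, exp (-((δ ^ 2)⁻¹ * Qf Γ 0 y) / 2) ∂ν with hI
  have hI0 : 0 ≤ I := integral_nonneg fun y => (exp_pos _).le
  have hIe : hE ν (δ ^ 2)⁻¹ Γ 0 = ENNReal.ofReal I := hE_ofReal hl Γ 0
  have key : ∀ w ∈ Set.Icc (fun _ : Fin k => (-0.05:ℝ)) (fun _ => 0.05), ENNReal.ofReal (√(ω * I)) ≤ hE ν (δ ^ 2)⁻¹ Γ w := by
    intro w hw
    have h1 : ((2:ℝ) • w) ⬝ᵥ ((2:ℝ) • w) < 0.0225 * k := by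
      have h2 : ∀ i, (2:ℝ) * w i * (2 * w i) ≤ 0.01 := by
        intro i
        have := hw.1 i
        have := hw.2 i
        simp only at *
        norm_num at *
        nlinarith
      calc ((2:ℝ) • w) ⬝ᵥ ((2:ℝ) • w) = ∑ i, (2:ℝ) * w i * (2 * w i) := by simp [dotProduct]
        _ ≤ ∑ i : Fin k, (0.01:ℝ) := Finset.sum_le_sum fun i _ => h2 i
        _ < _ := by simp; norm_num; linarith
    have h2 := ball_low hν hk hΓ hδ hδ1 h1
    have h3 := hE_lc hν hl Γ ((2:ℝ) • w) 0
    rw [add_zero, smul_smul] at h3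
    norm_num at h3
    have h4 := (mul_le_mul' h2 (le_refl (hE ν (δ ^ 2)⁻¹ Γ 0))).trans h3
    rw [hIe, ← ENNReal.ofReal_mul (by positivity)] at h4
    refine (ENNReal.pow_le_pow_left_iff two_ne_zero).mp (le_trans (le_of_eq ?_) h4)
    rw [← ENNReal.ofReal_pow (by positivity), Real.sq_sqrt (by positivity)]
  have h5 : ENNReal.ofReal (√(ω * I) * (1/10)^k) ≤ ENNReal.ofReal (√(2 * π / (δ ^ 2)⁻¹) ^ k) := by
    rw [← psi_int Γ hl (ν := ν)]
    calc _ = ENNReal.ofReal (√(ω * I)) * volume (Set.Icc (fun _ : Fin k => (-0.05:ℝ)) (fun _ => 0.05)) := by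
          rw [Real.volume_Icc_pi, ENNReal.ofReal_mul (by positivity)]
          congr 1
          simp only [Finset.prod_const, Finset.card_univ, Fintype.card_fin]
          rw [ENNReal.ofReal_pow (by norm_num)]; norm_num
      _ = ∫⁻ w in Set.Icc (fun _ : Fin k => (-0.05:ℝ)) (fun _ => 0.05), ENNReal.ofReal (√(ω * I)) := by simp
      _ ≤ ∫⁻ w in Set.Icc (fun _ : Fin k => (-0.05:ℝ)) (fun _ => 0.05), hE ν (δ ^ 2)⁻¹ Γ w := setLIntegral_mono' measurableSet_Icc key
      _ ≤ _ := setLIntegral_le_lintegral _ _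
  rw [ENNReal.ofReal_le_ofReal_iff (by positivity)] at h5
  have h6 := pow_le_pow_left₀ (by positivity) h5 2
  rw [mul_pow, Real.sq_sqrt (by positivity), ← pow_mul, ← pow_mul, mul_comm k 2, pow_mul, pow_mul, Real.sq_sqrt (by positivity)] at h6
  rw [hIe]
  apply ENNReal.ofReal_le_ofReal
  have e7 : (200 * π) ≤ exp 7 := by
    have := Real.exp_one_gt_d9
    have h5 : (2.7:ℝ)^7 ≤ exp 1 ^ 7 := by gcongr; linarith
    rw [← Real.exp_nat_mul] at h5
    have := Real.pi_lt_d2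
    norm_num at h5 ⊢
    linarith
  have e8 : ω * I ≤ (200 * π * δ ^ 2) ^ k := by
    have : (200 * π * δ ^ 2) ^ k * ((1/10)^2)^k = (2 * π / (δ ^ 2)⁻¹) ^ k := by
      rw [← mul_pow]; congr 1; field_simp; ring
    rw [← this] at h6
    exact le_of_mul_le_mul_right h6 (by positivity)
  have e9 : (200 * π * δ ^ 2) ^ k ≤ ω * (exp 25 * δ) ^ k := by
    have : exp (-18 * k : ℝ) = exp (-18) ^ k := by rw [← Real.exp_nat_mul]; congr 1; ring
    rw [hω, this, ← mul_pow, ← mul_pow]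
    apply pow_le_pow_left₀ (by positivity)
    have : exp (-18) * δ * (exp 25 * δ) = exp 7 * δ ^ 2 := by
      rw [show (7:ℝ) = -18 + 25 by norm_num, Real.exp_add]; ring
    rw [this]; gcongr
  exact le_of_mul_le_mul_left (e8.trans e9) hω0

lemma small_ball {n k : ℕ} {ν : Measure (Fin n → ℝ)} [IsProbabilityMeasure ν] {r : ℝ} (g : Reg2 ν k r) {δ : ℝ} (hδ : 0 < δ) (hδ1 : δ ≤ 1/10) :
    ν {y | y ⬝ᵥ y ≤ δ ^ 2} ≤ ENNReal.ofReal ((exp 26 * δ) ^ k) := by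
  have hk := g.kbig
  have hk1 := g.kpos
  have hl : 0 < (δ ^ 2)⁻¹ := by positivity
  have up : ∫⁻ Γ in Gs ν k, hE ν (δ ^ 2)⁻¹ Γ 0 ∂(gmat k n) ≤ ENNReal.ofReal ((exp 25 * δ) ^ k) := by
    calc _ ≤ ∫⁻ Γ in Gs ν k, ENNReal.ofReal ((exp 25 * δ) ^ k) ∂(gmat k n) := 
          setLIntegral_mono' (ms_Gs ν k) fun Γ hΓ => psi0 g.lc hk1 hΓ hδ hδ1
      _ ≤ ∫⁻ Γ, ENNReal.ofReal ((exp 25 * δ) ^ k) ∂(gmat k n) := setLIntegral_le_lintegral _ _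
      _ = _ := by simp
  have hsw : ∫⁻ Γ in Gs ν k, hE ν (δ ^ 2)⁻¹ Γ 0 ∂(gmat k n) = 
      ∫⁻ y, (∫⁻ Γ in Gs ν k, ENNReal.ofReal (exp (-((δ ^ 2)⁻¹ * Qf Γ 0 y) / 2)) ∂(gmat k n)) ∂ν := by
    simp only [hE]
    exact lintegral_lintegral_swap (by simp only [Function.uncurry_def]; fun_prop)
  rw [hsw] at up
  have key : ∀ y ∈ {y : Fin n → ℝ | y ⬝ᵥ y ≤ δ ^ 2}, ENNReal.ofReal (1/2 * 2 ^ (-(k/2:ℝ))) ≤ 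
      ∫⁻ Γ in Gs ν k, ENNReal.ofReal (exp (-((δ ^ 2)⁻¹ * Qf Γ 0 y) / 2)) ∂(gmat k n) := by
    intro y hy
    have hy : y ⬝ᵥ y ≤ δ ^ 2 := hy
    have hU := dot_self_nonneg y
    have hlU : (δ ^ 2)⁻¹ * (y ⬝ᵥ y) ≤ 1 := by rw [inv_mul_le_iff₀ (by positivity)]; linarith
    have hlU0 : 0 ≤ (δ ^ 2)⁻¹ * (y ⬝ᵥ y) := by positivity
    have h1 := gE (k := k) (l := (δ ^ 2)⁻¹) 0 y (by linarith)
    have h2 : ENNReal.ofReal (2 ^ (-(k/2:ℝ))) ≤ ∫⁻ Γ, ENNReal.ofReal (exp (-((δ ^ 2)⁻¹ * Qf Γ 0 y) / 2)) ∂(gmat k n) := by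
      rw [h1]
      apply ENNReal.ofReal_le_ofReal
      simp
      exact Real.rpow_le_rpow_of_nonpos (by linarith) (by linarith) (by linarith)
    rw [← lintegral_add_compl _ (ms_Gs ν k)] at h2
    have h3 : ∫⁻ Γ in (Gs ν k)ᶜ, ENNReal.ofReal (exp (-((δ ^ 2)⁻¹ * Qf Γ 0 y) / 2)) ∂(gmat k n) ≤ ENNReal.ofReal (1/2 * 2 ^ (-(k/2:ℝ))) := by
      refine le_trans ?_ (Gs_prob g)
      refine le_trans (setLIntegral_mono' (g := fun _ => 1) (ms_Gs ν k).compl fun Γ _ => ?_) (by simp)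
      rw [ENNReal.ofReal_le_one, Real.exp_le_one_iff]
      have := Qf_nonneg Γ 0 y
      have : 0 ≤ (δ ^ 2)⁻¹ * Qf Γ 0 y := by positivity
      linarith
    have h4 := h2.trans (add_le_add le_rfl h3)
    have h5 : ENNReal.ofReal (2 ^ (-(k/2:ℝ))) = ENNReal.ofReal (1/2 * 2 ^ (-(k/2:ℝ))) + ENNReal.ofReal (1/2 * 2 ^ (-(k/2:ℝ))) := by
      rw [← ENNReal.ofReal_add (by positivity) (by positivity)]; congr 1; ring
    rw [h5] at h4
    exact (ENNReal.add_le_add_iff_right ENNReal.ofReal_ne_top).mp h4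
  have low := (set_low (ν := ν) (ms_le (δ ^ 2)) (Set.subset_univ _) key)
  rw [Measure.restrict_univ] at low
  refine (ofReal_cancel (by positivity) (low.trans up)).trans (ENNReal.ofReal_le_ofReal ?_)
  rw [div_le_iff₀ (by positivity)]
  have e1 : exp (26:ℝ) = exp 25 * exp 1 := by rw [← Real.exp_add]; norm_num
  rw [e1, show exp 25 * exp 1 * δ = (exp 25 * δ) * exp 1 by ring, mul_pow (exp 25 * δ), mul_assoc]
  apply le_mul_of_one_le_right (by positivity)
  have e2 : exp (-(k/2:ℝ)) ≤ 2 ^ (-(k/2:ℝ)) := by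
    rw [show -(k/2:ℝ) = 1 * -(k/2:ℝ) by ring, Real.exp_mul, one_mul]
    exact Real.rpow_le_rpow_of_nonpos (by norm_num) (by have := Real.add_one_le_exp (1:ℝ); linarith) (by linarith)
  have e3 : 2 ≤ exp (k/2:ℝ) := by have := Real.add_one_le_exp (k/2:ℝ); linarith
  calc (1:ℝ) = 1/2 * 2 := by norm_num
    _ ≤ 1/2 * exp (k/2:ℝ) := by gcongr
    _ = exp 1 ^ k * (1/2 * exp (-(k/2:ℝ))) := by
        rw [← Real.exp_nat_mul, mul_left_comm, ← Real.exp_add]; congr 2; ring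
    _ ≤ _ := by gcongr
end GM

namespace GM
set_option linter.all false

lemma zero_null {n k : ℕ} {ν : Measure (Fin n → ℝ)} [IsProbabilityMeasure ν] {r : ℝ} (g : Reg2 ν k r) : 
    ν {y | y ⬝ᵥ y ≤ 0} = 0 := by
  have hk1 := g.kpos
  have h1 : ∀ m : ℕ, ν {y | y ⬝ᵥ y ≤ 0} ≤ ENNReal.ofReal ((exp 26 * (1/10 * (1/2)^m)) ^ k) := by
    intro m
    refine le_trans (measure_mono ?_) (small_ball g (δ := 1/10 * (1/2)^m) (by positivity) ?_)
    · intro y hy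
      have hy : y ⬝ᵥ y ≤ 0 := hy
      exact le_trans hy (by positivity)
    · have : (1/2:ℝ)^m ≤ 1 := pow_le_one₀ (by norm_num) (by norm_num)
      linarith
  have h2 : Filter.Tendsto (fun m : ℕ => ENNReal.ofReal ((exp 26 * (1/10 * (1/2)^m)) ^ k)) Filter.atTop (nhds (ENNReal.ofReal ((exp 26 * (1/10 * 0))^k))) := by
    refine (ENNReal.continuous_ofReal.tendsto _).comp ?_
    exact (((tendsto_pow_atTop_nhds_zero_of_lt_one (by norm_num) (by norm_num)).const_mul _).const_mul _).pow _
  have h3 := ge_of_tendsto' h2 h1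
  have : (exp 26 * (1/10 * 0))^k = 0 := by rw [mul_zero, mul_zero]; exact zero_pow (by omega)
  rw [this] at h3
  simpa using h3

lemma tiny_mom {n k : ℕ} {ν : Measure (Fin n → ℝ)} [IsProbabilityMeasure ν] {r : ℝ} (g : Reg2 ν k r) {m : ℝ} (hm : 0 < m) (hmk : m ≤ k / 10^6) :
    ∫⁻ y in {y | y ⬝ᵥ y ≤ exp (-56)}, ENNReal.ofReal ((y ⬝ᵥ y) ^ (-m/2)) ∂ν ≤ ENNReal.ofReal (2 * exp (-k)) := by
  have hk := g.kbig
  have hL : 0 < log 2 := Real.log_pos (by norm_num)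
  have hL1 : log 2 < 1 := by have := Real.log_two_lt_d9; linarith
  have h2e : (2:ℝ) = exp (log 2) := (Real.exp_log (by norm_num)).symm
  have hhalf : ∀ j : ℕ, (1/2:ℝ)^j = exp (-(log 2 * j)) := by
    intro j
    rw [Real.exp_neg, mul_comm, Real.exp_nat_mul, Real.exp_log (by norm_num), one_div, inv_pow]
  have hq : ∀ j : ℕ, (1/4:ℝ)^j = exp (-(2 * log 2 * j)) := by
    intro j
    rw [show (1/4:ℝ) = (1/2)^2 by norm_num, ← pow_mul, hhalf]; congr 1; push_cast; ring
  set c : ℕ → ℝ := fun j => exp ((28 + log 2 * (j+1)) * m) with hc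
  have pw : ∀ y ∈ {y : Fin n → ℝ | y ⬝ᵥ y ≤ exp (-56)}, ENNReal.ofReal ((y ⬝ᵥ y) ^ (-m/2)) ≤ 
      ∑' j : ℕ, {y : Fin n → ℝ | y ⬝ᵥ y ≤ (exp (-28) * (1/2)^j)^2}.indicator (fun _ => ENNReal.ofReal (c j)) y := by
    intro y hy
    have hy : y ⬝ᵥ y ≤ exp (-56) := hy
    rcases (dot_self_nonneg y).lt_or_eq with h0 | h0
    swap
    · rw [← h0, Real.zero_rpow (by linarith)]; simp
    obtain ⟨j, hj1, hj2⟩ := exists_nat_pow_near_of_lt_one (x := (y ⬝ᵥ y) / exp (-56)) (y := (1/4:ℝ)) (by positivity) 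
      (by rw [div_le_one (exp_pos _)]; exact hy) (by norm_num) (by norm_num)
    refine le_trans ?_ (ENNReal.le_tsum j)
    rw [lt_div_iff₀ (exp_pos _)] at hj1
    rw [div_le_iff₀ (exp_pos _)] at hj2
    have e : (exp (-28) * (1/2:ℝ)^j)^2 = (1/4)^j * exp (-56) := by
      rw [hhalf, hq, ← Real.exp_add, ← Real.exp_add, ← Real.exp_nat_mul]; congr 1; push_cast; ring
    rw [Set.indicator_of_mem (by show y ⬝ᵥ y ≤ _; rw [e]; exact hj2)]
    apply ENNReal.ofReal_le_ofReal
    refine le_trans (Real.rpow_le_rpow_of_nonpos (by positivity) hj1.le (by linarith)) ?_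
    rw [hq, ← Real.exp_add, ← Real.exp_mul, hc]
    apply le_of_eq; simp only; congr 1; push_cast; ring
  have hmS : ∀ u : ℝ, MeasurableSet {y : Fin n → ℝ | y ⬝ᵥ y ≤ u} := fun u => ms_le u
  calc _ ≤ ∫⁻ y in {y | y ⬝ᵥ y ≤ exp (-56)}, ∑' j : ℕ, {y : Fin n → ℝ | y ⬝ᵥ y ≤ (exp (-28) * (1/2)^j)^2}.indicator (fun _ => ENNReal.ofReal (c j)) y ∂ν :=
        setLIntegral_mono' (hmS _) pw
    _ ≤ ∫⁻ y, ∑' j : ℕ, {y : Fin n → ℝ | y ⬝ᵥ y ≤ (exp (-28) * (1/2)^j)^2}.indicator (fun _ => ENNReal.ofReal (c j)) y ∂ν := setLIntegral_le_lintegral _ _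
    _ = ∑' j : ℕ, ENNReal.ofReal (c j) * ν {y : Fin n → ℝ | y ⬝ᵥ y ≤ (exp (-28) * (1/2)^j)^2} := by
        rw [lintegral_tsum (fun j => (measurable_const.indicator (hmS _)).aemeasurable)]
        congr 1; ext j
        rw [lintegral_indicator (hmS _)]; simp
    _ ≤ ∑' j : ℕ, ENNReal.ofReal (exp (-k) * (1/2)^j) := by
        refine ENNReal.tsum_le_tsum fun j => ?_
        have h1 : (1/2:ℝ)^j ≤ 1 := pow_le_one₀ (by norm_num) (by norm_num)
        have h28 : exp (-28) ≤ 1/10 := by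
          have := exp_neg_le (x := 28) (c := 20) (by norm_num) (by norm_num)
          linarith
        have h2 := small_ball g (δ := exp (-28) * (1/2)^j) (by positivity) (by nlinarith [exp_pos (-28)])
        refine (mul_le_mul' le_rfl h2).trans ?_
        rw [← ENNReal.ofReal_mul (by positivity)]
        apply ENNReal.ofReal_le_ofReal
        rw [hhalf, hc, ← Real.exp_add, ← Real.exp_add, ← Real.exp_nat_mul, ← Real.exp_add, ← Real.exp_add, Real.exp_le_exp]
        have hj : (0:ℝ) ≤ log 2 * j := by positivity
        have hkm : log 2 * j * (m + 1 - k) ≤ 0 := mul_nonpos_of_nonneg_of_nonpos hj (by linarith)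
        have : log 2 * m ≤ 1 * m := by gcongr
        nlinarith
    _ = ENNReal.ofReal (2 * exp (-k)) := by
        rw [← ENNReal.ofReal_tsum_of_nonneg (fun j => by positivity) ((summable_geometric_of_lt_one (by norm_num) (by norm_num)).mul_left _), tsum_mul_left, 
          tsum_geometric_of_lt_one (by norm_num) (by norm_num)]
        congr 1; norm_num; ring

lemma neg_mom {n k : ℕ} {ν : Measure (Fin n → ℝ)} [IsProbabilityMeasure ν] {r : ℝ} (g : Reg2 ν k r) {p : ℝ} (hp : 1 ≤ p) (hpk : p ≤ k / 10^6) :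
    ∫⁻ y, ENNReal.ofReal ((y ⬝ᵥ y) ^ (-p/2)) ∂ν ≤ 
      ENNReal.ofReal (35 * exp (18 * p ^ 2 / (k - 1) + 8 * AA * exp AA * k * r)) := by
  have hk := g.kbig
  have h1 := g.neg_mom1 hp (by linarith)
  have h2 := tiny_mom g (m := p) (by linarith) hpk
  have h3 : ∫⁻ y in {y | y ⬝ᵥ y ≤ 1/4} ∩ {y | exp (-56) < y ⬝ᵥ y}, ENNReal.ofReal ((y ⬝ᵥ y) ^ (-p/2)) ∂ν ≤ ENNReal.ofReal (1/2) := by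
    calc _ ≤ ∫⁻ y in {y | y ⬝ᵥ y ≤ 1/4} ∩ {y | exp (-56) < y ⬝ᵥ y}, ENNReal.ofReal (exp (28 * p)) ∂ν := by
          refine setLIntegral_mono' ((ms_le _).inter (ms_lt _)) fun y hy => ?_
          have hy : exp (-56) < y ⬝ᵥ y := hy.2
          apply ENNReal.ofReal_le_ofReal
          refine le_trans (Real.rpow_le_rpow_of_nonpos (exp_pos _) hy.le (by linarith)) ?_
          rw [← Real.exp_mul]; apply le_of_eq; congr 1; ring
      _ ≤ ENNReal.ofReal (exp (28 * p)) * ν {y | y ⬝ᵥ y ≤ 1/4} := by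
          rw [setLIntegral_const]
          exact mul_le_mul' le_rfl (measure_mono Set.inter_subset_left)
      _ ≤ ENNReal.ofReal (exp (28 * p)) * ENNReal.ofReal (32 * exp (-k/10000)) := mul_le_mul' le_rfl g.small1
      _ ≤ _ := by
          rw [← ENNReal.ofReal_mul (exp_pos _).le]
          apply ENNReal.ofReal_le_ofReal
          rw [mul_left_comm, ← Real.exp_add]
          have e1 : 28 * p + -k/10000 ≤ -8 := by linarith
          have e2 := Real.exp_le_exp.mpr e1
          have e3 : exp (-8) ≤ 1/64 := by
            have := Real.exp_one_gt_d9
            have h5 : (2:ℝ)^8 ≤ exp 1 ^ 8 := by gcongr; linarith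
            rw [← Real.exp_nat_mul] at h5
            rw [Real.exp_neg, inv_le_comm₀ (exp_pos _) (by norm_num)]
            norm_num at h5 ⊢
            linarith
          linarith
  have hcov : (Set.univ : Set (Fin n → ℝ)) ⊆ {y | 1/4 < y ⬝ᵥ y} ∪ (({y | y ⬝ᵥ y ≤ 1/4} ∩ {y | exp (-56) < y ⬝ᵥ y}) ∪ {y | y ⬝ᵥ y ≤ exp (-56)}) := by
    intro y _
    by_cases h1 : 1/4 < y ⬝ᵥ y
    · left; exact h1
    · right
      by_cases h2 : y ⬝ᵥ y ≤ exp (-56)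
      · right; exact h2
      · left; exact ⟨not_lt.mp h1, not_le.mp h2⟩
  rw [← setLIntegral_univ]
  refine (lintegral_mono_set hcov).trans ?_
  refine (lintegral_union_le _ _ _).trans ?_
  refine (add_le_add h1 ((lintegral_union_le _ _ _).trans (add_le_add h3 h2))).trans ?_
  rw [← ENNReal.ofReal_add (by positivity) (by positivity), ← ENNReal.ofReal_add (by positivity) (by positivity)]
  apply ENNReal.ofReal_le_ofReal
  have hE1 : (1:ℝ) ≤ exp (18 * p ^ 2 / (k - 1) + 8 * AA * exp AA * k * r) := by
    apply Real.one_le_exp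
    have h0 : 0 < (k:ℝ) - 1 := by linarith
    have := g.rpos
    have : 0 ≤ AA := by norm_num [AA]
    positivity
  have e : exp (-(k:ℝ)) ≤ 1/4 := by
    have := Real.add_one_le_exp (k:ℝ)
    rw [Real.exp_neg, inv_le_comm₀ (exp_pos _) (by norm_num)]; norm_num; linarith
  linarith
end GM

namespace GM
set_option linter.all false

def e0 : ℝ := 1 / (10 ^ 7 * (AA * exp AA) * (AB * exp AB))
def KK : ℝ := 2 * (4 + 64 + 256 * AA * exp AA)
lemma e0_pos : 0 < e0 := by unfold e0 AA AB; positivity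
lemma KK_pos : 0 < KK := by unfold KK AA; positivity

lemma AAx : 1 ≤ AA * exp AA := by
  have : (1:ℝ) ≤ exp AA := Real.one_le_exp (by norm_num [AA])
  have h : (1:ℝ) ≤ AA := by norm_num [AA]
  nlinarith
lemma ABx : 1 ≤ AB * exp AB := by
  have : (1:ℝ) ≤ exp AB := Real.one_le_exp (by norm_num [AB])
  have h : (1:ℝ) ≤ AB := by norm_num [AB]
  nlinarith
lemma e0_1 : e0 ≤ 1 / 10 ^ 7 := by
  unfold e0
  have h1 := AAx
  have h2 := ABx
  apply one_div_le_one_div_of_le (by norm_num)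
  have : 1 ≤ (AA * exp AA) * (AB * exp AB) := one_le_mul_of_one_le_of_one_le h1 h2
  nlinarith
lemma e0_2 : AA * exp AA * e0 ≤ 1 / 10 ^ 7 := by
  have h1 := AAx
  have h2 := ABx
  have : AA * exp AA * e0 = 1 / (10 ^ 7 * (AB * exp AB)) := by
    have h3 : AA ≠ 0 := by norm_num [AA]
    unfold e0; field_simp
  rw [this]
  apply one_div_le_one_div_of_le (by norm_num); linarith
lemma e0_3 : AB * exp AB * e0 ≤ 1 / 10 ^ 7 := by
  have h1 := AAx
  have h2 := ABx
  have : AB * exp AB * e0 = 1 / (10 ^ 7 * (AA * exp AA)) := by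
    have h3 : AB ≠ 0 := by norm_num [AB]
    unfold e0; field_simp
  rw [this]
  apply one_div_le_one_div_of_le (by norm_num); linarith

lemma params {α N P : ℝ} (ha : 1 ≤ α) (ha2 : α ≤ 2) (hN : 0 < N) (h1 : 4 * N ^ (α / (2 * (α + 2))) ≤ P)
    (h2 : P ≤ e0 ^ 3 * N ^ (α / 2)) {ε : ℝ} (hε : ε = (P / N ^ (α / 2)) ^ (1 / (α + 1))) :
    0 < ε ∧ ε ≤ e0 ∧ 4 ≤ P ∧ 1 ≤ P * ε ∧ ∃ k : ℕ, P ≤ k * ε ∧ 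
      (2 * k : ℝ) ^ (2 / α) / N ≤ 16 * ε ^ 2 ∧ k * ((2 * k : ℝ) ^ (2 / α) / N) ≤ 32 * (P * ε) := by
  have he := e0_pos
  have he1 := e0_1
  have hM : 0 < N ^ (α / 2) := Real.rpow_pos_of_pos hN _
  have hMa : 0 < N ^ (α / (2 * (α + 2))) := Real.rpow_pos_of_pos hN _
  have hP0 : 0 < P := by linarith
  have hx0 : 0 < P / N ^ (α / 2) := by positivity
  have hε0 : 0 < ε := by rw [hε]; positivity
  have hpow : ε ^ (α + 1) = P / N ^ (α / 2) := by
    rw [hε, ← Real.rpow_mul hx0.le, one_div_mul_cancel (by linarith), Real.rpow_one]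
  have hle : ε ≤ e0 := by
    have : ε ^ (α + 1) ≤ e0 ^ (α + 1) := by
      rw [hpow]
      calc P / N ^ (α / 2) ≤ e0 ^ (3:ℕ) := by rw [div_le_iff₀ hM]; exact h2
        _ = e0 ^ (3:ℝ) := by rw [← Real.rpow_natCast]; norm_num
        _ ≤ _ := Real.rpow_le_rpow_of_exponent_ge he (by linarith) (by linarith)
    exact (Real.rpow_le_rpow_iff hε0.le he.le (by linarith)).mp this
  have hN1 : 1 ≤ N := by
    by_contra! hlt
    have : N ^ (α / 2) ≤ N ^ (α / (2 * (α + 2))) := by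
      apply Real.rpow_le_rpow_of_exponent_ge hN hlt.le
      rw [div_le_div_iff₀ (by positivity) (by positivity)]
      nlinarith
    have h3 : e0 ^ 3 ≤ 1 := pow_le_one₀ he.le (by linarith)
    nlinarith
  have hP4 : 4 ≤ P := by
    have : 1 ≤ N ^ (α / (2 * (α + 2))) := Real.one_le_rpow hN1 (by positivity)
    linarith
  have hPε : 1 ≤ P * ε := by
    have h3 : 1 ≤ (P * ε) ^ (α + 1) := by
      rw [Real.mul_rpow hP0.le hε0.le, hpow, mul_div_assoc', le_div_iff₀ hM, one_mul]
      have h4 : N ^ (α / 2) = (N ^ (α / (2 * (α + 2)))) ^ (α + 2) := by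
        rw [← Real.rpow_mul hN.le]; congr 1; field_simp
      have h5 : P ^ (α + 1) * P = P ^ (α + 2) := by
        rw [← Real.rpow_add_one hP0.ne']; congr 1; ring
      rw [h4, h5]
      apply Real.rpow_le_rpow hMa.le (by linarith) (by linarith)
    by_contra! h
    have := Real.rpow_lt_one (by positivity) h (show 0 < α + 1 by linarith)
    linarith
  refine ⟨hε0, hle, hP4, hPε, ⌈P / ε⌉₊, ?_, ?_⟩
  · rw [← div_le_iff₀ hε0]; exact Nat.le_ceil _
  set κ := P / ε with hκ
  have hκ0 : 0 < κ := by positivity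
  have hκ1 : 1 ≤ κ := by rw [hκ, le_div_iff₀ hε0]; linarith
  have hk2 : (⌈κ⌉₊ : ℝ) ≤ 2 * κ := by have := (Nat.ceil_lt_add_one hκ0.le).le; linarith
  have hκp : κ = (ε ^ 2 * N) ^ (α / 2) := by
    rw [Real.mul_rpow (by positivity) hN.le, ← Real.rpow_natCast, ← Real.rpow_mul hε0.le]
    have : ε ^ (α + 1) = ε ^ α * ε := Real.rpow_add_one hε0.ne' _
    rw [this] at hpow
    rw [hκ, show ((2:ℕ):ℝ) * (α / 2) = α by push_cast; ring, div_eq_iff hε0.ne']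
    field_simp at hpow
    linarith
  have hr : (2 * ⌈κ⌉₊ : ℝ) ^ (2 / α) / N ≤ 16 * ε ^ 2 := by
    rw [div_le_iff₀ hN]
    calc (2 * ⌈κ⌉₊ : ℝ) ^ (2 / α) ≤ (4 * κ) ^ (2 / α) := by
          apply Real.rpow_le_rpow (by positivity) (by linarith) (by positivity)
      _ = 4 ^ (2 / α) * κ ^ (2 / α) := Real.mul_rpow (by norm_num) hκ0.le
      _ ≤ 4 ^ (2:ℝ) * κ ^ (2 / α) := by
          gcongr
          · norm_num
          · rw [div_le_iff₀ (by linarith)]; linarith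
      _ = 16 * (ε ^ 2 * N) := by
          rw [hκp, ← Real.rpow_mul (by positivity), show α / 2 * (2 / α) = 1 by field_simp, Real.rpow_one]; norm_num
      _ = _ := by ring
  refine ⟨hr, ?_⟩
  calc (⌈κ⌉₊:ℝ) * ((2 * ⌈κ⌉₊ : ℝ) ^ (2 / α) / N) ≤ (2 * κ) * (16 * ε ^ 2) := by
        apply mul_le_mul hk2 hr (by positivity) (by positivity)
    _ = 32 * (P * ε) := by rw [hκ]; field_simp; ring

lemma rsm_ok {ε r : ℝ} (h0 : 0 < ε) (h1 : ε ≤ e0) (hr : r ≤ 16 * ε ^ 2) : 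
    8 * AA * exp AA * r ≤ 1 / 10 ^ 5 ∧ 4 * AB * exp AB * (2 * 200 * r) ≤ 1 := by
  have hA := AAx
  have hB := ABx
  have a1 := e0_1
  have a2 := e0_2
  have a3 := e0_3
  have b1 : r ≤ e0 := by nlinarith [e0_pos]
  constructor
  · have := mul_le_mul_of_nonneg_left b1 (show 0 ≤ AA * exp AA by linarith)
    linarith
  · have := mul_le_mul_of_nonneg_left b1 (show 0 ≤ AB * exp AB by linarith)
    linarith

lemma log35 {M E : ℝ} (hM1 : 1 ≤ M) (hM : M ≤ 35 * exp E) : log M ≤ 4 + E := by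
  rw [Real.log_le_iff_le_exp (by linarith), Real.exp_add]
  refine hM.trans ?_
  gcongr
  have := Real.exp_one_gt_d9
  have h5 : (2.7:ℝ)^4 ≤ exp 1 ^ 4 := by gcongr; linarith
  rw [← Real.exp_nat_mul] at h5
  norm_num at h5 ⊢
  linarith

lemma fin_pos {P ε p M r : ℝ} {k : ℕ} (hε : 0 < ε) (hε1 : ε ≤ e0) (hP : 4 ≤ P) (hPε : 1 ≤ P * ε) (hk : P ≤ k * ε) 
    (hkr : k * r ≤ 32 * (P * ε)) (hp : p = 2 + P) (hM1 : 1 ≤ M) 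
    (hM : M ≤ 33 * exp (8 * p ^ 2 / (k - 1) + 8 * AA * exp AA * k * r)) :
    1 - KK * exp KK * ε ≤ M ^ (1/p) ∧ M ^ (1/p) ≤ 1 + KK * exp KK * ε := by
  have a1 := e0_1
  have hK := KK_pos
  have hA := AAx
  have hp0 : 0 < p := by linarith
  have hk0 : P / ε ≤ k := by rwa [div_le_iff₀ hε]
  have hk2 : 2 ≤ (k:ℝ) := by
    refine le_trans ?_ hk0
    rw [le_div_iff₀ hε]; linarith
  constructor
  · have : 1 ≤ M ^ (1/p) := Real.one_le_rpow hM1 (by positivity)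
    have : 0 ≤ KK * exp KK * ε := by positivity
    linarith
  · have hl := log35 hM1 (hM.trans (mul_le_mul_of_nonneg_right (by norm_num) (exp_pos _).le))
    have b1 : 8 * p ^ 2 / (k - 1) ≤ 64 * (P * ε) := by
      rw [div_le_iff₀ (by linarith)]
      have c1 : p ^ 2 ≤ 4 * P ^ 2 - 0 := by rw [hp]; nlinarith
      have c2 : P ^ 2 ≤ P * (k * ε) := by rw [sq]; gcongr
      have c3 : (k:ℝ) / 2 ≤ k - 1 := by linarith
      have c4 : 64 * (P * ε) * (k / 2) ≤ 64 * (P * ε) * (k - 1) := by gcongr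
      linarith
    have b2 : 8 * AA * exp AA * k * r ≤ 256 * AA * exp AA * (P * ε) := by
      have := mul_le_mul_of_nonneg_left hkr (show 0 ≤ AA * exp AA by linarith)
      linarith
    have hlK : log M ≤ KK * ε * p := by
      have h0 : 0 ≤ (4 + 64 + 256 * AA * exp AA) := by linarith
      have h1 : P * ε ≤ 2 * (ε * p) := by rw [hp]; nlinarith
      have := mul_le_mul_of_nonneg_left h1 h0
      unfold KK
      linarith
    have h3 : M ^ (1/p) ≤ exp (KK * ε) := by
      rw [Real.rpow_def_of_pos (by linarith), Real.exp_le_exp, mul_one_div, div_le_iff₀ hp0]; exact hlK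
    refine h3.trans ?_
    have h4 : exp (KK * ε) ≤ 1 + KK * ε * exp (KK * ε) := by
      have := Real.add_one_le_exp (-(KK * ε))
      rw [Real.exp_neg] at this
      have h5 := mul_le_mul_of_nonneg_right this (exp_pos (KK * ε)).le
      rw [inv_mul_cancel₀ (exp_pos _).ne'] at h5
      linarith
    have h5 : exp (KK * ε) ≤ exp KK := by rw [Real.exp_le_exp]; nlinarith
    have : KK * ε * exp (KK * ε) ≤ KK * ε * exp KK := by gcongr
    linarith

lemma fin_neg {P ε p M r : ℝ} {k : ℕ} (hε : 0 < ε) (hε1 : ε ≤ e0) (hP : 4 ≤ P) (hPε : 1 ≤ P * ε) (hk : P ≤ k * ε) 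
    (hkr : k * r ≤ 32 * (P * ε)) (hp : p = 2 - P) (hM1 : 1 ≤ M) 
    (hM : M ≤ 35 * exp (18 * (-p) ^ 2 / (k - 1) + 8 * AA * exp AA * k * r)) :
    1 - KK * exp KK * ε ≤ M ^ (1/p) ∧ M ^ (1/p) ≤ 1 + KK * exp KK * ε := by
  have a1 := e0_1
  have hK := KK_pos
  have hA := AAx
  have hp0 : p < 0 := by linarith
  have hk0 : P / ε ≤ k := by rwa [div_le_iff₀ hε]
  have hk2 : 2 ≤ (k:ℝ) := by
    refine le_trans ?_ hk0
    rw [le_div_iff₀ hε]; linarith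
  constructor
  · have hl := log35 hM1 hM
    have b1 : 18 * (-p) ^ 2 / (k - 1) ≤ 36 * (P * ε) := by
      rw [div_le_iff₀ (by linarith)]
      have c1 : (-p) ^ 2 ≤ P ^ 2 := by rw [hp]; nlinarith
      have c2 : P ^ 2 ≤ P * (k * ε) := by rw [sq]; gcongr
      have c3 : (k:ℝ) / 2 ≤ k - 1 := by linarith
      have c4 : 36 * (P * ε) * (k / 2) ≤ 36 * (P * ε) * (k - 1) := by gcongr
      linarith
    have b2 : 8 * AA * exp AA * k * r ≤ 256 * AA * exp AA * (P * ε) := by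
      have := mul_le_mul_of_nonneg_left hkr (show 0 ≤ AA * exp AA by linarith)
      linarith
    have hlK : log M ≤ KK * ε * (-p) := by
      have h0 : 0 ≤ (4 + 64 + 256 * AA * exp AA) := by linarith
      have h1 : P * ε ≤ 2 * (ε * (-p)) := by rw [hp]; nlinarith
      have := mul_le_mul_of_nonneg_left h1 h0
      unfold KK
      linarith
    have h3 : exp (-(KK * ε)) ≤ M ^ (1/p) := by
      rw [Real.rpow_def_of_pos (by linarith), Real.exp_le_exp, mul_one_div, le_div_iff_of_neg hp0]; linarith
    refine le_trans ?_ h3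
    have := Real.add_one_le_exp (-(KK * ε))
    have h5 : 1 ≤ exp KK := Real.one_le_exp hK.le
    have : KK * ε * 1 ≤ KK * ε * exp KK := by gcongr
    linarith
  · have : M ^ (1/p) ≤ 1 := Real.rpow_le_one_of_one_le_of_nonpos hM1 (by rw [one_div]; exact (inv_neg''.mpr hp0).le)
    have : 0 ≤ KK * exp KK * ε := by positivity
    linarith
end GM

namespace GM
set_option linter.all false

lemma tailN {n : ℕ} {ν : Measure (Fin n → ℝ)} (hν : PLM ν (fun _ _ => 1)) 
    (h34 : ENNReal.ofReal (3/4) ≤ ν {y | y ⬝ᵥ y ≤ 4}) (hM : ∀ u : ℝ, 0 < u → ν {y | u < y ⬝ᵥ y} ≤ ENNReal.ofReal (1/u)) (N : ℕ) : 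
    ∃ C u1 : ℝ, 0 < C ∧ 4 ≤ u1 ∧ ∀ u, u1 ≤ u → ν {y | u < y ⬝ᵥ y} ≤ ENNReal.ofReal (C * (1/u) ^ (2 ^ N)) := by
  induction N with
  | zero => 
    refine ⟨1, 4, one_pos, le_refl _, fun u hu => ?_⟩
    simpa using hM u (by linarith)
  | succ N ih =>
    obtain ⟨C, u1, hC, hu1, h⟩ := ih
    refine ⟨2 * C ^ 2 * 9 ^ (2 ^ (N+1)), 9 * u1, by positivity, by linarith, fun u hu => ?_⟩
    have h1 := borell_step hν (u0 := 4) (u := u / 9) (by norm_num) (by linarith) h34 (a := C * (1/(u/9)) ^ (2 ^ N)) 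
      (by have : 0 < u := by linarith
          positivity) (h (u/9) (by linarith))
    rw [show u / 9 * 9 = u by ring] at h1
    refine h1.trans (ENNReal.ofReal_le_ofReal (le_of_eq ?_))
    have : 1 / (u/9) = 9 * (1/u) := by field_simp
    rw [this, mul_pow, ← pow_mul, ← pow_succ, mul_pow]
    ring

lemma int_all {n : ℕ} {ν : Measure (Fin n → ℝ)} [IsProbabilityMeasure ν] (hν : PLM ν (fun _ _ => 1)) 
    (h2 : ∫⁻ y, ENNReal.ofReal (y ⬝ᵥ y) ∂ν = 1) (m : ℕ) : Integrable (fun y => (y ⬝ᵥ y) ^ m) ν := by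
  have hM : ∀ u : ℝ, 0 < u → ν {y | u < y ⬝ᵥ y} ≤ ENNReal.ofReal (1/u) := by
    intro u hu
    have h := mul_meas_ge_le_lintegral (μ := ν) (f := fun y : Fin n → ℝ => ENNReal.ofReal (y ⬝ᵥ y)) (by fun_prop) (ENNReal.ofReal u)
    rw [h2] at h
    have h2 : ν {y | u < y ⬝ᵥ y} ≤ ν {y | ENNReal.ofReal u ≤ ENNReal.ofReal (y ⬝ᵥ y)} := 
      measure_mono fun y hy => ENNReal.ofReal_le_ofReal (le_of_lt hy)
    rw [one_div, ENNReal.ofReal_inv_of_pos hu, ENNReal.le_inv_iff_mul_le, mul_comm]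
    exact (mul_le_mul' le_rfl h2).trans h
  have h34 : ENNReal.ofReal (3/4) ≤ ν {y | y ⬝ᵥ y ≤ 4} := by
    have := prob_le (by norm_num) (hM 4 (by norm_num))
    norm_num at this ⊢
    exact this
  obtain ⟨C, u1, hC, hu1, h⟩ := tailN hν h34 hM (m + 1)
  set u : ℝ := max u1 (4 * 9 ^ m * C) with hu
  have hu4 : 4 ≤ u := hu1.trans (le_max_left _ _)
  have huC : 4 * 9 ^ m * C ≤ u := le_max_right _ _
  have hu0 : 0 < u := by linarith
  have h9 : (1:ℝ) ≤ 9 ^ m := one_le_pow₀ (by norm_num)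
  have hle1 : (1/u) ^ (2 ^ (m+1)) ≤ (1/u) ^ (m+1) := 
    pow_le_pow_of_le_one (by positivity) (by rw [div_le_one hu0]; linarith) Nat.lt_two_pow_self.le
  have hle2 : (1/u) ^ (m+1) ≤ 1/u := by
    refine (pow_le_pow_of_le_one (n := m+1) (m := 1) (by positivity) (by rw [div_le_one hu0]; linarith) (by omega)).trans (by simp)
  have hfin : ∫⁻ y in {y | u < y ⬝ᵥ y}, ENNReal.ofReal ((y ⬝ᵥ y) ^ (m:ℝ)) ∂ν ≤ ENNReal.ofReal (1/2) := by
    refine borell_int hν (u0 := 4) (by norm_num) hu4 (by linarith) h34 (a := C * (1/u) ^ (2 ^ (m+1))) (by positivity) ?_ 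
      (h u (le_max_left _ _)) (by positivity) ?_ le_rfl
    · have : C * (1/u) ≤ 1/4 := by rw [mul_one_div, div_le_iff₀ hu0]; nlinarith
      have : C * (1/u) ^ (2 ^ (m+1)) ≤ C * (1/u) := by gcongr; exact hle1.trans hle2
      linarith
    · rw [Real.rpow_natCast]
      calc (9 * u) ^ m * (2 * (C * (1/u) ^ (2 ^ (m+1)))) ≤ (9 * u) ^ m * (2 * (C * (1/u) ^ (m+1))) := by gcongr
        _ = 2 * 9 ^ m * C / u := by rw [mul_pow, pow_succ, one_div, inv_pow]; field_simp
        _ ≤ _ := by rw [div_le_iff₀ hu0]; linarith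
  refine ⟨by fun_prop, ?_⟩
  rw [hasFiniteIntegral_iff_ofReal (Filter.Eventually.of_forall fun y => pow_nonneg (dot_self_nonneg y) m)]
  simp only [Real.rpow_natCast] at hfin
  rw [← lintegral_add_compl _ (ms_lt u)]
  refine ENNReal.add_lt_top.mpr ⟨hfin.trans_lt ENNReal.ofReal_lt_top, ?_⟩
  calc _ ≤ ∫⁻ y in {y | u < y ⬝ᵥ y}ᶜ, ENNReal.ofReal (u ^ m) ∂ν := by
        refine setLIntegral_mono' (ms_lt u).compl fun y hy => ?_
        have hy : ¬ (u < y ⬝ᵥ y) := hy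
        exact ENNReal.ofReal_le_ofReal (pow_le_pow_left₀ (dot_self_nonneg y) (not_lt.mp hy) m)
    _ ≤ ∫⁻ y, ENNReal.ofReal (u ^ m) ∂ν := setLIntegral_le_lintegral _ _
    _ < ⊤ := by simp

lemma M_bounds {n k : ℕ} {ν : Measure (Fin n → ℝ)} [IsProbabilityMeasure ν] {r : ℝ} (g : Reg2 ν k r) {s B : ℝ} (hs : s ≤ 0 ∨ 1 ≤ s) (hB : 0 ≤ B)
    (h : ∫⁻ y, ENNReal.ofReal ((y ⬝ᵥ y) ^ s) ∂ν ≤ ENNReal.ofReal B) : 1 ≤ ∫ y, (y ⬝ᵥ y) ^ s ∂ν ∧ ∫ y, (y ⬝ᵥ y) ^ s ∂ν ≤ B := by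
  have hnn : ∀ y : Fin n → ℝ, 0 ≤ (y ⬝ᵥ y) ^ s := fun y => Real.rpow_nonneg (dot_self_nonneg y) _
  have hmeas : Measurable (fun y : Fin n → ℝ => (y ⬝ᵥ y) ^ s) := by fun_prop
  have hintg : Integrable (fun y => (y ⬝ᵥ y) ^ s) ν := by
    refine ⟨hmeas.aestronglyMeasurable, ?_⟩
    rw [hasFiniteIntegral_iff_ofReal (Filter.Eventually.of_forall hnn)]
    exact h.trans_lt ENNReal.ofReal_lt_top
  have hint1 : Integrable (fun y => y ⬝ᵥ y) ν := by simpa using g.int 1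
  have hs1 : Integrable (fun y : Fin n → ℝ => s * (y ⬝ᵥ y - 1)) ν := (hint1.sub (integrable_const 1)).const_mul s
  constructor
  · have h1 : ∫ y, (1 + s * (y ⬝ᵥ y - 1)) ∂ν = 1 := by
      rw [integral_add (integrable_const _) hs1, integral_const_mul, 
        integral_sub hint1 (integrable_const _), g.m2]
      simp
    rw [← h1]
    refine integral_mono_ae ((integrable_const _).add hs1) hintg ?_
    have h0 := zero_null g
    have : ∀ᵐ y ∂ν, 0 < y ⬝ᵥ y := by
      rw [ae_iff]; simpa using h0
    filter_upwards [this] with y hy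
    exact bern hy hs
  · rw [integral_eq_lintegral_of_nonneg_ae (Filter.Eventually.of_forall hnn) hmeas.aestronglyMeasurable]
    exact ENNReal.toReal_le_of_le_ofReal hB h

lemma core {n : ℕ} {ν : Measure (Fin n → ℝ)} [IsProbabilityMeasure ν] {α N p : ℝ} (ha : 1 ≤ α) (ha2 : α ≤ 2) (hN : 0 < N)
    (hG : ∀ k : ℕ, 1 ≤ k → Good ν k ((2 * k : ℝ) ^ (2 / α) / N))
    (h1 : 4 * N ^ (α / (2 * (α + 2))) ≤ |p - 2|) (h2 : |p - 2| ≤ e0 ^ 3 * N ^ (α / 2)) :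
    1 - KK * exp KK * (|p - 2| / N ^ (α / 2)) ^ (1 / (α + 1)) ≤ (∫ y, (y ⬝ᵥ y) ^ (p/2) ∂ν) ^ (1/p) ∧
    (∫ y, (y ⬝ᵥ y) ^ (p/2) ∂ν) ^ (1/p) ≤ 1 + KK * exp KK * (|p - 2| / N ^ (α / 2)) ^ (1 / (α + 1)) := by
  set P := |p - 2| with hP
  set ε := (P / N ^ (α / 2)) ^ (1 / (α + 1)) with hε
  obtain ⟨he, hee, hP4, hPe, k, hk, hr, hkr⟩ := params ha ha2 hN h1 h2 hε
  have a1 := e0_1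
  have hkbig : 10 ^ 6 * P ≤ k / 4 := by
    have : P / ε ≤ k := by rwa [div_le_iff₀ he]
    have : 4 * (10 ^ 6 * P) ≤ P / ε := by rw [le_div_iff₀ he]; nlinarith
    linarith
  have hk1 : 1 ≤ k := by
    have : (1:ℝ) ≤ k := by linarith
    exact_mod_cast this
  obtain ⟨r1, r2⟩ := rsm_ok he hee hr
  have g : Reg2 ν k ((2 * k : ℝ) ^ (2 / α) / N) := { hG k hk1 with kbig := by linarith, rsm := r1, rsm2 := r2 }
  have hAA : 0 ≤ AA := by norm_num [AA]
  rcases le_total 0 (p - 2) with hp | hp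
  · rw [abs_of_nonneg hp] at hP
    have hh := g.pos_mom (p := p) (by linarith) (by linarith)
    obtain ⟨m1, m2⟩ := M_bounds g (s := p/2) (Or.inr (by linarith)) (by positivity) hh
    exact fin_pos he hee hP4 hPe hk hkr (by linarith) m1 m2
  · rw [abs_of_nonpos hp] at hP
    have hh := neg_mom g (p := -p) (by linarith) (by linarith)
    rw [neg_neg] at hh
    obtain ⟨m1, m2⟩ := M_bounds g (s := p/2) (Or.inl (by linarith)) (by positivity) hh
    exact fin_neg he hee hP4 hPe hk hkr (by linarith) m1 m2
end GM

namespace GM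
set_option linter.all false

lemma lc_convex {n : ℕ} {f : EuclideanSpace ℝ (Fin n) → ℝ} (hf : IsLogConcaveFn f) (t : ℝ) :
    Convex ℝ (f ⁻¹' Set.Ioi t) := by
  intro x hx y hy a c ha hc hac
  have hx : t < f x := hx
  have hy : t < f y := hy
  show t < f (a • x + c • y)
  rcases lt_or_ge t 0 with h | h
  · exact h.trans_le (hf.1 _)
  have hm : t < min (f x) (f y) := lt_min hx hy
  have hm0 : 0 < min (f x) (f y) := h.trans_lt hm
  have e : c = 1 - a := by linarith
  have h1 := hf.2 x y a ha (by linarith)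
  rw [← e] at h1
  refine hm.trans_le (le_trans ?_ h1)
  calc min (f x) (f y) = min (f x) (f y) ^ a * min (f x) (f y) ^ c := by
        rw [← Real.rpow_add hm0, hac, Real.rpow_one]
    _ ≤ _ := by
        refine mul_le_mul (Real.rpow_le_rpow hm0.le ?_ ha) (Real.rpow_le_rpow hm0.le ?_ hc) (by positivity) (Real.rpow_nonneg (hf.1 _) _)
        exacts [min_le_left _ _, min_le_right _ _]

lemma lc_aemeas {n : ℕ} {f : EuclideanSpace ℝ (Fin n) → ℝ} (hf : IsLogConcaveFn f) :
    AEMeasurable f volume := by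
  have : NullMeasurable f (volume : Measure (EuclideanSpace ℝ (Fin n))) := by
    have h := @measurable_of_Ioi ℝ (NullMeasurableSpace (EuclideanSpace ℝ (Fin n)) volume) _ _ _ _ _ _ _ f
      (fun t => (lc_convex hf t).nullMeasurableSet volume)
    exact fun s hs => h hs
  exact this.aemeasurable

lemma lc_plm {n : ℕ} {f : EuclideanSpace ℝ (Fin n) → ℝ} (hf : IsLogConcaveFn f) :
    PLM (volume.withDensity fun x => ENNReal.ofReal (f x)) (fun _ _ => 1) := by
  refine plm_withDensity (plm_euclid n) (lc_aemeas hf).ennreal_ofReal ?_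
  intro x y
  have h := hf.2 x y (1/2) (by norm_num) (by norm_num)
  have e : (1 - 1/2 : ℝ) = 1/2 := by norm_num
  rw [e, ← smul_add] at h
  rw [← ENNReal.ofReal_mul (hf.1 _), ← ENNReal.ofReal_pow (hf.1 _)]
  refine ENNReal.ofReal_le_ofReal ?_
  calc f x * f y = (f x ^ (1/2:ℝ) * f y ^ (1/2:ℝ))^2 := by
        rw [← Real.sqrt_eq_rpow, ← Real.sqrt_eq_rpow, mul_pow, Real.sq_sqrt (hf.1 _), Real.sq_sqrt (hf.1 _)]
    _ ≤ _ := by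
        have h1 := hf.1 x
        have h2 := hf.1 y
        gcongr

def TA {n : ℕ} (A : Matrix (Fin n) (Fin n) ℝ) (x : EuclideanSpace ℝ (Fin n)) : Fin n → ℝ :=
  fun i => (√n)⁻¹ * mApp A x i

lemma mApp_i {n : ℕ} (A : Matrix (Fin n) (Fin n) ℝ) (x : EuclideanSpace ℝ (Fin n)) (i : Fin n) :
    mApp A x i = ∑ j, A i j * x j := by
  simp [mApp, Matrix.toLpLin_apply, Matrix.mulVec, dotProduct]

lemma mApp_row {n : ℕ} (A : Matrix (Fin n) (Fin n) ℝ) (x : EuclideanSpace ℝ (Fin n)) (i : Fin n) :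
    mApp A x i = ⟪x, WithLp.toLp 2 (A i)⟫ := by
  rw [mApp_i, PiLp.inner_apply]
  simp

lemma TA_meas {n : ℕ} (A : Matrix (Fin n) (Fin n) ℝ) : Measurable (TA A) := by
  unfold TA
  simp_rw [mApp_i]
  fun_prop

lemma TA_self {n : ℕ} (A : Matrix (Fin n) (Fin n) ℝ) (x : EuclideanSpace ℝ (Fin n)) :
    TA A x ⬝ᵥ TA A x = ‖mApp A x‖ ^ 2 / n := by
  rw [EuclideanSpace.norm_sq_eq]
  simp only [dotProduct, TA, Real.norm_eq_abs, sq_abs]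
  rw [Finset.sum_div]
  refine Finset.sum_congr rfl fun i _ => ?_
  have : (√(n:ℝ))⁻¹ * (√(n:ℝ))⁻¹ = (n:ℝ)⁻¹ := by
    rw [← mul_inv, Real.mul_self_sqrt (Nat.cast_nonneg _)]
  rw [div_eq_mul_inv, ← this]; ring

lemma mApp_dot {n : ℕ} (A : Matrix (Fin n) (Fin n) ℝ) (x : EuclideanSpace ℝ (Fin n)) (v : Fin n → ℝ) :
    ∑ i, v i * mApp A x i = ⟪x, WithLp.toLp 2 (Matrix.transpose A |>.mulVec v)⟫ := by
  rw [PiLp.inner_apply]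
  simp only [dotProduct, mApp_i, Matrix.mulVec, Matrix.transpose_apply, RCLike.inner_apply, conj_trivial]
  simp_rw [Finset.mul_sum, Finset.sum_mul]
  rw [Finset.sum_comm]
  refine Finset.sum_congr rfl fun i _ => Finset.sum_congr rfl fun j _ => ?_
  ring

lemma TA_v {n : ℕ} (A : Matrix (Fin n) (Fin n) ℝ) (x : EuclideanSpace ℝ (Fin n)) (v : Fin n → ℝ) :
    v ⬝ᵥ TA A x = (√n)⁻¹ * ⟪x, WithLp.toLp 2 (Matrix.transpose A |>.mulVec v)⟫ := by
  rw [← mApp_dot, Finset.mul_sum]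
  simp only [dotProduct, TA]
  refine Finset.sum_congr rfl fun i _ => ?_
  ring

lemma w_le {n : ℕ} (A : Matrix (Fin n) (Fin n) ℝ) (v : Fin n → ℝ) :
    ‖(WithLp.toLp 2 (Matrix.transpose A |>.mulVec v) : EuclideanSpace ℝ (Fin n))‖ ^ 2 ≤ opNorm A ^ 2 * (v ⬝ᵥ v) := by
  set w : EuclideanSpace ℝ (Fin n) := WithLp.toLp 2 (Matrix.transpose A |>.mulVec v) with hw
  set v' : EuclideanSpace ℝ (Fin n) := WithLp.toLp 2 v with hv
  have hvv : v ⬝ᵥ v = ‖v'‖ ^ 2 := by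
    rw [EuclideanSpace.norm_sq_eq]; simp [dotProduct, hv, sq]
  have hop : ‖mApp A w‖ ≤ opNorm A * ‖w‖ := by
    have := (LinearMap.toContinuousLinearMap (Matrix.toEuclideanLin A)).le_opNorm w
    simpa [mApp, opNorm] using this
  have h1 : ‖w‖ ^ 2 = ⟪mApp A w, v'⟫ := by
    rw [← real_inner_self_eq_norm_sq]
    have := mApp_dot A w v
    rw [← hw] at this
    rw [← this, PiLp.inner_apply]
    simp [hv]
  have h2 : ‖w‖ ^ 2 ≤ opNorm A * ‖w‖ * ‖v'‖ := by
    rw [h1]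
    exact (real_inner_le_norm _ _).trans (by gcongr)
  have hop0 : 0 ≤ opNorm A := norm_nonneg _
  have h3 : ‖w‖ ≤ opNorm A * ‖v'‖ := by
    rcases (norm_nonneg w).eq_or_lt with h | h
    · rw [← h]; positivity
    · nlinarith
  rw [hvv, ← mul_pow]
  gcongr

end GM

namespace GM
set_option linter.all false

section
variable {Ω : Type} [MeasurableSpace Ω] {P : Measure Ω} {n : ℕ} {X : Ω → EuclideanSpace ℝ (Fin n)}

lemma iso_sq (h : Isotropic P X) (θ : EuclideanSpace ℝ (Fin n)) : ∫ ω, ⟪X ω, θ⟫ ^ 2 ∂P = ‖θ‖ ^ 2 := by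
  have := h.2 θ θ
  rw [real_inner_self_eq_norm_sq] at this
  rw [← this]
  simp only [sq]

lemma iso_int (h : Isotropic P X) (θ : EuclideanSpace ℝ (Fin n)) : Integrable (fun ω => ⟪X ω, θ⟫ ^ 2) P := by
  rcases eq_or_ne θ 0 with rfl | h0
  · simp
  · by_contra hc
    have := iso_sq h θ
    rw [integral_undef hc] at this
    have : 0 < ‖θ‖ := norm_pos_iff.mpr h0
    nlinarith

lemma norm_row (A : Matrix (Fin n) (Fin n) ℝ) (x : EuclideanSpace ℝ (Fin n)) :
    ‖mApp A x‖ ^ 2 = ∑ i, ⟪x, WithLp.toLp 2 (A i)⟫ ^ 2 := by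
  rw [EuclideanSpace.norm_sq_eq]
  simp only [mApp_row, Real.norm_eq_abs, sq_abs]

lemma hs_int (h : Isotropic P X) (A : Matrix (Fin n) (Fin n) ℝ) : Integrable (fun ω => ‖mApp A (X ω)‖ ^ 2) P := by
  simp_rw [norm_row]
  exact integrable_finset_sum _ fun i _ => iso_int h _

lemma hs_eq (h : Isotropic P X) (A : Matrix (Fin n) (Fin n) ℝ) : ∫ ω, ‖mApp A (X ω)‖ ^ 2 ∂P = hsNorm A ^ 2 := by
  simp_rw [norm_row]
  rw [integral_finset_sum _ fun i _ => iso_int h _]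
  simp_rw [iso_sq h]
  rw [hsNorm, Real.sq_sqrt (by positivity)]
  refine Finset.sum_congr rfl fun i _ => ?_
  rw [EuclideanSpace.norm_sq_eq]; simp

lemma b_pos [IsProbabilityMeasure P] (hn : 1 ≤ n) {α b : ℝ} (h : Isotropic P X) (hp : IsPsiAlpha P X α b) : 0 < b := by
  let θ : EuclideanSpace ℝ (Fin n) := EuclideanSpace.single ⟨0, hn⟩ 1
  have hθ : ‖θ‖ = 1 := by simp [θ]
  have h1 := hp 2 le_rfl θ
  have h2 := iso_sq h θ
  have e : ∫ ω, |⟪X ω, θ⟫| ^ (2:ℝ) ∂P = ∫ ω, ⟪X ω, θ⟫ ^ 2 ∂P := by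
    simp
  rw [e, h2, hθ] at h1
  simp only [one_pow, Real.one_rpow, mul_one] at h1
  by_contra hc
  push Not at hc
  have : 0 < (2:ℝ) ^ (1/α) := by positivity
  nlinarith

lemma op_pos (hn : 1 ≤ n) {A : Matrix (Fin n) (Fin n) ℝ} (hA : hsNorm A ^ 2 = n) : 0 < opNorm A := by
  have h0 : 0 ≤ opNorm A := norm_nonneg _
  refine h0.lt_of_ne' fun h => ?_
  have : Matrix.toEuclideanLin A = 0 := by
    have := norm_eq_zero.mp h
    simpa using this
  have : A = 0 := by simpa using this
  subst this
  have hn0 : (0:ℝ) < n := by exact_mod_cast hn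
  rw [← hA] at hn0
  simp [hsNorm] at hn0

lemma mom_bd {α b : ℝ} (ha : 1 ≤ α) (hb : 0 < b) (h : Isotropic P X) (hp : IsPsiAlpha P X α b) {k : ℕ} (hk : 1 ≤ k)
    (w : EuclideanSpace ℝ (Fin n)) :
    ∫ ω, ⟪X ω, w⟫ ^ (2 * k) ∂P ≤ (b ^ 2 * (2 * k : ℝ) ^ (2 / α) * ‖w‖ ^ 2) ^ k := by
  have hk1 : (1:ℝ) ≤ k := by exact_mod_cast hk
  have h1 := hp (2 * k) (by linarith) w
  have e : ∀ ω, |⟪X ω, w⟫| ^ (2 * k : ℝ) = ⟪X ω, w⟫ ^ (2 * k) := fun ω => by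
    rw [show (2 * k : ℝ) = ((2 * k : ℕ) : ℝ) by push_cast; ring, Real.rpow_natCast, pow_mul, sq_abs, ← pow_mul]
  simp_rw [e] at h1
  rw [iso_sq h] at h1
  rw [← Real.sqrt_eq_rpow, Real.sqrt_sq (norm_nonneg _)] at h1
  set I := ∫ ω, ⟪X ω, w⟫ ^ (2 * k) ∂P with hI
  have hI0 : 0 ≤ I := integral_nonneg fun ω => by
    show 0 ≤ ⟪X ω, w⟫ ^ (2 * k)
    rw [pow_mul]; positivity
  have h2 : I = (I ^ (1 / (2 * k : ℝ))) ^ (2 * k) := by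
    rw [← Real.rpow_natCast, ← Real.rpow_mul hI0]
    push_cast
    rw [one_div, inv_mul_cancel₀ (by positivity), Real.rpow_one]
  rw [h2, pow_mul]
  refine pow_le_pow_left₀ (by positivity) ?_ _
  refine (pow_le_pow_left₀ (by positivity) h1 2).trans (le_of_eq ?_)
  rw [mul_pow, mul_pow]
  congr 2
  rw [← Real.rpow_natCast, ← Real.rpow_mul (by positivity)]
  congr 1
  push_cast; ring

lemma TA_mid (A : Matrix (Fin n) (Fin n) ℝ) (x y : EuclideanSpace ℝ (Fin n)) :
    TA A ((1/2:ℝ) • (x + y)) = (1/2:ℝ) • (TA A x + TA A y) := by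
  ext i
  simp only [Pi.smul_apply, Pi.add_apply, TA, mApp, map_smul, map_add]
  simp
  ring

lemma nu_plm {f : EuclideanSpace ℝ (Fin n) → ℝ} (hd : HasDensityFn P X f) (hf : IsLogConcaveFn f)
    (A : Matrix (Fin n) (Fin n) ℝ) : PLM (P.map fun ω => TA A (X ω)) (fun _ _ => 1) := by
  have : P.map (fun ω => TA A (X ω)) = (P.map X).map (TA A) := (Measure.map_map (TA_meas A) hd.1).symm
  rw [this, hd.2]
  exact PLM.map (TA_meas A) (TA_mid A) (lc_plm hf)

lemma nu_good [IsProbabilityMeasure P] {f : EuclideanSpace ℝ (Fin n) → ℝ} {α b : ℝ} {A : Matrix (Fin n) (Fin n) ℝ} (hn : 1 ≤ n)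
    (hd : HasDensityFn P X f) (hf : IsLogConcaveFn f) (h : Isotropic P X) (ha : 1 ≤ α) 
    (hp : IsPsiAlpha P X α b) (hA : hsNorm A ^ 2 = n) (k : ℕ) (hk : 1 ≤ k) :
    Good (P.map fun ω => TA A (X ω)) k ((2 * k : ℝ) ^ (2 / α) / ((n : ℝ) / (opNorm A ^ 2 * b ^ 2))) := by
  have hb := b_pos hn h hp
  have ho := op_pos hn hA
  have hn0 : (0:ℝ) < n := by exact_mod_cast hn
  have hk0 : (0:ℝ) < k := by exact_mod_cast hk
  have hm : Measurable (fun ω => TA A (X ω)) := (TA_meas A).comp hd.1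
  haveI : IsProbabilityMeasure (P.map fun ω => TA A (X ω)) := Measure.isProbabilityMeasure_map hm.aemeasurable
  have hm2 : ∫ y, y ⬝ᵥ y ∂(P.map fun ω => TA A (X ω)) = 1 := by
    rw [integral_map hm.aemeasurable (by fun_prop)]
    simp_rw [TA_self]
    rw [integral_div, hs_eq h, hA, div_self hn0.ne']
  have hintg : Integrable (fun y : Fin n → ℝ => y ⬝ᵥ y) (P.map fun ω => TA A (X ω)) := by
    by_contra hc
    rw [integral_undef hc] at hm2
    norm_num at hm2
  refine ⟨nu_plm hd hf A, by positivity, hk, ?_, hm2, ?_⟩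
  · refine int_all (nu_plm hd hf A) ?_
    rw [← ofReal_integral_eq_lintegral_ofReal hintg (Filter.Eventually.of_forall fun y => dot_self_nonneg y), hm2]
    simp
  · intro v
    rw [integral_map hm.aemeasurable (by fun_prop)]
    simp_rw [TA_v]
    rw [show (fun ω => ((√(n:ℝ))⁻¹ * ⟪X ω, WithLp.toLp 2 (Matrix.transpose A |>.mulVec v)⟫) ^ (2 * k)) = fun ω => ((√(n:ℝ))⁻¹) ^ (2 * k) * ⟪X ω, WithLp.toLp 2 (Matrix.transpose A |>.mulVec v)⟫ ^ (2 * k) from funext fun ω => mul_pow _ _ _, integral_const_mul]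
    have h1 := mom_bd ha hb h hp hk (WithLp.toLp 2 (Matrix.transpose A |>.mulVec v))
    have h2 := w_le A v
    have e : ((√(n:ℝ))⁻¹) ^ (2 * k) = ((n:ℝ)⁻¹) ^ k := by
      rw [pow_mul, inv_pow, Real.sq_sqrt hn0.le]
    rw [e]
    calc _ ≤ ((n:ℝ)⁻¹) ^ k * (b ^ 2 * (2 * k : ℝ) ^ (2 / α) * (opNorm A ^ 2 * (v ⬝ᵥ v))) ^ k := by
          refine mul_le_mul_of_nonneg_left (h1.trans ?_) (by positivity)
          gcongr
      _ = _ := by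
          rw [← mul_pow]
          congr 1
          field_simp

end
end GM

/-- large-range moment estimates for `|AX|`. -/
theorem statement7 :
    ∃ c₁ c₂ C : ℝ, 0 < c₁ ∧ 0 < c₂ ∧ 0 < C ∧
      ∀ (n : ℕ), 1 ≤ n →
      ∀ (Ω : Type) (_mΩ : MeasurableSpace Ω) (P : Measure Ω),
        IsProbabilityMeasure P →
        ∀ (X : Ω → EuclideanSpace ℝ (Fin n)) (f : EuclideanSpace ℝ (Fin n) → ℝ)
          (α b : ℝ) (A : Matrix (Fin n) (Fin n) ℝ),
          HasDensityFn P X f → IsLogConcaveFn f → Isotropic P X →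
          1 ≤ α → α ≤ 2 → IsPsiAlpha P X α b →
          hsNorm A ^ 2 = n →
          ∀ p : ℝ, p ≠ 0 →
            c₁ * ((n : ℝ) / (opNorm A ^ 2 * b ^ 2)) ^ (α / (2 * (α + 2))) ≤ |p - 2| →
            |p - 2| ≤ c₂ * ((n : ℝ) / (opNorm A ^ 2 * b ^ 2)) ^ (α / 2) →
            1 - C * (|p - 2| / ((n : ℝ) / (opNorm A ^ 2 * b ^ 2)) ^ (α / 2)) ^ (1/(α+1)) ≤
                (∫ ω, ‖mApp A (X ω)‖ ^ p ∂P) ^ (1/p) /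
                  (∫ ω, ‖mApp A (X ω)‖ ^ (2:ℝ) ∂P) ^ ((1:ℝ)/2) ∧
              (∫ ω, ‖mApp A (X ω)‖ ^ p ∂P) ^ (1/p) /
                  (∫ ω, ‖mApp A (X ω)‖ ^ (2:ℝ) ∂P) ^ ((1:ℝ)/2) ≤
                1 + C * (|p - 2| / ((n : ℝ) / (opNorm A ^ 2 * b ^ 2)) ^ (α / 2)) ^ (1/(α+1)) := by
  refine ⟨4, GM.e0 ^ 3, GM.KK * Real.exp GM.KK, by norm_num, pow_pos GM.e0_pos 3, mul_pos GM.KK_pos (Real.exp_pos _), ?_⟩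
  intro n hn Ω _ P _ X f α b A hd hf h ha ha2 hp hA p hp0 h1 h2
  have hb := GM.b_pos hn h hp
  have ho := GM.op_pos hn hA
  have hn0 : (0:ℝ) < n := by exact_mod_cast hn
  have hm : Measurable (fun ω => GM.TA A (X ω)) := (GM.TA_meas A).comp hd.1
  haveI : IsProbabilityMeasure (P.map fun ω => GM.TA A (X ω)) := Measure.isProbabilityMeasure_map hm.aemeasurable
  have hc := GM.core (ν := P.map fun ω => GM.TA A (X ω)) ha ha2 (by positivity) 
    (fun k hk => GM.nu_good hn hd hf h ha hp hA k hk) h1 h2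
  have e1 : ∫ y, (y ⬝ᵥ y) ^ (p/2) ∂(P.map fun ω => GM.TA A (X ω)) = ((n:ℝ) ^ (p/2))⁻¹ * ∫ ω, ‖mApp A (X ω)‖ ^ p ∂P := by
    rw [integral_map hm.aemeasurable (Measurable.aestronglyMeasurable (by fun_prop)), ← integral_const_mul]
    congr 1
    ext ω
    rw [GM.TA_self, Real.div_rpow (by positivity) hn0.le, ← Real.rpow_natCast, ← Real.rpow_mul (norm_nonneg _)]
    rw [show ((2:ℕ):ℝ) * (p/2) = p by push_cast; ring]
    ring
  have e2 : ∫ ω, ‖mApp A (X ω)‖ ^ (2:ℝ) ∂P = n := by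
    rw [← hA, ← GM.hs_eq h A]
    simp
  have e3 : (∫ y, (y ⬝ᵥ y) ^ (p/2) ∂(P.map fun ω => GM.TA A (X ω))) ^ (1/p) = 
      (∫ ω, ‖mApp A (X ω)‖ ^ p ∂P) ^ (1/p) / (∫ ω, ‖mApp A (X ω)‖ ^ (2:ℝ) ∂P) ^ ((1:ℝ)/2) := by
    rw [e1, e2, Real.mul_rpow (by positivity) (integral_nonneg fun ω => by positivity), 
      Real.inv_rpow (by positivity), ← Real.rpow_mul hn0.le, show p/2 * (1/p) = (1:ℝ)/2 by field_simp]
    ring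
  rw [← e3]
  exact hc
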